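/- Let G be a plane graph with no cycle of length 5 and no cycle of length 6, let p ∈ V(G), and let L be a (*,1)-list assignment on G with |L(p)| = 1 and |L(v)| = 3 for every vertex v ∈ V(G) other than p. Then G is L-colorable. -/

import Mathlib

open Set

namespace ChoosSep

/-- `G` has a cycle of length `n`. -/
def HasCycleLen {V : Type} (G : SimpleGraph V) (n : ℕ) : Prop :=
  ∃ (v : V) (c : G.Walk v v), c.IsCycle ∧ c.length = n

/-- `G` has a proper coloring choosing each color from the list `L v`. -/
def ColorableWith {V : Type} (G : SimpleGraph V) (L : V → Finset ℕ) : Prop :=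
  ∃ φ : V → ℕ, (∀ v, φ v ∈ L v) ∧ ∀ ⦃u v⦄, G.Adj u v → φ u ≠ φ v

/-- `G` is `(k,d)`-choosable: it has an `L`-coloring for every list assignment
giving each vertex at least `k` colors and any two adjacent vertices at most `d`
common colors. -/
def Choosable {V : Type} (G : SimpleGraph V) (k d : ℕ) : Prop :=
  ∀ L : V → Finset ℕ, (∀ v, k ≤ (L v).card) →
    (∀ ⦃u v⦄, G.Adj u v → ((L u) ∩ (L v)).card ≤ d) →
    ColorableWith G L

/-- The closed straight segment between two points of the plane. -/
def seg (x y : ℝ × ℝ) : Set (ℝ × ℝ) := segment ℝ x y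

/-- A straight-line plane embedding of `G`: vertices go to distinct points, edges are
drawn as straight segments, two distinct edges meet only in common endpoints, and no
vertex lies on the drawing of an edge it does not belong to.  By Fáry's theorem a
finite simple graph admits such an embedding iff it is planar. -/
structure PlaneEmb {V : Type} (G : SimpleGraph V) where
  pos : V → ℝ × ℝ
  inj : Function.Injective pos
  edges_meet : ∀ ⦃a b c d : V⦄, G.Adj a b → G.Adj c d → s(a, b) ≠ s(c, d) →
    seg (pos a) (pos b) ∩ seg (pos c) (pos d) ⊆ ({pos a, pos b} ∩ {pos c, pos d} : Set (ℝ × ℝ))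
  vertex_off : ∀ ⦃a b v : V⦄, G.Adj a b → v ≠ a → v ≠ b → pos v ∉ seg (pos a) (pos b)

/-- `G` is planar: it admits a plane embedding. -/
def IsPlanar {V : Type} (G : SimpleGraph V) : Prop := Nonempty (PlaneEmb G)

end ChoosSep

namespace ChoosSep

open Classical in
/-- Any finite set of points with distinct real labels carries a cyclic permutation sending each
point to the one with the next smaller label, and the lowest one to the highest one. -/
theorem exists_descending_cycle {V : Type} [Fintype V] (s : Finset V) (θ : V → ℝ)
    (hθ : Set.InjOn θ s) :
    ∃ σ : Equiv.Perm V, σ.IsCycleOn s ∧ ∀ x ∈ s,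
      (θ (σ x) < θ x ∧ ∀ y ∈ s, θ y ≤ θ (σ x) ∨ θ x ≤ θ y) ∨
        ∀ y ∈ s, θ x ≤ θ y ∧ θ y ≤ θ (σ x) := by
  let r : V → V → Prop := fun a b => θ b ≤ θ a
  have : Std.Total r := ⟨fun a b => le_total _ _⟩
  have : IsTrans V r := ⟨fun a b c h1 h2 => le_trans h2 h1⟩
  set l := s.toList.insertionSort r with hl
  have hperm : l.Perm s.toList := List.perm_insertionSort r _
  have hnd : l.Nodup := hperm.nodup_iff.2 s.nodup_toList
  have hmem : ∀ a, a ∈ l ↔ a ∈ s := fun a => by rw [hperm.mem_iff, Finset.mem_toList]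
  have hsort : l.Pairwise r := List.pairwise_insertionSort r _
  have hmono : ∀ i j (hi : i < l.length) (hj : j < l.length), i ≤ j → θ l[j] ≤ θ l[i] := by
    intro i j hi hj hij
    rcases hij.eq_or_lt with rfl | h
    · exact le_rfl
    · exact List.pairwise_iff_getElem.1 hsort i j hi hj h
  refine ⟨l.formPerm, ?_, ?_⟩
  · have := hnd.isCycleOn_formPerm
    convert this using 1
    ext a; simp [hmem]
  · intro x hx
    obtain ⟨i, hi, rfl⟩ := List.getElem_of_mem ((hmem x).2 hx)
    by_cases h : i + 1 < l.length
    · left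
      rw [List.formPerm_apply_lt_getElem _ hnd _ h]
      constructor
      · refine lt_of_le_of_ne (hmono _ _ _ _ (Nat.le_succ i)) fun he => ?_
        have := hθ ((hmem _).1 (List.getElem_mem h)) ((hmem _).1 (List.getElem_mem hi)) he
        have := (hnd.getElem_inj_iff).1 this
        omega
      · intro y hy
        obtain ⟨j, hj, rfl⟩ := List.getElem_of_mem ((hmem y).2 hy)
        rcases Nat.lt_or_ge i j with h' | h'
        · left; exact hmono _ _ _ _ h'
        · right; exact hmono _ _ _ _ h'
    · right
      intro y hy
      obtain ⟨j, hj, rfl⟩ := List.getElem_of_mem ((hmem y).2 hy)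
      have he : (i + 1) % l.length = 0 := by
        have : i + 1 = l.length := by omega
        rw [this, Nat.mod_self]
      rw [List.formPerm_apply_getElem _ hnd]
      simp only [he]
      exact ⟨hmono _ _ _ _ (by omega), hmono _ _ _ _ (by omega)⟩

theorem arg_neg_div_of_lt {a b : ℂ} (ha : a ≠ 0) (hb : b ≠ 0) (h : a.arg < b.arg) :
    (-b / a).arg = b.arg - a.arg - Real.pi := by
  have h1 : ((-b / a).arg : Real.Angle) = ((b.arg - a.arg - Real.pi : ℝ) : Real.Angle) := by
    rw [Complex.arg_div_coe_angle (neg_ne_zero.2 hb) ha, Complex.arg_neg_coe_angle hb]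
    rw [Real.Angle.coe_sub, Real.Angle.coe_sub, Real.Angle.sub_coe_pi_eq_add_coe_pi]
    abel
  rw [Complex.arg_coe_angle_eq_iff_eq_toReal.1 h1, Real.Angle.toReal_coe_eq_self_iff]
  have := Complex.neg_pi_lt_arg a
  have := Complex.arg_le_pi b
  have := Real.pi_pos
  constructor <;> linarith

theorem arg_neg_div_of_le {a b : ℂ} (ha : a ≠ 0) (hb : b ≠ 0) (h : b.arg ≤ a.arg) :
    (-b / a).arg = b.arg - a.arg + Real.pi := by
  have h1 : ((-b / a).arg : Real.Angle) = ((b.arg - a.arg + Real.pi : ℝ) : Real.Angle) := by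
    rw [Complex.arg_div_coe_angle (neg_ne_zero.2 hb) ha, Complex.arg_neg_coe_angle hb]
    rw [Real.Angle.coe_add, Real.Angle.coe_sub]
    abel
  rw [Complex.arg_coe_angle_eq_iff_eq_toReal.1 h1, Real.Angle.toReal_coe_eq_self_iff]
  have := Complex.neg_pi_lt_arg b
  have := Complex.arg_le_pi a
  have := Real.pi_pos
  constructor <;> linarith

/-- A straight-line drawing in the complex plane. -/
structure ComplexDrawing {V : Type} (G : SimpleGraph V) (P : V → ℂ) : Prop where
  inj : Function.Injective P
  disjoint : ∀ ⦃a b c d : V⦄, G.Adj a b → G.Adj c d → a ≠ c → a ≠ d → b ≠ c → b ≠ d →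
    ∀ x ∈ segment ℝ (P a) (P b), x ∉ segment ℝ (P c) (P d)
  off : ∀ ⦃a b v : V⦄, G.Adj a b → v ≠ a → v ≠ b → P v ∉ segment ℝ (P a) (P b)

theorem PlaneEmb.exists_complexDrawing {V : Type} {G : SimpleGraph V} (E : PlaneEmb G) :
    ∃ P, ComplexDrawing G P := by
  let e := Complex.equivRealProdCLM.symm
  have hseg : ∀ a b : V, ∀ x, x ∈ segment ℝ (e (E.pos a)) (e (E.pos b)) ↔
      ∃ y ∈ seg (E.pos a) (E.pos b), e y = x := by
    intro a b x
    have := image_segment ℝ (e : (ℝ × ℝ) →ₗ[ℝ] ℂ).toAffineMap (E.pos a) (E.pos b)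
    have h2 : segment ℝ (e (E.pos a)) (e (E.pos b)) = (fun y => e y) '' seg (E.pos a) (E.pos b) :=
      this.symm
    rw [h2]; rfl
  refine ⟨fun v => e (E.pos v), fun a b h => E.inj (e.injective h), ?_, ?_⟩
  · intro a b c d hab hcd h1 h2 h3 h4 x hx hx'
    obtain ⟨y, hy, rfl⟩ := (hseg _ _ _).1 hx
    obtain ⟨y', hy', he⟩ := (hseg _ _ _).1 hx'
    rw [e.injective he] at hy'
    have := E.edges_meet hab hcd (by simp [h1, h2]) ⟨hy, hy'⟩
    simp only [Set.mem_inter_iff, Set.mem_insert_iff, Set.mem_singleton_iff] at this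
    obtain ⟨h5, h6⟩ := this
    have hi := E.inj
    rcases h5 with rfl | rfl <;> rcases h6 with h | h <;> first
      | exact h1 (hi h) | exact h2 (hi h) | exact h3 (hi h) | exact h4 (hi h)
  · intro a b v hab h1 h2 hv
    obtain ⟨y, hy, he⟩ := (hseg _ _ _).1 hv
    rw [e.injective he] at hy
    exact E.vertex_off hab h1 h2 hy

end ChoosSep

namespace ChoosSep

section Homotopy

variable {V : Type} {G : SimpleGraph V} {P : V → ℂ}

open Classical in
/-- The vector seen from the point at parameter `t` of the segment from `P u` to `P v` when looking
at `P a`; the two ends of the segment are seen in fixed directions. -/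
noncomputable def sight (P : V → ℂ) (u v : V) (t : ℝ) (a : V) : ℂ :=
  if a = v then P v - P u else if a = u then -(P v - P u) else P a - (P u + t * (P v - P u))

theorem ComplexDrawing.sub_ne_zero (D : ComplexDrawing G P) {u v : V} (h : u ≠ v) :
    P v - P u ≠ 0 := _root_.sub_ne_zero.2 fun he => h (D.inj he.symm)

/-- A ratio of two nonzero numbers lies on the slit exactly when a segment passes through zero. -/
theorem div_mem_slitPlane {x y : ℂ} (hx : x ≠ 0)
    (h : ∀ s t : ℝ, 0 ≤ s → 0 ≤ t → s + t = 1 → s * x + t * y ≠ 0) :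
    y / x ∈ Complex.slitPlane := by
  rw [Complex.mem_slitPlane_iff_not_le_zero]
  intro hle
  obtain ⟨h1, h2⟩ := Complex.le_def.1 hle
  simp only [Complex.zero_re, Complex.zero_im] at h1 h2
  set q := (y / x).re with hq
  have hyx : y = q * x := by
    have : y / x = (q : ℂ) := Complex.ext (by simp [hq]) (by simpa using h2)
    rw [← this]; field_simp
  have h1q : (0 : ℝ) < 1 - q := by linarith
  have h1q' : ((1 : ℂ) - q) ≠ 0 := by
    have : ((1 - q : ℝ) : ℂ) ≠ 0 := by exact_mod_cast h1q.ne'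
    simpa using this
  refine h (-q / (1 - q)) (1 / (1 - q)) (by apply div_nonneg <;> linarith)
    (by positivity) (by field_simp; ring) ?_
  rw [hyx]
  push_cast
  field_simp
  ring

theorem sight_ratio_end (D : ComplexDrawing G P) {u v b : V} (huv : G.Adj u v) (hvb : G.Adj v b)
    (hbu : b ≠ u) {t : ℝ} (ht : t ∈ Set.Icc (0 : ℝ) 1) :
    (P b - (P u + t * (P v - P u))) / (P v - P u) ∈ Complex.slitPlane := by
  refine div_mem_slitPlane (D.sub_ne_zero huv.ne) fun s r hs hr hsr he => ?_
  have hr0 : r ≠ 0 := by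
    rintro rfl
    have : s = 1 := by linarith
    subst this
    exact D.sub_ne_zero huv.ne (by simpa using he)
  have hr0' : (r : ℂ) ≠ 0 := by exact_mod_cast hr0
  have hrpos : 0 < r := lt_of_le_of_ne hr (Ne.symm hr0)
  have hb : P b = P u + ((t - s / r : ℝ) : ℂ) * (P v - P u) := by
    push_cast
    field_simp
    linear_combination he
  have hsr' : 0 ≤ s / r := by positivity
  by_cases hc : 0 ≤ t - s / r
  · refine D.off huv hbu hvb.ne' ⟨1 - (t - s / r), t - s / r, by linarith [ht.2], hc, by ring, ?_⟩
    rw [hb]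
    simp only [Complex.real_smul]
    push_cast
    ring
  · push Not at hc
    set q := s / r - t
    have hq : 0 < q := by linarith
    refine D.off hvb huv.ne hbu.symm ⟨q / (1 + q), 1 / (1 + q), by positivity, by positivity,
      by field_simp; ring, ?_⟩
    have : t - s / r = -q := by ring
    rw [hb, this]
    have : (1 + q : ℂ) ≠ 0 := by
      have : ((1 + q : ℝ) : ℂ) ≠ 0 := by exact_mod_cast (by linarith : (1 + q : ℝ) ≠ 0)
      simpa using this
    simp only [Complex.real_smul]
    push_cast
    field_simp
    ring

theorem sight_ratio_start (D : ComplexDrawing G P) {u v b : V} (huv : G.Adj u v)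
    (hub : G.Adj u b) (hbv : b ≠ v) {t : ℝ} (ht : t ∈ Set.Icc (0 : ℝ) 1) :
    (P b - (P u + t * (P v - P u))) / (-(P v - P u)) ∈ Complex.slitPlane := by
  have := sight_ratio_end D huv.symm hub hbv (t := 1 - t) ⟨by linarith [ht.2], by linarith [ht.1]⟩
  convert this using 1
  push_cast
  congr 1 <;> ring

theorem sight_ratio_off (D : ComplexDrawing G P) {u v a b : V} (huv : G.Adj u v)
    (hab : G.Adj a b) (hau : a ≠ u) (hav : a ≠ v) (hbu : b ≠ u) (hbv : b ≠ v)
    {t : ℝ} (ht : t ∈ Set.Icc (0 : ℝ) 1) :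
    (P b - (P u + t * (P v - P u))) / (P a - (P u + t * (P v - P u))) ∈ Complex.slitPlane := by
  have key : P u + t * (P v - P u) ∈ segment ℝ (P u) (P v) := by
    refine ⟨1 - t, t, by linarith [ht.2], ht.1, by ring, ?_⟩
    simp only [Complex.real_smul]
    push_cast
    ring
  have hno := D.disjoint huv hab hau.symm hbu.symm hav.symm hbv.symm _ key
  refine div_mem_slitPlane ?_ fun s r hs hr hsr he => hno ⟨s, r, hs, hr, hsr, ?_⟩
  · intro h0
    apply hno
    rw [← sub_eq_zero.1 h0]
    exact left_mem_segment ℝ _ _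
  · simp only [Complex.real_smul]
    obtain rfl : r = 1 - s := by linarith
    push_cast at he ⊢
    linear_combination he

theorem sight_ratio (D : ComplexDrawing G P) {u v a b : V} (huv : G.Adj u v)
    (hab : G.Adj a b) (hne : s(a, b) ≠ s(u, v)) {t : ℝ} (ht : t ∈ Set.Icc (0 : ℝ) 1) :
    sight P u v t b / sight P u v t a ∈ Complex.slitPlane := by
  have inv : ∀ x y : ℂ, x / y ∈ Complex.slitPlane → y / x ∈ Complex.slitPlane := by
    intro x y h
    rw [Complex.mem_slitPlane_iff_arg] at h ⊢
    rw [← inv_div, Complex.arg_inv, if_neg h.1]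
    refine ⟨fun h' => ?_, inv_ne_zero h.2⟩
    have := Complex.neg_pi_lt_arg (x / y)
    linarith
  have hne1 : ¬ (a = u ∧ b = v) := by rintro ⟨rfl, rfl⟩; exact hne rfl
  have hne2 : ¬ (a = v ∧ b = u) := by rintro ⟨rfl, rfl⟩; exact hne Sym2.eq_swap
  unfold sight
  by_cases hav : a = v
  · subst hav
    have hbu : b ≠ u := fun h => hne2 ⟨rfl, h⟩
    rw [if_neg hab.ne', if_neg hbu, if_pos rfl]
    exact sight_ratio_end D huv hab hbu ht
  by_cases hau : a = u
  · subst hau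
    have hbv : b ≠ v := fun h => hne1 ⟨rfl, h⟩
    rw [if_neg hbv, if_neg hab.ne', if_neg hav, if_pos rfl]
    exact sight_ratio_start D huv hab hbv ht
  by_cases hbv : b = v
  · subst hbv
    rw [if_pos rfl, if_neg hav, if_neg hau]
    exact inv _ _ (sight_ratio_end D huv hab.symm hau ht)
  by_cases hbu : b = u
  · subst hbu
    rw [if_pos rfl, if_neg hav, if_neg hau, if_neg hbv]
    exact inv _ _ (sight_ratio_start D huv hab.symm hav ht)
  rw [if_neg hbv, if_neg hbu, if_neg hav, if_neg hau]
  exact sight_ratio_off D huv hab hau hav hbu hbv ht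

theorem sight_ne_zero (D : ComplexDrawing G P) {u v a : V} (huv : G.Adj u v) {t : ℝ}
    (ht : t ∈ Set.Icc (0 : ℝ) 1) : sight P u v t a ≠ 0 := by
  unfold sight
  have h := D.sub_ne_zero huv.ne
  split_ifs with h1 h2
  · exact h
  · exact neg_ne_zero.2 h
  · intro h0
    refine D.off huv h2 h1 ⟨1 - t, t, by linarith [ht.2], ht.1, by ring, ?_⟩
    rw [sub_eq_zero.1 h0]
    simp only [Complex.real_smul]
    push_cast
    ring

open Classical in
/-- The derivative of `sight`. -/
noncomputable def sightDeriv (P : V → ℂ) (u v a : V) : ℂ :=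
  if a = v then 0 else if a = u then 0 else -(P v - P u)

theorem hasDerivAt_sight (u v a : V) (t : ℝ) :
    HasDerivAt (fun t => sight P u v t a) (sightDeriv P u v a) t := by
  unfold sight sightDeriv
  split_ifs with h1 h2
  · exact hasDerivAt_const _ _
  · exact hasDerivAt_const _ _
  · have h := ((Complex.ofRealCLM.hasDerivAt (x := t)).mul_const (P v - P u)).const_add (P u)
    simpa using h.const_sub (P a)

open Classical in
/-- The visual angle of the edge `ab` seen while moving along the edge `uv`. -/
noncomputable def sightAngle (P : V → ℂ) (u v : V) (t : ℝ) (a b : V) : ℝ :=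
  if s(a, b) = s(u, v) then 0 else (sight P u v t b / sight P u v t a).arg

theorem hasDerivAt_sightAngle (D : ComplexDrawing G P) {u v a b : V} (huv : G.Adj u v)
    (hab : G.Adj a b) {t : ℝ} (ht : t ∈ Set.Icc (0 : ℝ) 1) :
    HasDerivAt (fun t => sightAngle P u v t a b)
      ((sightDeriv P u v b / sight P u v t b).im - (sightDeriv P u v a / sight P u v t a).im) t := by
  have hsa := sight_ne_zero D (a := a) huv ht
  have hsb := sight_ne_zero D (a := b) huv ht
  unfold sightAngle
  by_cases hne : s(a, b) = s(u, v)
  · simp only [hne, if_true]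
    have h0 : sightDeriv P u v a = 0 ∧ sightDeriv P u v b = 0 := by
      unfold sightDeriv
      rcases Sym2.eq_iff.1 hne with ⟨rfl, rfl⟩ | ⟨rfl, rfl⟩ <;> simp
    rw [h0.1, h0.2]
    simpa using hasDerivAt_const t (0 : ℝ)
  · simp only [hne, if_false]
    have h := ((hasDerivAt_sight u v b t).fun_div (hasDerivAt_sight u v a t) hsa).clog_real
      (sight_ratio D huv hab hne ht)
    have h2 := Complex.imCLM.hasFDerivAt.comp_hasDerivAt t h
    have h3 : (Complex.imCLM ∘ fun t => Complex.log (sight P u v t b / sight P u v t a)) =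
        fun t => (sight P u v t b / sight P u v t a).arg :=
      funext fun t => Complex.log_im _
    rw [h3] at h2
    refine h2.congr_deriv ?_
    simp only [Complex.imCLM_apply, ← Complex.sub_im]
    congr 1
    field_simp

theorem sightAngle_zero_swap (u v a b : V) (huv : u ≠ v) :
    sightAngle P u v 0 a b = sightAngle P v u 1 a b := by
  have : ∀ a, sight P u v 0 a = sight P v u 1 a := by
    intro a
    unfold sight
    split_ifs with h1 h2 h3 <;> simp_all
  unfold sightAngle
  rw [this, this, Sym2.eq_swap (a := u)]

theorem sum_sightAngle_symm [Fintype V] (D : ComplexDrawing G P) {u v : V} (huv : G.Adj u v)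
    {z : V → V → ℝ} (hanti : ∀ a b, z b a = -z a b) (hsupp : ∀ a b, ¬ G.Adj a b → z a b = 0)
    (hdiv : ∀ a, ∑ b, z a b = 0) :
    ∑ a, ∑ b, z a b * sightAngle P u v 1 a b = ∑ a, ∑ b, z a b * sightAngle P v u 1 a b := by
  have hd : ∀ t ∈ Set.Icc (0 : ℝ) 1,
      HasDerivAt (fun t => ∑ a, ∑ b, z a b * sightAngle P u v t a b) 0 t := by
    intro t ht
    set k : V → ℝ := fun a => (sightDeriv P u v a / sight P u v t a).im with hk
    have h : HasDerivAt (fun t => ∑ a, ∑ b, z a b * sightAngle P u v t a b)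
        (∑ a, ∑ b, z a b * (k b - k a)) t := by
      refine HasDerivAt.fun_sum fun a _ => HasDerivAt.fun_sum fun b _ => ?_
      by_cases hab : G.Adj a b
      · exact (hasDerivAt_sightAngle D huv hab ht).const_mul _
      · simpa [hsupp a b hab] using hasDerivAt_const t (0 : ℝ)
    convert h using 1
    simp only [mul_sub, Finset.sum_sub_distrib]
    have h1 : ∑ a, ∑ b, z a b * k a = 0 := by
      simp only [← Finset.sum_mul, hdiv, zero_mul, Finset.sum_const_zero]
    have h2 : ∑ a, ∑ b, z a b * k b = 0 := by
      rw [Finset.sum_comm]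
      have : ∀ y, ∑ x, z x y = 0 := by
        intro y
        simp_rw [fun x => hanti y x, Finset.sum_neg_distrib, hdiv, neg_zero]
      simp only [← Finset.sum_mul, this, zero_mul, Finset.sum_const_zero]
    rw [h1, h2, sub_zero]
  have := constant_of_has_deriv_right_zero (a := (0 : ℝ)) (b := 1)
    (f := fun t => ∑ a, ∑ b, z a b * sightAngle P u v t a b)
    (fun t ht => (hd t ht).continuousAt.continuousWithinAt)
    (fun t ht => (hd t ⟨ht.1, ht.2.le⟩).hasDerivWithinAt) 1 (by simp)
  simpa only [sightAngle_zero_swap u v _ _ huv.ne] using this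

end Homotopy

end ChoosSep

namespace ChoosSep

/-- A rotation system: a cyclic order of the neighbours around every vertex. -/
structure Rotation {V : Type} (G : SimpleGraph V) where
  next : V → Equiv.Perm V
  cyclic : ∀ v, (next v).IsCycleOn (G.neighborSet v)

namespace Rotation

variable {V : Type} {G : SimpleGraph V} (R : Rotation G)

theorem adj_next {u v : V} (h : G.Adj v u) : G.Adj v (R.next v u) :=
  (R.cyclic v).1.mapsTo h

theorem adj_prev {u v : V} (h : G.Adj v u) : G.Adj v ((R.next v).symm u) := by
  obtain ⟨w, hw, he⟩ := (R.cyclic v).1.surjOn h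
  rw [← he, Equiv.symm_apply_apply]
  exact hw

/-- The face permutation: traverse a dart, then turn to the next edge around its head. -/
def face : Equiv.Perm G.Dart where
  toFun d := ⟨(d.snd, R.next d.snd d.fst), R.adj_next d.adj.symm⟩
  invFun d := ⟨((R.next d.fst).symm d.snd, d.fst), (R.adj_prev d.adj).symm⟩
  left_inv d := by
    apply SimpleGraph.Dart.ext
    simp
  right_inv d := by
    apply SimpleGraph.Dart.ext
    simp

@[simp] theorem face_fst (d : G.Dart) : (R.face d).fst = d.snd := rfl

@[simp] theorem face_snd (d : G.Dart) : (R.face d).snd = R.next d.snd d.fst := rfl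

end Rotation

section Potential

variable {V : Type} {G : SimpleGraph V} {P : V → ℂ}

theorem sight_one_of_ne {v w a : V} (h : a ≠ v) : sight P w v 1 a = P a - P v := by
  unfold sight
  rw [if_neg h]
  split_ifs with h'
  · subst h'; ring
  · push_cast; ring

theorem sightAngle_self_left {v w y : V} (hyv : y ≠ v) (hyw : y ≠ w) :
    sightAngle P w v 1 v y = (-(P y - P v) / (P w - P v)).arg := by
  unfold sightAngle
  rw [if_neg, sight_one_of_ne hyv]
  · unfold sight
    rw [if_pos rfl, neg_div, ← div_neg, neg_sub]
  · intro h
    rcases Sym2.eq_iff.1 h with ⟨_, h⟩ | ⟨_, h⟩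
    · exact hyv h
    · exact hyw h

theorem sightAngle_self_right (D : ComplexDrawing G P) {v w y : V} (hvw : G.Adj v w)
    (hvy : G.Adj v y) : sightAngle P w v 1 y v = -sightAngle P w v 1 v y := by
  by_cases hyw : y = w
  · subst hyw
    simp [sightAngle, Sym2.eq_swap]
  · have hne : s(v, y) ≠ s(w, v) := by
      intro h
      rcases Sym2.eq_iff.1 h with ⟨_, h⟩ | ⟨_, h⟩
      · exact hvy.ne h.symm
      · exact hyw h
    have h := sight_ratio D hvw.symm hvy hne (t := 1) (by simp)
    unfold sightAngle
    rw [if_neg (show s(y, v) ≠ s(w, v) by rwa [Sym2.eq_swap]), if_neg hne, ← inv_div, Complex.arg_inv,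
      if_neg (Complex.slitPlane_arg_ne_pi h)]

theorem injOn_arg_sub (D : ComplexDrawing G P) (v : V) :
    Set.InjOn (fun y => (P y - P v).arg) (G.neighborSet v) := by
  intro y hy w hw he
  by_contra hyw
  have hvy : G.Adj v y := hy
  have hvw : G.Adj v w := hw
  have hne : s(v, y) ≠ s(w, v) := by
    intro h
    rcases Sym2.eq_iff.1 h with ⟨_, h⟩ | ⟨_, h⟩
    · exact hvy.ne h.symm
    · exact hyw h
  have h := sight_ratio D hvw.symm hvy hne (t := 1) (by simp)
  have h2 := sightAngle_self_left (P := P) hvy.ne' hyw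
  unfold sightAngle at h2
  rw [if_neg hne] at h2
  apply Complex.slitPlane_arg_ne_pi h
  rw [h2, arg_neg_div_of_le (D.sub_ne_zero hvw.ne) (D.sub_ne_zero hvy.ne) he.le]
  simp only at he
  rw [he]
  ring

variable [Fintype V]

theorem sum_sightAngle_next (D : ComplexDrawing G P) {v w x : V} (hvw : G.Adj v w)
    (hvx : G.Adj v x)
    (hwx : ((P w - P v).arg < (P x - P v).arg ∧ ∀ y, G.Adj v y →
        (P y - P v).arg ≤ (P w - P v).arg ∨ (P x - P v).arg ≤ (P y - P v).arg) ∨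
      ∀ y, G.Adj v y → (P x - P v).arg ≤ (P y - P v).arg ∧ (P y - P v).arg ≤ (P w - P v).arg)
    {z : V → V → ℝ} (hanti : ∀ a b, z b a = -z a b) (hsupp : ∀ a b, ¬ G.Adj a b → z a b = 0)
    (hdiv : ∀ a, ∑ b, z a b = 0) :
    ∑ a, ∑ b, z a b * sightAngle P w v 1 a b + 2 * Real.pi * z v w =
      ∑ a, ∑ b, z a b * sightAngle P x v 1 a b - 2 * Real.pi * z v x := by
  classical
  set g : V → V → ℝ := fun a b =>
    z a b * sightAngle P w v 1 a b - z a b * sightAngle P x v 1 a b with hg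
  have hgoff : ∀ a b, a ≠ v → b ≠ v → g a b = 0 := by
    intro a b ha hb
    simp only [hg, sightAngle, sight_one_of_ne ha, sight_one_of_ne hb]
    rw [if_neg, if_neg, sub_self] <;>
    · intro h
      rcases Sym2.eq_iff.1 h with ⟨_, h⟩ | ⟨h, _⟩
      · exact hb h
      · exact ha h
  have hgsymm : ∀ a, g a v = g v a := by
    intro a
    by_cases hva : G.Adj v a
    · simp only [hg]
      rw [sightAngle_self_right D hvw hva, sightAngle_self_right D hvx hva, hanti v a]
      ring
    · simp only [hg]
      rw [hsupp v a hva, hsupp a v (fun h => hva h.symm)]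
      simp
  have hgvv : g v v = 0 := by
    simp only [hg, hsupp v v (G.loopless.irrefl v), zero_mul, sub_self]
  have hsum : ∑ a, ∑ b, g a b = 2 * ∑ y, g v y := by
    have h1 : ∀ a, ∑ b, g a b = (if a = v then ∑ y, g v y else 0) + g v a := by
      intro a
      split_ifs with h
      · subst h; rw [hgvv, add_zero]
      · rw [zero_add, ← hgsymm, Finset.sum_eq_single v]
        · intro b _ hb; exact hgoff a b h hb
        · simp
    rw [Finset.sum_congr rfl fun a _ => h1 a, Finset.sum_add_distrib, Finset.sum_ite_eq',
      if_pos (Finset.mem_univ _)]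
    ring
  have hconst : ∃ c : ℝ, ∀ y, g v y = c * z v y - (if y = w then Real.pi * z v w else 0)
      - (if y = x then Real.pi * z v x else 0) := by
    have hang : ∀ u, G.Adj v u → ∀ y, G.Adj v y → sightAngle P u v 1 v y =
        (P y - P v).arg - (P u - P v).arg + (if y = u then 0 else
          if (P u - P v).arg < (P y - P v).arg then -Real.pi else Real.pi) := by
      intro u hu y hy
      by_cases hyu : y = u
      · subst hyu
        simp [sightAngle, Sym2.eq_swap]
      · rw [sightAngle_self_left hy.ne' hyu, if_neg hyu]
        split_ifs with h
        · rw [arg_neg_div_of_lt (D.sub_ne_zero hu.ne) (D.sub_ne_zero hy.ne) h]; ring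
        · rw [arg_neg_div_of_le (D.sub_ne_zero hu.ne) (D.sub_ne_zero hy.ne) (not_lt.1 h)]
    have hinj := injOn_arg_sub D v
    rcases hwx with ⟨hlt, hbtw⟩ | hext
    · refine ⟨(P x - P v).arg - (P w - P v).arg, fun y => ?_⟩
      have hne : w ≠ x := by rintro rfl; exact lt_irrefl _ hlt
      by_cases hy : G.Adj v y
      · simp only [hg, hang w hvw y hy, hang x hvx y hy]
        by_cases hyw : y = w
        · subst hyw
          simp only [if_true, hne, if_false, if_neg (not_lt.2 hlt.le)]
          ring
        by_cases hyx : y = x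
        · subst hyx
          simp only [if_true, hne.symm, if_false, if_pos hlt]
          ring
        simp only [if_neg hyw, if_neg hyx]
        have hn1 : (P y - P v).arg ≠ (P w - P v).arg := fun h => hyw (hinj hy hvw h)
        have hn2 : (P y - P v).arg ≠ (P x - P v).arg := fun h => hyx (hinj hy hvx h)
        rcases hbtw y hy with h | h
        · rw [if_neg (not_lt.2 h), if_neg (not_lt.2 (h.trans hlt.le))]; ring
        · rw [if_pos (hlt.trans_le h), if_pos (lt_of_le_of_ne h hn2.symm)]; ring
      · have h0 := hsupp v y hy
        have h1 : y ≠ w := by rintro rfl; exact hy hvw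
        have h2 : y ≠ x := by rintro rfl; exact hy hvx
        simp only [hg, h0, h1, h2, zero_mul, mul_zero, if_false, sub_zero]
    · refine ⟨(P x - P v).arg - (P w - P v).arg + 2 * Real.pi, fun y => ?_⟩
      by_cases hy : G.Adj v y
      · simp only [hg, hang w hvw y hy, hang x hvx y hy]
        obtain ⟨h1, h2⟩ := hext y hy
        rw [if_neg (not_lt.2 h2)]
        by_cases hyx : y = x
        · by_cases hyw : y = w
          · rw [← hyw, ← hyx]; simp only [if_true, lt_irrefl, if_false]; ring
          · rw [← hyx]; simp only [if_neg hyw, if_true]; ring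
        · have hn2 : (P y - P v).arg ≠ (P x - P v).arg := fun h => hyx (hinj hy hvx h)
          rw [if_neg hyx, if_pos (lt_of_le_of_ne h1 hn2.symm), if_neg hyx]
          by_cases hyw : y = w
          · rw [← hyw]; simp only [if_true]; ring
          · simp only [if_neg hyw]; ring
      · have h0 := hsupp v y hy
        have h1 : y ≠ w := by rintro rfl; exact hy hvw
        have h2 : y ≠ x := by rintro rfl; exact hy hvx
        simp only [hg, h0, h1, h2, zero_mul, mul_zero, if_false, sub_zero]
  obtain ⟨c, hc⟩ := hconst
  have h3 : ∑ y, g v y = -(Real.pi * z v w) - Real.pi * z v x := by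
    simp only [hc, Finset.sum_sub_distrib, ← Finset.mul_sum, hdiv, Finset.sum_ite_eq',
      Finset.mem_univ, if_true]
    ring
  have h4 : ∑ a, ∑ b, g a b = ∑ a, ∑ b, z a b * sightAngle P w v 1 a b -
      ∑ a, ∑ b, z a b * sightAngle P x v 1 a b := by
    simp only [hg, Finset.sum_sub_distrib]
  rw [h3, h4] at hsum
  linarith

/-- A plane drawing has a rotation system for which every circulation is the difference of a
face potential across the edges. -/
theorem ComplexDrawing.exists_rotation (D : ComplexDrawing G P) :
    ∃ R : Rotation G, ∀ z : V → V → ℝ, (∀ a b, z b a = -z a b) →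
      (∀ a b, ¬ G.Adj a b → z a b = 0) → (∀ a, ∑ b, z a b = 0) →
      ∃ W : G.Dart → ℝ, (∀ d, W (R.face d) = W d) ∧ ∀ d, W d - W d.symm = z d.fst d.snd := by
  classical
  have hex : ∀ v, ∃ σ : Equiv.Perm V, σ.IsCycleOn (G.neighborSet v) ∧ ∀ x, G.Adj v x →
      ((P (σ x) - P v).arg < (P x - P v).arg ∧ ∀ y, G.Adj v y →
        (P y - P v).arg ≤ (P (σ x) - P v).arg ∨ (P x - P v).arg ≤ (P y - P v).arg) ∨
      ∀ y, G.Adj v y →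
        (P x - P v).arg ≤ (P y - P v).arg ∧ (P y - P v).arg ≤ (P (σ x) - P v).arg := by
    intro v
    obtain ⟨σ, h1, h2⟩ := exists_descending_cycle (G.neighborFinset v)
      (fun y => (P y - P v).arg) (by simpa using injOn_arg_sub D v)
    refine ⟨σ, by simpa using h1, fun x hx => by simpa using h2 x (by simpa using hx)⟩
  choose σ hσ1 hσ2 using hex
  refine ⟨⟨σ, hσ1⟩, fun z hanti hsupp hdiv => ?_⟩
  refine ⟨fun d => (∑ a, ∑ b, z a b * sightAngle P d.snd d.fst 1 a b +
    2 * Real.pi * z d.fst d.snd) / (4 * Real.pi), fun d => ?_, fun d => ?_⟩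
  · have h := sum_sightAngle_next D (v := d.snd) (w := σ d.snd d.fst) (x := d.fst)
      ((hσ1 d.snd).1.mapsTo d.adj.symm) d.adj.symm
      (hσ2 d.snd d.fst d.adj.symm) hanti hsupp hdiv
    have h2 := sum_sightAngle_symm D d.adj hanti hsupp hdiv
    simp only [Rotation.face_fst, Rotation.face_snd]
    rw [h, h2, hanti d.fst d.snd]
    ring
  · have h2 := sum_sightAngle_symm D d.adj hanti hsupp hdiv
    have hpi := Real.pi_pos.ne'
    change _ - (∑ a, ∑ b, z a b * sightAngle P d.fst d.snd 1 a b +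
      2 * Real.pi * z d.snd d.fst) / (4 * Real.pi) = _
    rw [h2, hanti d.fst d.snd]
    field_simp
    ring

end Potential

end ChoosSep

namespace ChoosSep

open Classical in
/-- The orbits of a permutation are counted by the reciprocals of the periods of the points. -/
theorem sum_inv_minimalPeriod {D : Type} [Fintype D] (σ : Equiv.Perm D) :
    ∑ d, (1 : ℝ) / Function.minimalPeriod σ d =
      Fintype.card (MulAction.orbitRel.Quotient (Subgroup.zpowers σ) D) := by
  let π : D → MulAction.orbitRel.Quotient (Subgroup.zpowers σ) D := Quotient.mk _
  rw [← Finset.sum_fiberwise Finset.univ π]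
  have h : ∀ q, ∑ d with π d = q, (1 : ℝ) / Function.minimalPeriod σ d = 1 := by
    intro q
    obtain ⟨d₀, rfl⟩ := Quotient.exists_rep q
    have hper : ∀ d, Function.minimalPeriod σ d =
        Fintype.card (MulAction.orbit (Subgroup.zpowers σ) d) := fun d =>
      MulAction.minimalPeriod_eq_card (a := σ) (b := d)
    have hmem : ∀ d, π d = Quotient.mk _ d₀ ↔ d ∈ MulAction.orbit (Subgroup.zpowers σ) d₀ := by
      intro d
      rw [← MulAction.orbitRel_apply]
      exact Quotient.eq
    have h1 : ∀ d, π d = Quotient.mk _ d₀ → (1 : ℝ) / Function.minimalPeriod σ d =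
        1 / Fintype.card (MulAction.orbit (Subgroup.zpowers σ) d₀) := by
      intro d hd
      rw [hper]
      have := MulAction.orbit_eq_iff.2 ((hmem d).1 hd)
      simp only [this]
    rw [Finset.sum_congr rfl fun d hd => h1 d (Finset.mem_filter.1 hd).2, Finset.sum_const]
    have h2 : (Finset.univ.filter fun d => π d = Quotient.mk _ d₀).card =
        Fintype.card (MulAction.orbit (Subgroup.zpowers σ) d₀) := by
      rw [← Set.toFinset_card]
      congr 1
      ext d
      simp [hmem]
    rw [h2, nsmul_eq_mul, mul_one_div_cancel]
    have : 0 < Fintype.card (MulAction.orbit (Subgroup.zpowers σ) d₀) :=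
      Fintype.card_pos_iff.2 ⟨⟨d₀, MulAction.mem_orbit_self d₀⟩⟩
    exact_mod_cast this.ne'
  rw [Finset.sum_congr rfl fun q _ => h q]
  simp

open Classical in
/-- Euler's inequality for a rotation system in which every circulation comes from a
face potential. -/
theorem Rotation.euler {V : Type} [Fintype V] [Nonempty V] {G : SimpleGraph V} (R : Rotation G)
    (hR : ∀ z : V → V → ℝ, (∀ a b, z b a = -z a b) →
      (∀ a b, ¬ G.Adj a b → z a b = 0) → (∀ a, ∑ b, z a b = 0) →
      ∃ W : G.Dart → ℝ, (∀ d, W (R.face d) = W d) ∧ ∀ d, W d - W d.symm = z d.fst d.snd) :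
    (Fintype.card G.Dart : ℝ) / 2 - Fintype.card V + 1 ≤
      ∑ d, (1 : ℝ) / Function.minimalPeriod R.face d := by
  rw [sum_inv_minimalPeriod]
  set Q := MulAction.orbitRel.Quotient (Subgroup.zpowers R.face) G.Dart
  let π : G.Dart → Q := Quotient.mk _
  have hdart : ∀ e : G.edgeSet, ∃ d : G.Dart, d.edge = e := by
    rintro ⟨e, he⟩
    induction e with
    | h a b => exact ⟨⟨(a, b), he⟩, rfl⟩
  choose dart hdart using hdart
  have hcard : Fintype.card G.Dart = 2 * Fintype.card G.edgeSet := by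
    rw [G.dart_card_eq_twice_card_edges, SimpleGraph.edgeFinset_card]
  -- the flow of an edge labelling
  let flow : (G.edgeSet → ℝ) → V → V → ℝ := fun y a b =>
    if h : G.Adj a b then
      (if dart ⟨s(a, b), h⟩ = ⟨(a, b), h⟩ then y ⟨s(a, b), h⟩ else -y ⟨s(a, b), h⟩) else 0
  have hflow_anti : ∀ y a b, flow y b a = -flow y a b := by
    intro y a b
    by_cases h : G.Adj a b
    · have hs : (⟨s(b, a), h.symm⟩ : G.edgeSet) = ⟨s(a, b), h⟩ := Subtype.ext Sym2.eq_swap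
      simp only [flow, dif_pos h, dif_pos h.symm, hs]
      have h1 := (SimpleGraph.dart_edge_eq_iff (dart ⟨s(a, b), h⟩) ⟨(a, b), h⟩).1
        (hdart ⟨s(a, b), h⟩)
      change _ ∨ _ = (⟨(b, a), h.symm⟩ : G.Dart) at h1
      have hne : (⟨(a, b), h⟩ : G.Dart) ≠ ⟨(b, a), h.symm⟩ := by
        intro h'
        exact h.ne (congrArg (fun d : G.Dart => d.fst) h')
      rcases h1 with h1 | h1
      · rw [if_pos h1, if_neg (by rw [h1]; exact hne)]
      · rw [if_pos h1, if_neg (by rw [h1]; exact hne.symm), neg_neg]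
    · simp only [flow, dif_neg h, dif_neg (fun h' : G.Adj b a => h h'.symm), neg_zero]
  have hflow_dart : ∀ y e, flow y (dart e).fst (dart e).snd = y e := by
    intro y e
    have hs : (⟨s((dart e).fst, (dart e).snd), (dart e).adj⟩ : G.edgeSet) = e :=
      Subtype.ext (hdart e)
    simp only [flow, dif_pos (dart e).adj, hs, if_true]
  let div : (G.edgeSet → ℝ) →ₗ[ℝ] (V → ℝ) :=
    { toFun := fun y a => ∑ b, flow y a b
      map_add' := by
        intro y y'
        funext a
        simp only [Pi.add_apply, ← Finset.sum_add_distrib]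
        refine Finset.sum_congr rfl fun b _ => ?_
        simp only [flow]
        split_ifs
        · rfl
        · simp only [Pi.add_apply]; ring
        · simp
      map_smul' := by
        intro c y
        funext a
        simp only [Pi.smul_apply, smul_eq_mul, Finset.mul_sum, RingHom.id_apply]
        refine Finset.sum_congr rfl fun b _ => ?_
        simp only [flow]
        split_ifs <;> simp }
  let bd : (Q → ℝ) →ₗ[ℝ] (G.edgeSet → ℝ) :=
    { toFun := fun f e => f (π (dart e)) - f (π (dart e).symm)
      map_add' := by intro f g; funext e; simp only [Pi.add_apply]; ring
      map_smul' := by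
        intro c f; funext e; simp only [Pi.smul_apply, smul_eq_mul, RingHom.id_apply]; ring }
  have hle : LinearMap.ker div ≤ LinearMap.range bd := by
    intro y hy
    obtain ⟨W, hW1, hW2⟩ := hR (flow y) (hflow_anti y) (fun a b h => dif_neg h)
      (fun a => congrFun (LinearMap.mem_ker.1 hy) a)
    have hinv : ∀ d d' : G.Dart, (MulAction.orbitRel (Subgroup.zpowers R.face) G.Dart) d d' →
        W d = W d' := by
      rintro d d' h
      rw [MulAction.orbitRel_apply] at h
      obtain ⟨⟨g, hg⟩, rfl⟩ := h
      obtain ⟨k, rfl⟩ := Subgroup.mem_zpowers_iff.1 hg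
      change W ((R.face ^ k) d') = W d'
      induction k with
      | zero => simp
      | succ k ih =>
        rw [add_comm, zpow_add, zpow_one, Equiv.Perm.mul_apply, hW1]
        exact ih (Subgroup.zpow_mem_zpowers _ _)
      | pred k ih =>
        have h := hW1 ((R.face ^ (-(k : ℤ) - 1)) d')
        rw [← h, ← Equiv.Perm.mul_apply, ← zpow_one_add]
        have : (1 + (-(k : ℤ) - 1)) = -k := by ring
        rw [this]
        exact ih (Subgroup.zpow_mem_zpowers _ _)
    refine ⟨Quotient.lift W hinv, ?_⟩
    funext e
    change W (dart e) - W (dart e).symm = y e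
    rw [hW2, hflow_dart]
  have hrange : Module.finrank ℝ (LinearMap.range div) + 1 ≤ Fintype.card V := by
    let tot : (V → ℝ) →ₗ[ℝ] ℝ := ∑ v, LinearMap.proj v
    have htot : ∀ f, tot f = ∑ v, f v := by intro f; simp [tot]
    have h1 : LinearMap.range div ≤ LinearMap.ker tot := by
      rintro _ ⟨y, rfl⟩
      rw [LinearMap.mem_ker, htot]
      change ∑ a, ∑ b, flow y a b = 0
      have h2 : ∑ a, ∑ b, flow y a b = -∑ a, ∑ b, flow y a b := by
        conv_lhs => rw [Finset.sum_comm]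
        rw [← Finset.sum_neg_distrib]
        refine Finset.sum_congr rfl fun a _ => ?_
        rw [← Finset.sum_neg_distrib]
        exact Finset.sum_congr rfl fun b _ => hflow_anti y a b
      linarith
    have h2 : Module.finrank ℝ (LinearMap.range tot) = 1 := by
      have : LinearMap.range tot = ⊤ := by
        rw [LinearMap.range_eq_top]
        intro r
        obtain ⟨v⟩ := ‹Nonempty V›
        exact ⟨Pi.single v r, by rw [htot]; simp⟩
      rw [this, finrank_top, Module.finrank_self]
    have h3 := tot.finrank_range_add_finrank_ker
    rw [h2, Module.finrank_fintype_fun_eq_card] at h3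
    have := Submodule.finrank_mono h1
    omega
  have h1 := div.finrank_range_add_finrank_ker
  have h2 := Submodule.finrank_mono hle
  have h3 := bd.finrank_range_add_finrank_ker
  rw [Module.finrank_fintype_fun_eq_card] at h1 h3
  rw [hcard]
  have h4 : Fintype.card G.edgeSet + 1 ≤ Fintype.card Q + Fintype.card V := by omega
  have h5 : (Fintype.card G.edgeSet : ℝ) + 1 ≤ Fintype.card Q + Fintype.card V := by
    exact_mod_cast h4
  push_cast
  linarith

end ChoosSep

namespace ChoosSep
variable {V : Type} {G : SimpleGraph V}

theorem hasCycleLen_five {a b c d e : V} (hab : G.Adj a b) (hbc : G.Adj b c) (hcd : G.Adj c d)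
    (hde : G.Adj d e) (hea : G.Adj e a) (hac : a ≠ c) (had : a ≠ d) (hbd : b ≠ d) (hbe : b ≠ e)
    (hce : c ≠ e) : HasCycleLen G 5 := by
  refine ⟨a, .cons hab (.cons hbc (.cons hcd (.cons hde (.cons hea .nil)))), ?_, rfl⟩
  have := hab.ne; have := hbc.ne; have := hcd.ne; have := hde.ne; have := hea.ne
  rw [SimpleGraph.Walk.cons_isCycle_iff]
  simp_all [SimpleGraph.Walk.isPath_def, eq_comm]

theorem hasCycleLen_six {a b c d e f : V} (hab : G.Adj a b) (hbc : G.Adj b c) (hcd : G.Adj c d)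
    (hde : G.Adj d e) (hef : G.Adj e f) (hfa : G.Adj f a) (hac : a ≠ c) (had : a ≠ d) (hae : a ≠ e)
    (hbd : b ≠ d) (hbe : b ≠ e) (hbf : b ≠ f) (hce : c ≠ e) (hcf : c ≠ f) (hdf : d ≠ f) :
    HasCycleLen G 6 := by
  refine ⟨a, .cons hab (.cons hbc (.cons hcd (.cons hde (.cons hef (.cons hfa .nil))))), ?_, rfl⟩
  have := hab.ne; have := hbc.ne; have := hcd.ne; have := hde.ne; have := hef.ne; have := hfa.ne
  rw [SimpleGraph.Walk.cons_isCycle_iff]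
  simp_all [SimpleGraph.Walk.isPath_def, eq_comm]

end ChoosSep

namespace ChoosSep

variable {V : Type} {G : SimpleGraph V}

/-- The number of neighbours of a vertex. -/
noncomputable def deg (G : SimpleGraph V) (v : V) : ℕ := (G.neighborSet v).ncard

theorem Rotation.pow_next_eq_iff [Finite V] (R : Rotation G) {u v : V} (h : G.Adj v u) (n : ℕ) :
    (R.next v ^ n) u = u ↔ deg G v ∣ n := by
  have hc : (R.next v).IsCycleOn ((G.neighborSet v).toFinite.toFinset : Set V) := by
    simpa using R.cyclic v
  rw [hc.pow_apply_eq (by simpa using h), deg, Set.ncard_eq_toFinset_card _]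

/-- A face of length three. -/
structure Rotation.Tri (R : Rotation G) (u v w : V) : Prop where
  adj₁ : G.Adj u v
  adj₂ : G.Adj v w
  adj₃ : G.Adj w u
  next₁ : R.next v u = w
  next₂ : R.next w v = u
  next₃ : R.next u w = v

theorem Rotation.Tri.rot {R : Rotation G} {u v w : V} (h : R.Tri u v w) : R.Tri v w u :=
  ⟨h.adj₂, h.adj₃, h.adj₁, h.next₂, h.next₃, h.next₁⟩

/-- A face of length four. -/
structure Rotation.Quad (R : Rotation G) (u v w x : V) : Prop where
  adj₁ : G.Adj u v
  adj₂ : G.Adj v w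
  adj₃ : G.Adj w x
  adj₄ : G.Adj x u
  next₁ : R.next v u = w
  next₂ : R.next w v = x
  next₃ : R.next x w = u
  next₄ : R.next u x = v

/-- A sparse graph with a rotation system and a special vertex `p`, to which discharging applies. -/
structure Config (R : Rotation G) (p : V) (X : Finset V) : Prop where
  no5 : ¬ HasCycleLen G 5
  no6 : ¬ HasCycleLen G 6
  deg_p : 2 ≤ deg G p
  deg_of_ne : ∀ v, v ≠ p → 3 ≤ deg G v
  not_triangle : ∀ ⦃u w⦄, G.Adj p u → G.Adj p w → ¬ G.Adj u w
  not_K4 : ∀ ⦃v a b c⦄, v ≠ p → deg G v = 3 → G.Adj v a → G.Adj v b → G.Adj v c →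
    G.Adj a b → G.Adj b c → ¬ G.Adj a c
  mem_X : ∀ ⦃v a b c⦄, v ≠ p → deg G v = 3 → G.Adj v a → G.Adj v b → G.Adj v c →
    G.Adj a b → G.Adj b c → a ≠ c → v ∈ X

namespace Config

variable {R : Rotation G} {p : V} {X : Finset V} (C : Config R p X)
include C

theorem two_le_deg (v : V) : 2 ≤ deg G v := by
  by_cases h : v = p
  · rw [h]; exact C.deg_p
  · exact (C.deg_of_ne v h).trans' (by norm_num)

theorem tri_ne {u v w : V} (huv : G.Adj u v) (hvw : G.Adj v w) (hwu : G.Adj w u) : u ≠ p := by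
  rintro rfl
  exact C.not_triangle huv hwu.symm hvw

theorem cycle5 {a b c d e : V} (hab : G.Adj a b) (hbc : G.Adj b c) (hcd : G.Adj c d)
    (hde : G.Adj d e) (hea : G.Adj e a) (hac : a ≠ c) (had : a ≠ d) (hbd : b ≠ d) (hbe : b ≠ e)
    (hce : c ≠ e) : False :=
  C.no5 (hasCycleLen_five hab hbc hcd hde hea hac had hbd hbe hce)

variable [Finite V]

theorem next_ne {u v : V} (h : G.Adj v u) : R.next v u ≠ u := by
  intro he
  have := (R.pow_next_eq_iff h 1).1 (by simpa using he)
  have := Nat.le_of_dvd one_pos this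
  have := C.two_le_deg v
  omega

theorem next_next_ne {u v : V} (hv : v ≠ p) (h : G.Adj v u) : R.next v (R.next v u) ≠ u := by
  intro he
  have := (R.pow_next_eq_iff h 2).1 (by simpa [pow_two] using he)
  have := Nat.le_of_dvd two_pos this
  have := C.deg_of_ne v hv
  omega

theorem quad_ne {u v w x : V} (h : R.Quad u v w x) : u ≠ w ∧ v ≠ x :=
  ⟨fun h1 => C.next_ne h.adj₁.symm (by rw [h.next₁, h1]),
    fun h1 => C.next_ne h.adj₂.symm (by rw [h.next₂, h1])⟩

theorem not_tri_quad {u v w x z : V} (h : R.Tri v u z) (h' : R.Quad u v w x) : False := by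
  have hu := C.tri_ne h.adj₂ h.adj₃ h.adj₁
  have hv := C.tri_ne h.adj₁ h.adj₂ h.adj₃
  have hzw : z ≠ w := by
    rintro rfl
    exact C.next_next_ne hv h.adj₁ (by rw [h'.next₁, h.next₃])
  have hzx : z ≠ x := by
    rintro rfl
    exact C.next_next_ne hu h.adj₁.symm (by rw [h.next₁, h'.next₄])
  exact C.cycle5 h.adj₂ h.adj₃ h'.adj₂ h'.adj₃ h'.adj₄ h'.adj₁.ne
    (C.quad_ne h').1 hzw hzx (C.quad_ne h').2

theorem not_quad_quad {v w s t y z : V} (hv : v ≠ p) (hw : w ≠ p) (h : R.Quad v w s t)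
    (h' : R.Quad w v y z) : False := by
  obtain ⟨hvs, hwt⟩ := C.quad_ne h
  obtain ⟨hwy, hvz⟩ := C.quad_ne h'
  have hsz : s ≠ z := by
    rintro rfl
    exact C.next_next_ne hw h.adj₁.symm (by rw [h.next₁, h'.next₄])
  have hty : t ≠ y := by
    rintro rfl
    exact C.next_next_ne hv h'.adj₁.symm (by rw [h'.next₁, h.next₄])
  by_cases hsy : s = y
  · subst hsy
    by_cases htz : t = z
    · subst htz
      exact h.adj₁.ne (by rw [← h.next₃, h'.next₃])
    · exact C.cycle5 h.adj₄.symm h.adj₃.symm h'.adj₃ h'.adj₄ h'.adj₁ hvs hvz htz hwt.symm hwy.symm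
  · by_cases htz : t = z
    · subst htz
      exact C.cycle5 h.adj₁ h.adj₂ h.adj₃ h'.adj₃.symm h'.adj₂.symm hvs h.adj₄.ne.symm hwt
        hwy hsy
    · exact C.no6 (hasCycleLen_six h.adj₄.symm h.adj₃.symm h.adj₂.symm h'.adj₄.symm h'.adj₃.symm
        h'.adj₂.symm hvs h.adj₁.ne hvz hwt.symm htz hty hsz hsy hwy)

theorem not_mid_mid {u v w s t : V} (h : R.Tri u v w) (h₁ : R.Tri v u s) (h₂ : R.Tri w v t) :
    False := by
  have hu := C.tri_ne h.adj₁ h.adj₂ h.adj₃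
  have hv := C.tri_ne h₁.adj₁ h₁.adj₂ h₁.adj₃
  have hw := C.tri_ne h₂.adj₁ h₂.adj₂ h₂.adj₃
  have hsw : s ≠ w := by
    rintro rfl
    exact C.next_next_ne hu h.adj₁ (by rw [h₁.next₁, h.next₃])
  have htu : t ≠ u := by
    rintro rfl
    exact C.next_next_ne hv h₂.adj₁.symm (by rw [h₂.next₁, h.next₁])
  by_cases hst : s = t
  · subst hst
    have h3 : deg G v ∣ 3 := by
      rw [← R.pow_next_eq_iff h₂.adj₁.symm 3]
      simp [pow_succ, h₂.next₁, h₁.next₃, h.next₁]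
    have := Nat.le_of_dvd (by norm_num) h3
    exact C.not_K4 hv (le_antisymm this (C.deg_of_ne v hv)) h₁.adj₃.symm h.adj₁.symm h.adj₂
      h₁.adj₂.symm h.adj₃.symm h₂.adj₃
  · exact C.cycle5 h₁.adj₂ h₁.adj₃ h₂.adj₂ h₂.adj₃ h.adj₃ h.adj₁.ne htu.symm hst hsw h.adj₂.ne

theorem mid_apex_ne {a b c d : V} (h₁ : R.Tri b c a) (h₂ : R.Tri c b d) : a ≠ d := by
  rintro rfl
  exact C.next_next_ne (C.tri_ne h₁.adj₁ h₁.adj₂ h₁.adj₃) h₁.adj₁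
    (by rw [h₂.next₁, h₁.next₃])

theorem mid_chord_unique {a b c d b' c' : V} (h₁ : R.Tri b c a) (h₂ : R.Tri c b d)
    (h₁' : R.Tri b' c' a) (h₂' : R.Tri c' b' d) : b' = b := by
  have had := C.mid_apex_ne h₁ h₂
  have key : ∀ x, G.Adj a x → G.Adj x d → x = b ∨ x = c := by
    intro x hax hxd
    by_contra hx
    push Not at hx
    exact C.cycle5 hax hxd h₂.adj₃ h₁.adj₁.symm h₁.adj₃.symm had h₁.adj₂.ne' hx.2 hx.1 h₂.adj₂.ne'
  rcases key b' h₁'.adj₃ h₂'.adj₂ with h | h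
  · exact h
  · rcases key c' h₁'.adj₂.symm h₂'.adj₃.symm with h' | h'
    · subst h h'
      exact absurd (h₁.next₁.symm.trans h₂'.next₁) had
    · exact absurd (h.trans h'.symm) h₁'.adj₁.ne

/-- The two apices of a pair of adjacent triangular faces, if adjacent, lie on no short face. -/
theorem chord_not_short {a b c d : V} (h₁ : R.Tri b c a) (h₂ : R.Tri c b d) :
    (∀ z, ¬ R.Tri a d z) ∧ ∀ x y, ¬ R.Quad a d x y := by
  have had := C.mid_apex_ne h₁ h₂
  have hb := C.tri_ne h₁.adj₁ h₁.adj₂ h₁.adj₃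
  have hc := C.tri_ne h₂.adj₁ h₂.adj₂ h₂.adj₃
  constructor
  · intro z h
    by_cases hzb : z = b
    · subst hzb
      have h3 : deg G z ∣ 3 := by
        rw [← R.pow_next_eq_iff h₁.adj₁ 3]
        simp [pow_succ, h₂.next₁, h₁.next₃, h.next₂]
      have := Nat.le_of_dvd (by norm_num) h3
      exact C.not_K4 hb (le_antisymm this (C.deg_of_ne z hb)) h₁.adj₃.symm h₁.adj₁ h₂.adj₂
        h₁.adj₂.symm h₂.adj₃.symm h.adj₁
    by_cases hzc : z = c
    · subst hzc
      have := h.next₂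
      exact h₁.adj₃.ne (by rw [← h.next₂, h₂.next₃])
    · exact C.cycle5 h.adj₃.symm h.adj₂.symm h₂.adj₃ h₁.adj₁.symm h₁.adj₃.symm h.adj₁.ne
        h₁.adj₂.ne' hzc hzb h₂.adj₂.ne'
  · intro x y h
    obtain ⟨hax, hdy⟩ := C.quad_ne h
    by_cases hxb : x = b
    · subst hxb
      by_cases hyc : y = c
      · subst hyc
        exact C.next_next_ne hb h₁.adj₁ (by rw [h₂.next₁, h.next₂])
      · exact C.cycle5 h.adj₄.symm h.adj₃.symm h₁.adj₁ h₂.adj₃.symm h.adj₁.symm hax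
          h₁.adj₂.ne' hyc hdy.symm h₂.adj₂.ne
    by_cases hxc : x = c
    · subst hxc
      by_cases hyb : y = b
      · subst hyb
        exact had (h.next₃.symm.trans h₂.next₁)
      · exact C.cycle5 h.adj₄.symm h.adj₃.symm h₁.adj₁.symm h₂.adj₂ h.adj₁.symm hax
          h₁.adj₃.ne hyb hdy.symm h₂.adj₃.ne.symm
    by_cases hyb : y = b
    · subst hyb
      exact C.cycle5 h.adj₁ h.adj₂ h.adj₃ h₁.adj₁ h₁.adj₂ hax h₁.adj₃.ne hdy h₂.adj₃.ne hxc
    by_cases hyc : y = c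
    · subst hyc
      exact C.cycle5 h.adj₁ h.adj₂ h.adj₃ h₁.adj₁.symm h₁.adj₃.symm hax h₁.adj₂.ne' hdy
        h₂.adj₂.ne' hxb
    · exact C.cycle5 h.adj₄.symm h.adj₃.symm h.adj₂.symm h₂.adj₂.symm h₁.adj₃.symm hax h.adj₁.ne
        hdy.symm hyb hxb

/-- Next to an edge between two triangular faces with nonadjacent apices, the other triangles on
the boundary edges are only the faces themselves. -/
theorem no_third_vertex {a b c d z : V} (h₁ : R.Tri b c a) (h₂ : R.Tri c b d)
    (had : ¬ G.Adj a d) :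
    (G.Adj z a → G.Adj z c → z = b) ∧ (G.Adj z a → G.Adj z b → z = c) := by
  have hne := C.mid_apex_ne h₁ h₂
  constructor
  · intro hza hzc
    by_contra hzb
    refine C.cycle5 hza h₁.adj₃ h₂.adj₂ h₂.adj₃ hzc.symm hzb ?_ hne h₁.adj₂.ne' h₁.adj₁.ne
    rintro rfl
    exact had hza.symm
  · intro hza hzb
    by_contra hzc
    refine C.cycle5 hza h₁.adj₂.symm h₂.adj₃.symm h₂.adj₂.symm hzb.symm hzc ?_ hne
      h₁.adj₃.ne h₁.adj₁.ne'
    rintro rfl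
    exact had hza.symm

end Config
end ChoosSep

namespace ChoosSep

variable {V : Type} {G : SimpleGraph V}

theorem Rotation.face_symm_snd (R : Rotation G) (d : G.Dart) : (R.face.symm d).snd = d.fst := by
  simpa using (R.face_fst (R.face.symm d)).symm

/-- The face containing a dart is a triangle. -/
def Rotation.IsTri (R : Rotation G) (d : G.Dart) : Prop :=
  R.Tri d.fst d.snd (R.next d.snd d.fst)

/-- The length of the face containing a dart. -/
noncomputable def Rotation.len (R : Rotation G) (d : G.Dart) : ℕ :=
  Function.minimalPeriod R.face d

theorem Rotation.IsTri.face_face_face {R : Rotation G} {d : G.Dart} (h : R.IsTri d) :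
    R.face (R.face (R.face d)) = d := by
  ext
  · simpa using h.next₂
  · simpa [h.next₂] using h.next₃

theorem Rotation.isTri_of_face {R : Rotation G} {d : G.Dart}
    (h : R.face (R.face (R.face d)) = d) : R.IsTri d := by
  have h1 : R.next (R.next d.snd d.fst) d.snd = d.fst := by
    simpa using congrArg (fun x : G.Dart => x.fst) h
  have h2 : R.next d.fst (R.next d.snd d.fst) = d.snd := by
    simpa [h1] using congrArg (fun x : G.Dart => x.snd) h
  refine ⟨d.adj, by simpa using (R.face d).adj, ?_, rfl, h1, h2⟩
  simpa [h1] using (R.face (R.face d)).adj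

theorem Rotation.isTri_face {R : Rotation G} {d : G.Dart} : R.IsTri (R.face d) ↔ R.IsTri d :=
  ⟨fun h => isTri_of_face (R.face.injective h.face_face_face),
    fun h => isTri_of_face (congrArg R.face h.face_face_face)⟩

theorem Rotation.isTri_face_symm {R : Rotation G} {d : G.Dart} :
    R.IsTri (R.face.symm d) ↔ R.IsTri d := by
  rw [← isTri_face, Equiv.apply_symm_apply]

theorem Rotation.len_face [Finite V] (R : Rotation G) (d : G.Dart) :
    R.len (R.face d) = R.len d := by
  have : Finite G.Dart := Finite.of_injective _ SimpleGraph.Dart.toProd_injective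
  exact Function.minimalPeriod_apply
    (Function.Injective.mem_periodicPts R.face.injective d)

theorem Rotation.len_face_symm [Finite V] (R : Rotation G) (d : G.Dart) :
    R.len (R.face.symm d) = R.len d := by
  rw [← len_face, Equiv.apply_symm_apply]

theorem Rotation.IsTri.len_le {R : Rotation G} {d : G.Dart} (h : R.IsTri d) :
    R.len d ≤ 3 := by
  have : Function.IsPeriodicPt R.face 3 d := h.face_face_face
  exact this.minimalPeriod_le (by norm_num)

namespace Config

variable {R : Rotation G} {p : V} {X : Finset V} [Finite V] (C : Config R p X)
include C

theorem face_walk_ne (d : G.Dart) : d.fst ≠ (R.face d).snd := by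
  have := C.next_ne d.adj.symm
  simpa using this.symm

/-- Short faces are triangles or quadrangles. -/
theorem len_cases (d : G.Dart) : (R.len d = 3 ∧ R.IsTri d) ∨
    (R.len d = 4 ∧ ∃ w x, R.Quad d.fst d.snd w x) ∨ 6 ≤ R.len d := by
  have : Finite G.Dart := Finite.of_injective _ SimpleGraph.Dart.toProd_injective
  have hpos : 0 < R.len d := Function.minimalPeriod_pos_of_mem_periodicPts
    (Function.Injective.mem_periodicPts R.face.injective d)
  have hper : (R.face)^[R.len d] d = d := Function.iterate_minimalPeriod
  by_cases h6 : 6 ≤ R.len d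
  · exact Or.inr (Or.inr h6)
  have h0 := C.face_walk_ne d
  have h1 := C.face_walk_ne (R.face d)
  have h2 := C.face_walk_ne (R.face (R.face d))
  have h3 := C.face_walk_ne (R.face (R.face (R.face d)))
  have h4 := C.face_walk_ne (R.face (R.face (R.face (R.face d))))
  have a0 := d.adj
  have a1 := (R.face d).adj
  have a2 := (R.face (R.face d)).adj
  have a3 := (R.face (R.face (R.face d))).adj
  have a4 := (R.face (R.face (R.face (R.face d)))).adj
  generalize hl : R.len d = l at *
  have hl6 : l < 6 := by omega
  interval_cases l
  · exact absurd (congrArg (fun x : G.Dart => x.fst) hper) (by simp [d.adj.ne'])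
  · exact absurd (congrArg (fun x : G.Dart => x.fst) hper) (by simpa using h0.symm)
  · exact Or.inl ⟨rfl, R.isTri_of_face hper⟩
  · refine Or.inr (Or.inl ⟨rfl, R.next d.snd d.fst, R.next (R.next d.snd d.fst) d.snd, ?_⟩)
    have e1 := congrArg (fun x : G.Dart => x.fst) hper
    have e2 := congrArg (fun x : G.Dart => x.snd) hper
    simp only [Function.iterate_succ, Function.comp, Function.iterate_zero, id, R.face_fst,
      R.face_snd] at e1 e2 a1 a2 a3
    rw [e1] at e2 a3
    exact ⟨a0, a1, a2, a3, rfl, rfl, e1, e2⟩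
  · exfalso
    have e1 := congrArg (fun x : G.Dart => x.fst) hper
    have e2 := congrArg (fun x : G.Dart => x.snd) hper
    simp only [Function.iterate_succ, Function.comp, Function.iterate_zero, id, R.face_fst,
      R.face_snd] at e1 e2 a1 a2 a3 a4 h0 h1 h2 h3 h4
    rw [e1] at a4 h3 h4 e2
    rw [e2] at h4
    exact C.cycle5 a0 a1 a2 a3 a4 h0 h3.symm h1 h4.symm h2

theorem len_six {d : G.Dart} (h : R.len d = 6) :
    ∃ z, G.Adj z d.fst ∧ G.Adj z d.snd ∧
      (z = R.next d.snd d.fst ∨ d.snd = R.next d.fst z) := by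
  have hper : (R.face)^[R.len d] d = d := Function.iterate_minimalPeriod
  rw [h] at hper
  have h0 := C.face_walk_ne d
  have h1 := C.face_walk_ne (R.face d)
  have h2 := C.face_walk_ne (R.face (R.face d))
  have h3 := C.face_walk_ne (R.face (R.face (R.face d)))
  have h4 := C.face_walk_ne (R.face (R.face (R.face (R.face d))))
  have h5 := C.face_walk_ne (R.face (R.face (R.face (R.face (R.face d)))))
  have a0 := d.adj
  have a1 := (R.face d).adj
  have a2 := (R.face (R.face d)).adj
  have a3 := (R.face (R.face (R.face d))).adj
  have a4 := (R.face (R.face (R.face (R.face d)))).adj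
  have a5 := (R.face (R.face (R.face (R.face (R.face d))))).adj
  have e1 := congrArg (fun x : G.Dart => x.fst) hper
  have e2 := congrArg (fun x : G.Dart => x.snd) hper
  simp only [Function.iterate_succ, Function.comp, Function.iterate_zero, id, R.face_fst,
      R.face_snd] at e1 e2 a1 a2 a3 a4 a5 h0 h1 h2 h3 h4 h5
  rw [e1] at a5 h4 h5 e2
  rw [e2] at h5
  generalize hv2 : R.next d.snd d.fst = v2 at *
  generalize hv3 : R.next v2 d.snd = v3 at *
  generalize hv4 : R.next v3 v2 = v4 at *
  generalize hv5 : R.next v4 v3 = v5 at *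
  by_cases c0 : d.fst = v3
  · exact ⟨v2, by rw [c0]; exact a2, a1.symm, Or.inl rfl⟩
  by_cases c1 : d.snd = v4
  · exact ⟨v5, a5, by rw [c1]; exact a4.symm, Or.inr e2.symm⟩
  by_cases c2 : v2 = v5
  · exact ⟨v2, by rw [c2]; exact a5, a1.symm, Or.inl rfl⟩
  exact absurd (hasCycleLen_six a0 a1 a2 a3 a4 a5 h0 c0 h4.symm h1 c1 h5.symm h2 c2 h3) C.no6

theorem not_two_mid {d : G.Dart} (h : R.IsTri d) (h₁ : R.IsTri d.symm)
    (h₂ : R.IsTri (R.face d).symm) : False := by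
  refine C.not_mid_mid h h₁ (t := R.next d.snd (R.next d.snd d.fst)) ?_
  simpa [Rotation.IsTri] using h₂

theorem six_le_len {d : G.Dart} (h : ¬ R.IsTri d) (h' : R.IsTri d.symm) : 6 ≤ R.len d := by
  rcases C.len_cases d with ⟨-, h1⟩ | ⟨-, w, x, h1⟩ | h1
  · exact absurd h1 h
  · exact (C.not_tri_quad h' h1).elim
  · exact h1

end Config
end ChoosSep

namespace ChoosSep

variable {V : Type} {G : SimpleGraph V}

namespace Rotation

variable (R : Rotation G)

/-- The edge of a dart lies between two triangular faces. -/
def Mid (d : G.Dart) : Prop := R.IsTri d ∧ R.IsTri d.symm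

/-- A dart with no triangular face on either side. -/
def Bare (d : G.Dart) : Prop := ¬ R.IsTri d ∧ ¬ R.IsTri d.symm

/-- The apices of the triangles next to a dart. -/
def Chord (d : G.Dart) : Prop :=
  G.Adj (R.next d.snd d.fst) (R.next d.fst d.snd)

/-- A middle edge both of whose ends have degree at least four. -/
def MidBig (d : G.Dart) : Prop := R.Mid d ∧ 4 ≤ deg G d.fst ∧ 4 ≤ deg G d.snd

/-- The next out-dart at the tail of a dart. -/
def turn : Equiv.Perm G.Dart where
  toFun d := R.face d.symm
  invFun d := (R.face.symm d).symm
  left_inv d := by simp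
  right_inv d := by simp

variable {R}

@[simp] theorem turn_apply (d : G.Dart) : R.turn d = R.face d.symm := rfl

theorem turn_fst (d : G.Dart) : (R.turn d).fst = d.fst := by simp

theorem turn_snd (d : G.Dart) : (R.turn d).snd = R.next d.fst d.snd := by simp

theorem Mid.symm {d : G.Dart} (h : R.Mid d) : R.Mid d.symm := ⟨h.2, by simpa using h.1⟩

theorem MidBig.symm {d : G.Dart} (h : R.MidBig d) : R.MidBig d.symm :=
  ⟨h.1.symm, h.2.2, h.2.1⟩

theorem Mid.tri {d : G.Dart} (h : R.Mid d) : R.Tri d.fst d.snd (R.next d.snd d.fst) := h.1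

theorem Mid.tri_symm {d : G.Dart} (h : R.Mid d) : R.Tri d.snd d.fst (R.next d.fst d.snd) := h.2

end Rotation

namespace Config

open Rotation

variable {R : Rotation G} {p : V} {X : Finset V} (C : Config R p X)
include C

theorem fst_ne_of_isTri {d : G.Dart} (h : R.IsTri d) : d.fst ≠ p :=
  C.tri_ne h.adj₁ h.adj₂ h.adj₃

variable [Finite V]

theorem not_mid_turn {d : G.Dart} (h : R.Mid d) : ¬ R.Mid (R.turn d) := fun h' =>
  C.not_two_mid (d := d.symm) h.2 (by simpa using h.1) h'.2

theorem mem_X_of_mid {d : G.Dart} (h : R.Mid d) (h3 : deg G d.fst = 3) : d.fst ∈ X :=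
  C.mem_X (C.fst_ne_of_isTri h.1) h3 h.tri.adj₃.symm h.tri.adj₁ h.tri_symm.adj₂
    h.tri.adj₂.symm h.tri_symm.adj₃.symm (C.mid_apex_ne h.tri h.tri_symm)

theorem not_bare_of_side {n : G.Dart} (h : R.Mid (R.face (R.face n).symm)) :
    ¬ R.IsTri n ∧ 6 ≤ R.len n := by
  have h1 : R.IsTri (R.face n).symm := isTri_face.1 h.1
  have h2 : ¬ R.IsTri (R.face n) := fun h2 =>
    C.not_two_mid (d := (R.face n).symm) h1 (by simpa using h2) h.2
  exact ⟨fun h => h2 (isTri_face.2 h), by simpa [R.len_face] using C.six_le_len h2 h1⟩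

theorem not_bare_of_side' {n : G.Dart} (h : R.Mid (R.face.symm (R.face.symm n).symm)) :
    ¬ R.IsTri n ∧ 6 ≤ R.len n := by
  have h1 : R.IsTri (R.face.symm n).symm := isTri_face_symm.1 h.1
  have h2 : ¬ R.IsTri (R.face.symm n) := fun h2 =>
    C.not_two_mid h.1 h.2 (by simpa using h2)
  exact ⟨fun h => h2 (isTri_face_symm.2 h), by
    simpa [R.len_face_symm] using C.six_le_len h2 h1⟩

theorem not_mid_face_of_mid {d : G.Dart} (h : R.Mid (R.face.symm d.symm)) :
    ¬ R.Mid (R.face d.symm) := by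
  intro h'
  refine C.not_two_mid h'.1 h'.2 ?_
  have h3 := (isTri_face.1 h'.1).face_face_face
  have : R.face (R.face d.symm) = R.face.symm d.symm := by
    rw [Equiv.eq_symm_apply, h3]
  rw [this]
  exact h.2

/-- A face next to a triangle across an edge which is adjacent in that triangle to a chordless
middle edge has length at least seven. -/
theorem seven_le_len {d : G.Dart} (h : R.Mid (R.face.symm d.symm) ∧ ¬ R.Chord (R.face.symm d.symm) ∨
      R.Mid (R.face d.symm) ∧ ¬ R.Chord (R.face d.symm)) :
    R.IsTri d.symm ∧ ¬ R.IsTri d ∧ 7 ≤ R.len d := by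
  rcases h with ⟨h, hc⟩ | ⟨h, hc⟩
  · have h1 : R.IsTri d.symm := isTri_face_symm.1 h.1
    have h2 : ¬ R.IsTri d := fun h2 => C.not_two_mid h.1 h.2 (by simpa using h2)
    refine ⟨h1, h2, ?_⟩
    have h6 := C.six_le_len h2 h1
    by_contra h7
    obtain ⟨z, hz1, hz2, hz⟩ := C.len_six (by omega : R.len d = 6)
    have hs : (R.face.symm d.symm).snd = d.snd := by simp [R.face_symm_snd]
    have t := h.tri
    have ha : R.next (R.face.symm d.symm).snd (R.face.symm d.symm).fst = d.fst := by
      simpa using (R.face_snd (R.face.symm d.symm)).symm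
    rw [ha] at t
    have hzb := (C.no_third_vertex t h.tri_symm (by rw [← ha]; exact hc)).1 hz1 (by rwa [hs])
    rw [← hzb, hs] at t
    rcases hz with hz | hz
    · exact C.next_next_ne (C.tri_ne t.adj₂ t.adj₃ t.adj₁) t.adj₁.symm (by rw [t.next₁, ← hz])
    · exact C.next_next_ne (C.tri_ne t.adj₃ t.adj₁ t.adj₂) t.adj₂.symm
        (by rw [t.next₂, ← hz])
  · have h1 : R.IsTri d.symm := isTri_face.1 h.1
    have h2 : ¬ R.IsTri d := fun h2 => C.not_two_mid h1 (by simpa using h2) h.2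
    refine ⟨h1, h2, ?_⟩
    have h6 := C.six_le_len h2 h1
    by_contra h7
    obtain ⟨z, hz1, hz2, hz⟩ := C.len_six (by omega : R.len d = 6)
    have t := h.tri
    have ha : R.next (R.face d.symm).snd (R.face d.symm).fst = d.snd := by
      simpa using h1.next₂
    rw [ha] at t
    have hzb := (C.no_third_vertex t h.tri_symm (by rw [← ha]; exact hc)).2 hz2 (by simpa using hz1)
    rw [← hzb] at t
    have hs : (R.face d.symm).fst = d.fst := by simp
    rw [hs] at t
    rcases hz with hz | hz
    · exact C.next_next_ne (C.tri_ne t.adj₃ t.adj₁ t.adj₂) t.adj₂.symm (by rw [t.next₂, ← hz])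
    · exact C.next_next_ne (C.tri_ne t.adj₁ t.adj₂ t.adj₃) t.adj₃.symm (by rw [t.next₃, ← hz])

end Config
end ChoosSep

namespace ChoosSep

open Classical in
/-- The real-valued indicator of a proposition. -/
noncomputable def ind (P : Prop) : ℝ := if P then 1 else 0

theorem ind_true {P : Prop} (h : P) : ind P = 1 := if_pos h

theorem ind_false {P : Prop} (h : ¬ P) : ind P = 0 := if_neg h

theorem ind_nonneg (P : Prop) : 0 ≤ ind P := by
  unfold ind; split_ifs <;> norm_num

theorem ind_le_one (P : Prop) : ind P ≤ 1 := by
  unfold ind; split_ifs <;> norm_num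

theorem ind_mono {P Q : Prop} (h : P → Q) : ind P ≤ ind Q := by
  by_cases hP : P
  · rw [ind_true hP, ind_true (h hP)]
  · rw [ind_false hP]; exact ind_nonneg Q

theorem sum_ind_le_one {ι : Type*} [Fintype ι] {P : ι → Prop}
    (h : ∀ i j, P i → P j → i = j) : ∑ i, ind (P i) ≤ 1 := by
  classical
  by_cases hP : ∃ i, P i
  · obtain ⟨i, hi⟩ := hP
    rw [Finset.sum_eq_single i (fun j _ hj => ind_false fun hPj => hj (h j i hPj hi)) (by simp)]
    exact ind_le_one _
  · rw [Finset.sum_eq_zero fun i _ => ind_false fun hi => hP ⟨i, hi⟩]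
    norm_num

theorem one_sub_four_div_le {n l : ℕ} (hn : 0 < n) (h : n ≤ l) :
    1 - 4 / (n : ℝ) ≤ 1 - 4 / (l : ℝ) := by
  have h1 : (0 : ℝ) < n := by exact_mod_cast hn
  have h2 : (n : ℝ) ≤ l := by exact_mod_cast h
  gcongr

variable {V : Type} {G : SimpleGraph V}

/-- A vertex of degree three which is not paid for otherwise. -/
def Demander (G : SimpleGraph V) (p : V) (X : Finset V) (v : V) : Prop :=
  v ≠ p ∧ deg G v = 3 ∧ ¬ G.Adj v p ∧ v ∉ X

namespace Rotation

variable (R : Rotation G) (p : V) (X : Finset V)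

/-- A dart pays the demander at its head. -/
def PaysHead (d : G.Dart) : Prop := R.Bare d ∧ 6 ≤ R.len d ∧ Demander G p X d.snd

/-- A dart pays the demander at its tail. -/
def PaysTail (d : G.Dart) : Prop :=
  R.Bare d ∧ 6 ≤ R.len d ∧ Demander G p X d.fst ∧ ¬ R.Bare (R.face.symm d)

/-- A dart pays, at its head, for a middle edge. -/
def SideHead (d : G.Dart) : Prop :=
  R.MidBig (R.face (R.face d).symm) ∧ ¬ R.IsTri d.symm

/-- A dart pays, at its tail, for a middle edge. -/
def SideTail (d : G.Dart) : Prop :=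
  R.MidBig (R.face.symm (R.face.symm d).symm) ∧ ¬ R.IsTri d.symm

/-- A dart joins the apices of the triangles next to a middle edge. -/
def ChordOf (d m : G.Dart) : Prop :=
  R.Mid m ∧ R.next m.snd m.fst = d.fst ∧ R.next m.fst m.snd = d.snd

/-- A middle edge whose apices are not adjacent. -/
def MidOpen (d : G.Dart) : Prop := R.Mid d ∧ ¬ R.Chord d

/-- The charge a dart can afford to give away. -/
noncomputable def charge [Fintype G.Dart] (d : G.Dart) : ℝ :=
  -(1/3) * ind (R.IsTri d) + (1/3) * (ind (R.IsTri d.symm) - ind (R.Mid d))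
  + (1/12) * (ind (R.MidOpen (R.face.symm d.symm)) + ind (R.MidOpen (R.face d.symm)))
  + (1/6) * (ind (R.PaysHead p X d) + ind (R.PaysTail p X d))
  + (1/12) * (ind (R.SideHead d) + ind (R.SideTail d))
  + (1/6) * ∑ m, ind (R.ChordOf d m)

end Rotation

namespace Config

open Rotation

variable {R : Rotation G} {p : V} {X : Finset V} [Finite V] (C : Config R p X)
include C

theorem chordOf_unique {d m m' : G.Dart} (h : R.ChordOf d m) (h' : R.ChordOf d m') : m = m' := by
  obtain ⟨h, e1, e2⟩ := h
  obtain ⟨h', e1', e2'⟩ := h'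
  have t1 := h.tri
  have t2 := h.tri_symm
  have t1' := h'.tri
  have t2' := h'.tri_symm
  rw [e1] at t1
  rw [e2] at t2
  rw [e1'] at t1'
  rw [e2'] at t2'
  ext
  · exact C.mid_chord_unique t1' t2' t1 t2
  · exact C.mid_chord_unique t2' t1' t2 t1

theorem chordOf_props {d m : G.Dart} (h : R.ChordOf d m) :
    R.Bare d ∧ 6 ≤ R.len d ∧ deg G d.fst ≠ 3 ∧ deg G d.snd ≠ 3 := by
  obtain ⟨h, e1, e2⟩ := h
  have t1 := h.tri
  have t2 := h.tri_symm
  rw [e1] at t1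
  rw [e2] at t2
  have s1 := C.chord_not_short t1 t2
  have s2 := C.chord_not_short t2 t1
  refine ⟨⟨s1.1 _, s2.1 _⟩, ?_, ?_, ?_⟩
  · rcases C.len_cases d with ⟨-, h1⟩ | ⟨-, w, x, h1⟩ | h1
    · exact absurd h1 (s1.1 _)
    · exact absurd h1 (s1.2 _ _)
    · exact h1
  · intro h3
    exact C.not_K4 (C.tri_ne t1.adj₃ t1.adj₁ t1.adj₂) h3 t1.adj₃ d.adj t1.adj₂.symm
      t2.adj₂ t2.adj₃ t1.adj₁
  · intro h3
    exact C.not_K4 (C.tri_ne t2.adj₃ t2.adj₁ t2.adj₂) h3 t2.adj₃ d.adj.symm t2.adj₂.symm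
      t1.adj₂ t1.adj₃ t2.adj₁

theorem side_head {d : G.Dart} (h : R.SideHead d) :
    R.Bare d ∧ 6 ≤ R.len d ∧ deg G d.snd ≠ 3 := by
  have h1 := C.not_bare_of_side h.1.1
  refine ⟨⟨h1.1, h.2⟩, h1.2, ?_⟩
  have := h.1.2.1
  simp at this
  omega

theorem side_tail {d : G.Dart} (h : R.SideTail d) :
    R.Bare d ∧ 6 ≤ R.len d ∧ deg G d.fst ≠ 3 := by
  have h1 := C.not_bare_of_side' h.1.1
  refine ⟨⟨h1.1, h.2⟩, h1.2, ?_⟩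
  have := h.1.2.2
  simp [R.face_symm_snd] at this
  omega

theorem charge_le [Fintype G.Dart] (d : G.Dart) :
    R.charge p X d ≤ 1 - 4 / (R.len d : ℝ) := by
  unfold Rotation.charge
  by_cases hN : R.Bare d
  · have hM : ¬ R.Mid d := fun h => hN.1 h.1
    have hO1 : ¬ R.MidOpen (R.face.symm d.symm) := fun h =>
      hN.2 (C.seven_le_len (Or.inl h)).1
    have hO2 : ¬ R.MidOpen (R.face d.symm) := fun h =>
      hN.2 (C.seven_le_len (Or.inr h)).1
    rw [ind_false hN.1, ind_false hN.2, ind_false hM, ind_false hO1, ind_false hO2]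
    by_cases h6 : 6 ≤ R.len d
    · have hw := one_sub_four_div_le (by norm_num) h6
      have hch : ∑ m, ind (R.ChordOf d m) ≤ 1 :=
        sum_ind_le_one fun m m' h h' => C.chordOf_unique h h'
      have hH : ind (R.PaysHead p X d) + ind (R.SideHead d) ≤ 1 := by
        by_cases hs : R.SideHead d
        · rw [ind_false (fun h : R.PaysHead p X d => (C.side_head hs).2.2 h.2.2.2.1)]
          linarith [ind_le_one (R.SideHead d)]
        · rw [ind_false hs]; linarith [ind_le_one (R.PaysHead p X d)]
      have hT : ind (R.PaysTail p X d) + ind (R.SideTail d) ≤ 1 := by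
        by_cases hs : R.SideTail d
        · rw [ind_false (fun h : R.PaysTail p X d => (C.side_tail hs).2.2 h.2.2.1.2.1)]
          linarith [ind_le_one (R.SideTail d)]
        · rw [ind_false hs]; linarith [ind_le_one (R.PaysTail p X d)]
      have hs1 := ind_nonneg (R.SideHead d)
      have hs2 := ind_nonneg (R.SideTail d)
      by_cases hc : ∃ m, R.ChordOf d m
      · obtain ⟨m, hm⟩ := hc
        obtain ⟨-, -, h1, h2⟩ := C.chordOf_props hm
        rw [ind_false (fun h : R.PaysHead p X d => h2 h.2.2.2.1)] at hH ⊢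
        rw [ind_false (fun h : R.PaysTail p X d => h1 h.2.2.1.2.1)] at hT ⊢
        norm_num at hw ⊢
        linarith
      · rw [Finset.sum_eq_zero fun m _ => ind_false fun hm => hc ⟨m, hm⟩]
        norm_num at hw ⊢
        linarith
    · rw [ind_false fun h : R.PaysHead p X d => h6 h.2.1,
        ind_false fun h : R.PaysTail p X d => h6 h.2.1,
        ind_false fun h => h6 (C.side_head h).2.1, ind_false fun h => h6 (C.side_tail h).2.1,
        Finset.sum_eq_zero fun m _ => ind_false fun hm => h6 (C.chordOf_props hm).2.1]
      rcases C.len_cases d with ⟨-, h1⟩ | ⟨h1, -⟩ | h1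
      · exact absurd h1 hN.1
      · rw [h1]; norm_num
      · exact absurd h1 h6
  · rw [ind_false fun h : R.PaysHead p X d => hN h.1,
      ind_false fun h : R.PaysTail p X d => hN h.1,
      ind_false fun h => hN (C.side_head h).1, ind_false fun h => hN (C.side_tail h).1,
      Finset.sum_eq_zero fun m _ => ind_false fun hm => hN (C.chordOf_props hm).1]
    by_cases hT : R.IsTri d
    · rw [ind_true hT, ind_false fun h : R.MidOpen (R.face.symm d.symm) => (C.seven_le_len (Or.inl h)).2.1 hT,
        ind_false fun h : R.MidOpen (R.face d.symm) => (C.seven_le_len (Or.inr h)).2.1 hT]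
      have h3 : R.len d = 3 := by
        rcases C.len_cases d with ⟨h1, -⟩ | ⟨h1, -⟩ | h1
        · exact h1
        · have := hT.len_le; omega
        · have := hT.len_le; omega
      have : ind (R.IsTri d.symm) ≤ ind (R.Mid d) := ind_mono fun h => ⟨hT, h⟩
      rw [h3]
      norm_num
      linarith
    · have hS : R.IsTri d.symm := by
        by_contra hS
        exact hN ⟨hT, hS⟩
      rw [ind_false hT, ind_true hS, ind_false fun h : R.Mid d => hT h.1]
      have h6 := C.six_le_len hT hS
      have hw := one_sub_four_div_le (by norm_num) h6
      by_cases hO : R.MidOpen (R.face.symm d.symm) ∨ R.MidOpen (R.face d.symm)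
      · have hw := one_sub_four_div_le (by norm_num) (C.seven_le_len hO).2.2
        have : ind (R.MidOpen (R.face.symm d.symm)) + ind (R.MidOpen (R.face d.symm)) ≤ 1 := by
          by_cases h1 : R.MidOpen (R.face.symm d.symm)
          · rw [ind_false fun h : R.MidOpen (R.face d.symm) => C.not_mid_face_of_mid h1.1 h.1]
            linarith [ind_le_one (R.MidOpen (R.face.symm d.symm))]
          · rw [ind_false h1]
            linarith [ind_le_one (R.MidOpen (R.face d.symm))]
        norm_num at hw ⊢
        linarith
      · push Not at hO
        rw [ind_false hO.1, ind_false hO.2]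
        norm_num at hw ⊢
        linarith

end Config
end ChoosSep

namespace ChoosSep

theorem exists_card_sum_ind {ι : Type*} (s : Finset ι) (P : ι → Prop) :
    ∃ k : ℕ, ∑ i ∈ s, ind (P i) = k := by
  classical
  exact ⟨(s.filter P).card, by simp [ind]⟩

variable {V : Type} {G : SimpleGraph V}

namespace Rotation

variable {R : Rotation G}

/-- A middle edge at whose tail the second-previous dart starts a triangle. -/
def TightPrev (R : Rotation G) (d : G.Dart) : Prop :=
  R.MidBig d ∧ R.IsTri (R.turn.symm (R.turn.symm d))

/-- A middle edge at whose tail the second-next dart ends a triangle. -/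
def TightNext (R : Rotation G) (d : G.Dart) : Prop :=
  R.MidBig d ∧ R.IsTri (R.turn (R.turn d)).symm

theorem turn_symm_eq (d : G.Dart) : R.turn.symm d = (R.face.symm d).symm := rfl

end Rotation

theorem Rotation.next_pow_deg [Finite V] (R : Rotation G) {u v : V} (h : G.Adj v u) :
    (R.next v ^ deg G v) u = u :=
  (R.pow_next_eq_iff h _).2 dvd_rfl

/-- The darts leaving a vertex. -/
noncomputable def outDarts [Fintype G.Dart] (v : V) : Finset G.Dart := by
  classical exact Finset.univ.filter fun d => d.fst = v

@[simp] theorem mem_outDarts [Fintype G.Dart] {v : V} {d : G.Dart} :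
    d ∈ outDarts v ↔ d.fst = v := by
  simp [outDarts]

theorem card_outDarts [Fintype V] [Fintype G.Dart] (v : V) :
    (outDarts (G := G) v).card = deg G v := by
  classical
  rw [deg, ← Nat.card_coe_set_eq, Nat.card_eq_fintype_card, G.card_neighborSet_eq_degree,
    ← G.dart_fst_fiber_card_eq_degree v, outDarts]
  congr!

theorem sum_outDarts [Fintype V] [Fintype G.Dart] (h : G.Dart → ℝ) :
    ∑ v, ∑ d ∈ outDarts v, h d = ∑ d, h d := by
  classical
  exact Finset.sum_fiberwise Finset.univ (fun d : G.Dart => d.fst) h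

theorem sum_turn [Fintype G.Dart] (R : Rotation G) (v : V) (h : G.Dart → ℝ) :
    ∑ d ∈ outDarts v, h (R.turn d) = ∑ d ∈ outDarts v, h d :=
  Finset.sum_equiv R.turn (by simp) (by simp)

namespace Config

open Rotation

variable {R : Rotation G} {p : V} {X : Finset V} (C : Config R p X)
include C

variable [Finite V]

theorem two_mul_sum_mid_le [Fintype V] [Fintype G.Dart] (v : V) :
    2 * ∑ d ∈ outDarts v, ind (R.Mid d) ≤ deg G v := by
  have h1 : ∑ d ∈ outDarts v, (ind (R.Mid d) + ind (R.Mid (R.turn d))) ≤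
      ∑ d ∈ outDarts (G := G) v, 1 := by
    refine Finset.sum_le_sum fun d _ => ?_
    by_cases h : R.Mid d
    · rw [ind_false (C.not_mid_turn h)]
      linarith [ind_le_one (R.Mid d)]
    · rw [ind_false h]
      linarith [ind_le_one (R.Mid (R.turn d))]
  rw [Finset.sum_add_distrib, sum_turn R v fun d => ind (R.Mid d)] at h1
  simp [card_outDarts] at h1
  linarith

theorem five_le_deg_of_tightPrev {d : G.Dart} (h : R.TightPrev d) : 5 ≤ deg G d.fst := by
  by_contra h5
  obtain ⟨e, rfl⟩ : ∃ e, d = R.turn (R.turn e) := ⟨R.turn.symm (R.turn.symm d), by simp⟩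
  obtain ⟨⟨hm, h4, -⟩, ht⟩ := h
  rw [Equiv.symm_apply_apply, Equiv.symm_apply_apply] at ht
  have h4 : deg G e.fst = 4 := by
    simp only [turn_fst] at h4 h5
    omega
  have hp := C.fst_ne_of_isTri ht
  have h1 := R.next_pow_deg e.adj
  rw [h4] at h1
  simp only [pow_succ, pow_zero, one_mul, Equiv.Perm.mul_apply] at h1
  have t1 := hm.tri
  have t2 := hm.tri_symm
  simp only [turn_fst, turn_snd] at t1 t2
  have t3 := ht.next₃
  have hn := ht.adj₂
  have hy := e.adj
  generalize e.fst = b at *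
  generalize e.snd = y at *
  have n1 := C.next_ne hy
  generalize ha : R.next b y = a at *
  generalize hc : R.next b a = c at *
  generalize hd : R.next b c = d at *
  have e1 : R.next c b = a := (R.next b).injective (by rw [t1.next₃, hc])
  rw [(R.next b).injective (t3.trans h1.symm)] at hn
  rw [e1] at t1
  have had : a ≠ d := C.mid_apex_ne t1 t2
  have hcy : c ≠ y := by
    have := C.next_next_ne hp hy
    rwa [ha, hc] at this
  exact C.cycle5 t1.adj₃.symm t1.adj₂.symm t2.adj₃.symm hn.symm hy.symm t1.adj₁.ne
    t2.adj₂.ne had n1 hcy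

theorem five_le_deg_of_tightNext {d : G.Dart} (h : R.TightNext d) : 5 ≤ deg G d.fst := by
  by_contra h5
  obtain ⟨⟨hm, h4, -⟩, ht⟩ := h
  have h4 : deg G d.fst = 4 := by omega
  have hp := C.fst_ne_of_isTri hm.1
  have h1 := R.next_pow_deg d.adj
  rw [h4] at h1
  simp only [pow_succ, pow_zero, one_mul, Equiv.Perm.mul_apply] at h1
  have t1 := hm.tri
  have t2 := hm.tri_symm
  have t3 := ht.adj₃
  have hbd := (R.turn d).adj
  have hby := (R.turn (R.turn d)).adj
  simp only [SimpleGraph.Dart.symm_toProd, Prod.fst_swap, Prod.snd_swap, turn_fst, turn_snd]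
    at t3 hbd hby
  have hc := d.adj
  generalize d.fst = b at *
  generalize d.snd = c at *
  generalize hd : R.next b c = d at *
  have n1 := C.next_ne hbd
  have n2 := C.next_next_ne hp hc
  have n3 := C.next_next_ne hp hbd
  rw [hd] at n2
  generalize hy : R.next b d = y at *
  have e1 : R.next c b = R.next b y := (R.next b).injective (by rw [t1.next₃, h1])
  rw [e1] at t1
  exact C.cycle5 hbd t2.adj₃ t1.adj₂ t3 hby.symm hc.ne t1.adj₃.ne' n3.symm n1.symm n2.symm

theorem mem_X_of_not_bare {d : G.Dart} (h3 : deg G d.snd = 3) (h : R.IsTri d.symm)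
    (h' : R.IsTri (R.face d).symm) : d.snd ∈ X := by
  have hp := C.fst_ne_of_isTri h
  have t1 : R.Tri d.snd d.fst (R.next d.fst d.snd) := h
  have t2 := h'.rot
  simp only [SimpleGraph.Dart.symm_toProd, Prod.fst_swap, Prod.snd_swap, face_fst, face_snd]
    at t2
  have h1 := R.next_pow_deg d.adj.symm
  have hn := C.next_ne d.adj.symm
  rw [h3] at h1
  simp only [pow_succ, pow_zero, one_mul, Equiv.Perm.mul_apply] at h1
  simp only [SimpleGraph.Dart.symm_toProd, Prod.fst_swap] at hp
  rw [(R.next d.snd).injective (t1.next₃.trans h1.symm)] at t1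
  exact C.mem_X hp h3 t1.adj₁ t1.adj₃.symm t2.adj₃.symm t1.adj₂ t2.adj₂ hn.symm

theorem six_le_len_or {d : G.Dart} (hd : Demander G p X d.fst) :
    6 ≤ R.len d ∨ 6 ≤ R.len (R.turn d) := by
  obtain ⟨hp, h3, hap, hX⟩ := hd
  rw [turn_apply, R.len_face]
  have hq : d.snd ≠ p := fun h => hap (h ▸ d.adj)
  have hM : ¬ R.Mid d := fun h => hX (C.mem_X_of_mid h h3)
  rcases C.len_cases d with ⟨-, h1⟩ | ⟨-, w, x, h1⟩ | h1
  · rcases C.len_cases d.symm with ⟨-, h2⟩ | ⟨-, y, z, h2⟩ | h2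
    · exact absurd ⟨h1, h2⟩ hM
    · exact (C.not_tri_quad h1 h2).elim
    · exact Or.inr h2
  · rcases C.len_cases d.symm with ⟨-, h2⟩ | ⟨-, y, z, h2⟩ | h2
    · exact (C.not_tri_quad h2 h1).elim
    · exact (C.not_quad_quad hp hq h1 h2).elim
    · exact Or.inr h2
  · exact Or.inl h1

theorem two_le_sum_pays [Fintype V] [Fintype G.Dart] {v : V} (hv : Demander G p X v) :
    2 ≤ ∑ d ∈ outDarts v, (ind (R.PaysHead p X (R.face.symm d)) + ind (R.PaysTail p X d)) := by
  have h1 : ∑ d ∈ outDarts (G := G) v, 1 ≤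
      ∑ d ∈ outDarts v, (ind (6 ≤ R.len d) + ind (6 ≤ R.len (R.turn d))) := by
    refine Finset.sum_le_sum fun d hd => ?_
    rw [mem_outDarts] at hd
    subst hd
    rcases C.six_le_len_or hv with h | h
    · rw [ind_true h]; linarith [ind_nonneg (6 ≤ R.len (R.turn d))]
    · rw [ind_true h]; linarith [ind_nonneg (6 ≤ R.len d)]
  rw [Finset.sum_add_distrib, sum_turn R v fun d => ind (6 ≤ R.len d)] at h1
  obtain ⟨k, hk⟩ := exists_card_sum_ind (outDarts v) fun d => 6 ≤ R.len d
  rw [hk] at h1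
  simp only [Finset.sum_const, card_outDarts, hv.2.1] at h1
  have hk2 : 2 ≤ k := by
    by_contra hk2
    have : (k : ℝ) ≤ 1 := by exact_mod_cast (by omega : k ≤ 1)
    norm_num at h1
    linarith
  have hk2 : (2 : ℝ) ≤ k := by exact_mod_cast hk2
  refine hk2.trans (hk ▸ Finset.sum_le_sum fun d hd => ?_)
  rw [mem_outDarts] at hd
  subst hd
  by_cases h6 : 6 ≤ R.len d
  · rw [ind_true h6]
    by_cases hb : R.Bare (R.face.symm d)
    · rw [ind_true (P := R.PaysHead p X (R.face.symm d))
        ⟨hb, by rwa [R.len_face_symm], by rwa [R.face_symm_snd]⟩]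
      linarith [ind_nonneg (R.PaysTail p X d)]
    · have hT : ¬ R.IsTri d := fun h => by have := h.len_le; omega
      have hb' : R.Bare d := by
        refine ⟨hT, fun h => ?_⟩
        by_cases hs : R.IsTri (R.face.symm d).symm
        · refine hv.2.2.2 ?_
          have := C.mem_X_of_not_bare (d := R.face.symm d) (by rw [R.face_symm_snd, hv.2.1]) hs
            (by simpa using h)
          rwa [R.face_symm_snd] at this
        · exact hb ⟨fun h => hT (isTri_face_symm.1 h), hs⟩
      rw [ind_true (P := R.PaysTail p X d) ⟨hb', h6, hv, hb⟩]
      linarith [ind_nonneg (R.PaysHead p X (R.face.symm d))]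
  · rw [ind_false h6]
    exact add_nonneg (ind_nonneg _) (ind_nonneg _)

end Config
end ChoosSep

namespace ChoosSep

theorem sum_ind_eq_card {ι : Type*} [Fintype ι] {P : ι → Prop} {s : Finset ι}
    (h : ∀ i, P i ↔ i ∈ s) : ∑ i, ind (P i) = s.card := by
  classical
  have : Finset.univ.filter P = s := by ext i; simp [h]
  simp only [ind, Finset.sum_boole]
  rw [← this]

variable {V : Type} {G : SimpleGraph V}

/-- The charge remaining at a dart after reindexing, attributed to its tail. -/
noncomputable def Rotation.debt (R : Rotation G) (p : V) (X : Finset V) (d : G.Dart) : ℝ :=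
  -(1/3) * ind (R.Mid d ∧ deg G d.fst = 3)
  - (1/12) * (ind (R.TightPrev d) + ind (R.TightNext d))
  + (1/6) * (ind (R.PaysHead p X (R.face.symm d)) + ind (R.PaysTail p X d))

namespace Rotation

variable {R : Rotation G} [Fintype G.Dart]

omit R in
theorem sum_symm (h : G.Dart → ℝ) : ∑ d : G.Dart, h d.symm = ∑ d, h d :=
  Equiv.sum_comp (SimpleGraph.Dart.symm_involutive.toPerm) h

theorem sum_sideHead_ge :
    ∑ d, ind (R.MidBig d) - ∑ d, ind (R.TightPrev d) ≤ ∑ d, ind (R.SideHead d) := by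
  rw [← Equiv.sum_comp (R.face.trans R.turn) fun d => ind (R.MidBig d),
    ← Equiv.sum_comp (R.face.trans R.turn) fun d => ind (R.TightPrev d),
    ← Finset.sum_sub_distrib]
  refine Finset.sum_le_sum fun d _ => ?_
  by_cases h : R.MidBig ((R.face.trans R.turn) d)
  · by_cases h' : R.IsTri d.symm
    · rw [ind_true h, ind_true (P := R.TightPrev _) ⟨h, by simpa [turn_symm_eq] using h'⟩]
      linarith [ind_nonneg (R.SideHead d)]
    · rw [ind_true (P := R.SideHead d) ⟨h, h'⟩]
      linarith [ind_le_one (R.MidBig ((R.face.trans R.turn) d)),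
        ind_nonneg (R.TightPrev ((R.face.trans R.turn) d))]
  · rw [ind_false h]
    linarith [ind_nonneg (R.SideHead d), ind_nonneg (R.TightPrev ((R.face.trans R.turn) d))]

theorem sum_sideTail_ge :
    ∑ d, ind (R.MidBig d) - ∑ d, ind (R.TightNext d) ≤ ∑ d, ind (R.SideTail d) := by
  rw [← Equiv.sum_comp (R.turn.symm.trans R.turn.symm) fun d => ind (R.MidBig d),
    ← Equiv.sum_comp (R.turn.symm.trans R.turn.symm) fun d => ind (R.TightNext d),
    ← Finset.sum_sub_distrib]
  refine Finset.sum_le_sum fun d _ => ?_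
  by_cases h : R.MidBig ((R.turn.symm.trans R.turn.symm) d)
  · by_cases h' : R.IsTri d.symm
    · rw [ind_true h, ind_true (P := R.TightNext _) ⟨h, by
        rwa [Equiv.trans_apply, Equiv.apply_symm_apply, Equiv.apply_symm_apply]⟩]
      linarith [ind_nonneg (R.SideTail d)]
    · rw [ind_true (P := R.SideTail d) ⟨by simpa [turn_symm_eq] using h.symm, h'⟩]
      linarith [ind_le_one (R.MidBig ((R.turn.symm.trans R.turn.symm) d)),
        ind_nonneg (R.TightNext ((R.turn.symm.trans R.turn.symm) d))]
  · rw [ind_false h]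
    linarith [ind_nonneg (R.SideTail d),
      ind_nonneg (R.TightNext ((R.turn.symm.trans R.turn.symm) d))]

end Rotation

namespace Config

open Rotation

variable {R : Rotation G} {p : V} {X : Finset V} (C : Config R p X)
include C

theorem sum_mid_le [Fintype G.Dart] : ∑ d, ind (R.Mid d) ≤
    ∑ d, ind (R.MidBig d) + 2 * ∑ d, ind (R.Mid d ∧ deg G d.fst = 3) := by
  have h1 := sum_symm fun d : G.Dart => ind (R.Mid d ∧ deg G d.fst = 3)
  have h2 : ∑ d, ind (R.Mid d) ≤ ∑ d : G.Dart, (ind (R.MidBig d) +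
      ind (R.Mid d ∧ deg G d.fst = 3) + ind (R.Mid d.symm ∧ deg G d.symm.fst = 3)) := by
    refine Finset.sum_le_sum fun d _ => ?_
    by_cases h : R.Mid d
    · have a1 := C.deg_of_ne _ (C.fst_ne_of_isTri h.1)
      have a2 := C.deg_of_ne _ (C.fst_ne_of_isTri h.2)
      have b1 := ind_nonneg (R.MidBig d)
      have b2 := ind_nonneg (R.Mid d ∧ deg G d.fst = 3)
      have b3 := ind_nonneg (R.Mid d.symm ∧ deg G d.symm.fst = 3)
      rw [ind_true h]
      by_cases c1 : deg G d.fst = 3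
      · rw [ind_true (P := R.Mid d ∧ deg G d.fst = 3) ⟨h, c1⟩]; linarith
      by_cases c2 : deg G d.symm.fst = 3
      · rw [ind_true (P := R.Mid d.symm ∧ deg G d.symm.fst = 3) ⟨h.symm, c2⟩]; linarith
      · rw [ind_true (P := R.MidBig d) ⟨h, by omega, by change 4 ≤ deg G d.symm.fst; omega⟩]
        linarith
    · rw [ind_false h]
      have b1 := ind_nonneg (R.MidBig d)
      have b2 := ind_nonneg (R.Mid d ∧ deg G d.fst = 3)
      have b3 := ind_nonneg (R.Mid d.symm ∧ deg G d.symm.fst = 3)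
      linarith
  rw [Finset.sum_add_distrib, Finset.sum_add_distrib, h1] at h2
  linarith

theorem sum_debt_le [Fintype G.Dart] : ∑ d, R.debt p X d ≤ ∑ d, R.charge p X d := by
  have e1 := sum_symm fun d : G.Dart => ind (R.IsTri d)
  have e2 : ∑ d : G.Dart, ind (R.MidOpen (R.face.symm d.symm)) = ∑ d, ind (R.MidOpen d) := by
    rw [sum_symm fun d : G.Dart => ind (R.MidOpen (R.face.symm d))]
    exact Equiv.sum_comp R.face.symm fun d => ind (R.MidOpen d)
  have e3 : ∑ d : G.Dart, ind (R.MidOpen (R.face d.symm)) = ∑ d, ind (R.MidOpen d) := by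
    rw [sum_symm fun d : G.Dart => ind (R.MidOpen (R.face d))]
    exact Equiv.sum_comp R.face fun d => ind (R.MidOpen d)
  have e4 := Equiv.sum_comp R.face.symm fun d => ind (R.PaysHead p X d)
  have e5 : ∑ d, ind (R.Mid d) ≤ ∑ d, ind (R.MidOpen d) + ∑ d, ∑ m, ind (R.ChordOf d m) := by
    rw [Finset.sum_comm, ← Finset.sum_add_distrib]
    refine Finset.sum_le_sum fun m _ => ?_
    by_cases h : R.Mid m
    · by_cases hc : R.Chord m
      · have : ind (R.ChordOf ⟨(_, _), hc⟩ m) ≤ ∑ d, ind (R.ChordOf d m) :=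
          Finset.single_le_sum (f := fun d => ind (R.ChordOf d m)) (fun d _ => ind_nonneg _)
            (Finset.mem_univ _)
        rw [ind_true (P := R.ChordOf _ m) ⟨h, rfl, rfl⟩] at this
        linarith [ind_le_one (R.Mid m), ind_nonneg (R.MidOpen m)]
      · rw [ind_true (P := R.MidOpen m) ⟨h, hc⟩]
        linarith [ind_le_one (R.Mid m),
          Finset.sum_nonneg fun (d : G.Dart) (_ : d ∈ Finset.univ) => ind_nonneg (R.ChordOf d m)]
    · rw [ind_false h]
      linarith [ind_nonneg (R.MidOpen m),
        Finset.sum_nonneg fun (d : G.Dart) (_ : d ∈ Finset.univ) => ind_nonneg (R.ChordOf d m)]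
  have e6 := sum_sideHead_ge (R := R)
  have e7 := sum_sideTail_ge (R := R)
  have e8 := C.sum_mid_le
  simp only [Rotation.debt, Rotation.charge, Finset.sum_add_distrib, Finset.sum_sub_distrib,
    ← Finset.mul_sum]
  rw [e1, e2, e3, e4]
  linarith

theorem vertex_bound [Fintype V] [Fintype G.Dart] (v : V) :
    0 ≤ ∑ d ∈ outDarts v, R.debt p X d + ind (v ≠ p) * (((deg G v : ℝ) - 4) / 3)
      + (1/3) * ind (G.Adj v p) + (2/3) * ind (v ∈ X) := by
  have hpay : 0 ≤ ∑ d ∈ outDarts v,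
      (ind (R.PaysHead p X (R.face.symm d)) + ind (R.PaysTail p X d)) :=
    Finset.sum_nonneg fun d _ => add_nonneg (ind_nonneg _) (ind_nonneg _)
  have hA := ind_nonneg (G.Adj v p)
  have hX := ind_nonneg (v ∈ X)
  have hmid := C.two_mul_sum_mid_le v
  have hprev : ∑ d ∈ outDarts v, ind (R.TightPrev d) ≤ ∑ d ∈ outDarts v, ind (R.Mid d) :=
    Finset.sum_le_sum fun d _ => ind_mono fun h => h.1.1
  have hnext : ∑ d ∈ outDarts v, ind (R.TightNext d) ≤ ∑ d ∈ outDarts v, ind (R.Mid d) :=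
    Finset.sum_le_sum fun d _ => ind_mono fun h => h.1.1
  have h3 : ∑ d ∈ outDarts v, ind (R.Mid d ∧ deg G d.fst = 3) ≤
      ∑ d ∈ outDarts v, ind (R.Mid d) := Finset.sum_le_sum fun d _ => ind_mono fun h => h.1
  have hprev0 : deg G v < 5 → ∑ d ∈ outDarts v, ind (R.TightPrev d) = 0 := fun h5 =>
    Finset.sum_eq_zero fun d hd => ind_false fun h => by
      have := C.five_le_deg_of_tightPrev h
      rw [mem_outDarts.1 hd] at this
      omega
  have hnext0 : deg G v < 5 → ∑ d ∈ outDarts v, ind (R.TightNext d) = 0 := fun h5 =>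
    Finset.sum_eq_zero fun d hd => ind_false fun h => by
      have := C.five_le_deg_of_tightNext h
      rw [mem_outDarts.1 hd] at this
      omega
  have h30 : deg G v ≠ 3 → ∑ d ∈ outDarts v, ind (R.Mid d ∧ deg G d.fst = 3) = 0 := fun h5 =>
    Finset.sum_eq_zero fun d hd => ind_false fun h => h5 (mem_outDarts.1 hd ▸ h.2)
  obtain ⟨k, hk⟩ := exists_card_sum_ind (outDarts v) R.Mid
  rw [hk] at hmid hprev hnext h3
  have hk2 : 2 * k ≤ deg G v := by exact_mod_cast hmid
  have hdebt : ∑ d ∈ outDarts v, R.debt p X d =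
      -(1/3) * ∑ d ∈ outDarts v, ind (R.Mid d ∧ deg G d.fst = 3)
      - (1/12) * (∑ d ∈ outDarts v, ind (R.TightPrev d) + ∑ d ∈ outDarts v, ind (R.TightNext d))
      + (1/6) * ∑ d ∈ outDarts v,
        (ind (R.PaysHead p X (R.face.symm d)) + ind (R.PaysTail p X d)) := by
    simp only [Rotation.debt, Finset.sum_add_distrib, Finset.sum_sub_distrib, ← Finset.mul_sum]
  rw [hdebt]
  by_cases hv : v = p
  · have hk0 : (k : ℝ) = 0 := by
      rw [← hk]
      refine Finset.sum_eq_zero fun d hd => ind_false fun h => ?_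
      exact C.fst_ne_of_isTri h.1 ((mem_outDarts.1 hd).trans hv)
    rw [hk0] at hprev hnext h3
    rw [ind_false (not_not.2 hv)]
    linarith
  · rw [ind_true hv]
    have hd3 := C.deg_of_ne v hv
    by_cases hd : deg G v = 3
    · rw [hprev0 (by omega), hnext0 (by omega), hd]
      have hk1 : (k : ℝ) ≤ 1 := by exact_mod_cast (by omega : k ≤ 1)
      by_cases hX : v ∈ X
      · rw [ind_true hX]
        norm_num
        linarith
      · have hk0 : (k : ℝ) = 0 := by
          rw [← hk]
          refine Finset.sum_eq_zero fun d hd' => ind_false fun h => hX ?_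
          rw [← mem_outDarts.1 hd'] at hd ⊢
          exact C.mem_X_of_mid h hd
        by_cases hap : G.Adj v p
        · rw [ind_true hap]
          norm_num
          linarith
        · have := C.two_le_sum_pays ⟨hv, hd, hap, hX⟩
          norm_num
          linarith
    · rw [h30 hd]
      have hd4 : (4 : ℝ) ≤ deg G v := by exact_mod_cast (by omega : 4 ≤ deg G v)
      by_cases hd5 : deg G v < 5
      · rw [hprev0 hd5, hnext0 hd5]
        linarith
      · have : k + 8 ≤ 2 * deg G v := by omega
        have : (k : ℝ) + 8 ≤ 2 * deg G v := by exact_mod_cast this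
        linarith

/-- The discharging argument: a configuration violates Euler's formula. -/
theorem false_of_euler [Fintype V] [Fintype G.Dart]
    (hE : (Fintype.card G.Dart : ℝ) / 2 - Fintype.card V + 1 ≤
      ∑ d, (1 : ℝ) / Function.minimalPeriod R.face d)
    (hD : 4 * Fintype.card V + X.card ≤ Fintype.card G.Dart + 2) : False := by
  classical
  have h1 : ∑ d, R.charge p X d ≤ ∑ d, (1 - 4 / (R.len d : ℝ)) :=
    Finset.sum_le_sum fun d _ => C.charge_le d
  have h2 := C.sum_debt_le
  have h3 := Finset.sum_nonneg fun (v : V) (_ : v ∈ Finset.univ) => C.vertex_bound v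
  have h4 : ∑ d, (1 - 4 / (R.len d : ℝ)) = Fintype.card G.Dart -
      4 * ∑ d, (1 : ℝ) / Function.minimalPeriod R.face d := by
    rw [Finset.sum_sub_distrib, Finset.mul_sum]
    simp [Rotation.len, div_eq_mul_inv]
  have hdart : (∑ v, (deg G v : ℝ)) = Fintype.card G.Dart := by
    have := sum_outDarts (G := G) fun _ => 1
    simpa [card_outDarts] using this
  have hadj : ∑ v, ind (G.Adj v p) = deg G p := by
    rw [deg, Set.ncard_eq_toFinset_card']
    exact sum_ind_eq_card fun v => by simp [SimpleGraph.adj_comm]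
  have hX : ∑ v, ind (v ∈ X) = X.card := by
    exact sum_ind_eq_card fun v => Iff.rfl
  have hne : ∑ v, ind (v ≠ p) * (((deg G v : ℝ) - 4) / 3) =
      (Fintype.card G.Dart - 4 * Fintype.card V) / 3 - ((deg G p : ℝ) - 4) / 3 := by
    rw [← hdart]
    have : ∀ v, ind (v ≠ p) * (((deg G v : ℝ) - 4) / 3) =
        ((deg G v : ℝ) - 4) / 3 - if v = p then ((deg G v : ℝ) - 4) / 3 else 0 := by
      intro v
      by_cases h : v = p
      · simp [h, ind]
      · simp [h, ind]
    simp only [this, Finset.sum_sub_distrib, ← Finset.sum_div]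
    simp
    ring
  simp only [Finset.sum_add_distrib, ← Finset.mul_sum] at h3
  rw [sum_outDarts, hadj, hX, hne] at h3
  have hD' : (4 : ℝ) * Fintype.card V + X.card ≤ Fintype.card G.Dart + 2 := by exact_mod_cast hD
  linarith

end Config
end ChoosSep

namespace ChoosSep

open MvPolynomial

variable {σ : Type*}

/-- `f` has degree at most `n`, and its part of degree `n` has nonnegative coefficients. -/
def TopNonneg (f : MvPolynomial σ ℚ) (n : ℕ) : Prop :=
  (∀ m : σ →₀ ℕ, n < m.degree → f.coeff m = 0) ∧ ∀ m : σ →₀ ℕ, m.degree = n → 0 ≤ f.coeff m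

/-- `M` is an exponent of top degree of `f`, and the top degree part of `f` has nonnegative
coefficients. -/
def Lead (f : MvPolynomial σ ℚ) (M : σ →₀ ℕ) : Prop :=
  TopNonneg f M.degree ∧ 0 < f.coeff M

theorem TopNonneg.add {f g : MvPolynomial σ ℚ} {n : ℕ} (hf : TopNonneg f n)
    (hg : TopNonneg g n) : TopNonneg (f + g) n :=
  ⟨fun m hm => by rw [coeff_add, hf.1 m hm, hg.1 m hm, add_zero],
    fun m hm => by rw [coeff_add]; exact add_nonneg (hf.2 m hm) (hg.2 m hm)⟩

theorem topNonneg_of_totalDegree_lt {f : MvPolynomial σ ℚ} {n : ℕ} (h : f.totalDegree < n) :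
    TopNonneg f n := by
  have : ∀ m : σ →₀ ℕ, n ≤ m.degree → f.coeff m = 0 := fun m hm =>
    coeff_eq_zero_of_totalDegree_lt (h.trans_le hm)
  exact ⟨fun m hm => this m hm.le, fun m hm => (this m hm.ge).ge⟩

theorem TopNonneg.mul {f g : MvPolynomial σ ℚ} {m n : ℕ} (hf : TopNonneg f m)
    (hg : TopNonneg g n) : TopNonneg (f * g) (m + n) := by
  classical
  have key : ∀ k : σ →₀ ℕ, ∀ x ∈ Finset.HasAntidiagonal.antidiagonal k, m + n ≤ k.degree →
      0 ≤ f.coeff x.1 * g.coeff x.2 ∧ (m + n < k.degree → f.coeff x.1 * g.coeff x.2 = 0) := by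
    intro k x hx hk
    rw [Finset.HasAntidiagonal.mem_antidiagonal] at hx
    rw [← hx, map_add] at hk ⊢
    rcases lt_trichotomy m x.1.degree with h | h | h
    · rw [hf.1 _ h, zero_mul]; exact ⟨le_rfl, fun _ => rfl⟩
    · rcases lt_or_eq_of_le (show n ≤ x.2.degree by omega) with h' | h'
      · rw [hg.1 _ h', mul_zero]; exact ⟨le_rfl, fun _ => rfl⟩
      · exact ⟨mul_nonneg (hf.2 _ h.symm) (hg.2 _ h'.symm), fun h => by omega⟩
    · rw [hg.1 x.2 (by omega), mul_zero]; exact ⟨le_rfl, fun _ => rfl⟩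
  refine ⟨fun k hk => ?_, fun k hk => ?_⟩ <;> rw [coeff_mul]
  · exact Finset.sum_eq_zero fun x hx => (key k x hx hk.le).2 hk
  · exact Finset.sum_nonneg fun x hx => (key k x hx hk.ge).1

theorem Lead.mul {f g : MvPolynomial σ ℚ} {M N : σ →₀ ℕ} (hf : Lead f M) (hg : Lead g N) :
    Lead (f * g) (M + N) := by
  classical
  refine ⟨by rw [map_add]; exact hf.1.mul hg.1, ?_⟩
  rw [coeff_mul]
  refine (mul_pos hf.2 hg.2).trans_le (Finset.single_le_sum
    (f := fun x : (σ →₀ ℕ) × (σ →₀ ℕ) => f.coeff x.1 * g.coeff x.2) (fun x hx => ?_)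
    (Finset.HasAntidiagonal.mem_antidiagonal.2 (rfl : (M, N).1 + (M, N).2 = M + N)))
  rw [Finset.HasAntidiagonal.mem_antidiagonal] at hx
  have hd : x.1.degree + x.2.degree = M.degree + N.degree := by rw [← map_add, hx, map_add]
  rcases lt_trichotomy M.degree x.1.degree with h | h | h
  · simp [hf.1.1 _ h]
  · exact mul_nonneg (hf.1.2 _ h.symm) (hg.1.2 _ (by omega))
  · simp [hg.1.1 x.2 (by omega)]

theorem lead_one : Lead (1 : MvPolynomial σ ℚ) 0 := by
  classical
  refine ⟨⟨fun m hm => ?_, fun m hm => ?_⟩, by simp⟩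
  · rw [coeff_one, if_neg]
    rintro rfl
    exact hm.ne rfl
  · rw [coeff_one]; split_ifs <;> norm_num

theorem Lead.prod {ι : Type*} (s : Finset ι) {f : ι → MvPolynomial σ ℚ} {M : ι → σ →₀ ℕ}
    (h : ∀ i ∈ s, Lead (f i) (M i)) : Lead (∏ i ∈ s, f i) (∑ i ∈ s, M i) := by
  classical
  induction s using Finset.induction_on with
  | empty => simpa using lead_one
  | insert a s ha ih =>
    rw [Finset.prod_insert ha, Finset.sum_insert ha]
    exact (h a (by simp)).mul (ih fun i hi => h i (by simp [hi]))

theorem Lead.add {f g : MvPolynomial σ ℚ} {M : σ →₀ ℕ} (hf : Lead f M)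
    (hg : TopNonneg g M.degree) : Lead (f + g) M :=
  ⟨hf.1.add hg, by rw [coeff_add]; exact add_pos_of_pos_of_nonneg hf.2 (hg.2 M rfl)⟩

theorem lead_X (u : σ) : Lead (X u : MvPolynomial σ ℚ) (Finsupp.single u 1) := by
  classical
  refine ⟨⟨fun m hm => ?_, fun m hm => ?_⟩, by simp⟩
  · rw [coeff_X, if_neg]
    rintro rfl
    exact hm.ne rfl
  · rw [coeff_X]; split_ifs <;> norm_num

theorem Lead.C_mul {f : MvPolynomial σ ℚ} {M : σ →₀ ℕ} (hf : Lead f M) {α : ℚ} (hα : 0 < α) :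
    Lead (C α * f) M :=
  ⟨⟨fun m hm => by rw [coeff_C_mul, hf.1.1 m hm, mul_zero],
    fun m hm => by rw [coeff_C_mul]; exact mul_nonneg hα.le (hf.1.2 m hm)⟩,
    by rw [coeff_C_mul]; exact mul_pos hα hf.2⟩

/-- A polynomial with a leading exponent bounded by two does not vanish on the grid. -/
theorem Lead.exists_eval_ne_zero [Finite σ] {f : MvPolynomial σ ℚ} {M : σ →₀ ℕ} (hf : Lead f M)
    (hM : ∀ v, M v ≤ 2) :
    ∃ s : σ → ℚ, (∀ v, s v ∈ ({0, 1, 2} : Finset ℚ)) ∧ eval s f ≠ 0 := by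
  refine combinatorial_nullstellensatz_exists_eval_nonzero f M hf.2.ne' ?_
    (fun _ => {0, 1, 2}) fun i => ?_
  · refine le_antisymm ?_ (le_totalDegree (mem_support_iff.2 hf.2.ne'))
    rw [totalDegree, Finset.sup_le_iff]
    intro m hm
    by_contra h
    exact (mem_support_iff.1 hm) (hf.1.1 m (by simpa [Finsupp.degree_apply, Finsupp.sum] using h))
  · have : ({0, 1, 2} : Finset ℚ).card = 3 := by norm_num
    rw [this]
    have := hM i
    omega

/-- The variable of a vertex of `S`, and a constant for the other vertices. -/
noncomputable def var [DecidableEq σ] (S : Finset σ) (base : σ → ℚ) (v : σ) : MvPolynomial σ ℚ :=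
  if v ∈ S then X v else C (base v)

section var

variable [DecidableEq σ] {S : Finset σ} {base : σ → ℚ} {u v : σ}

theorem lead_var (h : v ∈ S) : Lead (var S base v) (Finsupp.single v 1) := by
  rw [var, if_pos h]; exact lead_X v

theorem totalDegree_var_le : (var S base v).totalDegree ≤ if v ∈ S then 1 else 0 := by
  unfold var
  split_ifs <;> simp

theorem topNonneg_var : TopNonneg (var S base v) 1 := by
  by_cases h : v ∈ S
  · simpa using (lead_var h).1
  · refine topNonneg_of_totalDegree_lt (totalDegree_var_le.trans_lt ?_)
    simp [h]

theorem lead_linear {α β a c : ℚ} (hα : 0 < α) (hβ : 0 < β) {t : σ} (ht : t = u ∨ t = v)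
    (htS : t ∈ S) :
    Lead (C α * (var S base u - C a) + C β * (var S base v - C c)) (Finsupp.single t 1) := by
  have hC : TopNonneg (C (-(α * a) - β * c) : MvPolynomial σ ℚ) 1 :=
    topNonneg_of_totalDegree_lt (by rw [totalDegree_C]; norm_num)
  have hm : ∀ {γ : ℚ} {w : σ}, 0 < γ → TopNonneg (C γ * var S base w) 1 := by
    intro γ w hγ
    exact ⟨fun m hm => by rw [coeff_C_mul, topNonneg_var.1 m hm, mul_zero],
      fun m hm => by rw [coeff_C_mul]; exact mul_nonneg hγ.le (topNonneg_var.2 m hm)⟩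
  have he : C α * (var S base u - C a) + C β * (var S base v - C c) =
      C α * var S base u + C β * var S base v + C (-(α * a) - β * c) := by
    simp only [map_sub, map_neg, map_mul]; ring
  have hd : (Finsupp.single t 1 : σ →₀ ℕ).degree = 1 := by simp
  rw [he]
  refine Lead.add ?_ (by rwa [hd])
  rcases ht with rfl | rfl
  · exact ((lead_var htS).C_mul hα).add (by rw [hd]; exact hm hβ)
  · rw [add_comm]
    exact ((lead_var htS).C_mul hβ).add (by rw [hd]; exact hm hα)

end var
end ChoosSep

namespace ChoosSep

open Classical in
/-- If at most `2 * #U` edges touch `U`, then for some nonempty `S ⊆ U` one can choose for each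
edge touching `S` an end in `S` so that no vertex is chosen more than twice. -/
theorem exists_tail {ι V : Type*} (F : Finset ι) (inc : ι → V → Prop) :
    ∀ (n : ℕ) (U : Finset V), U.card = n → U.Nonempty →
      {e ∈ F | ∃ v ∈ U, inc e v}.card ≤ 2 * U.card →
      ∃ S ⊆ U, S.Nonempty ∧ ∃ tail : ι → V,
        (∀ e ∈ F, (∃ v ∈ S, inc e v) → tail e ∈ S ∧ inc e (tail e)) ∧
        ∀ v, {e ∈ F | (∃ w ∈ S, inc e w) ∧ tail e = v}.card ≤ 2 := by
  intro n
  induction n using Nat.strong_induction_on with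
  | _ n ih =>
    intro U hn hU hF
    let t : {e // e ∈ F ∧ ∃ v ∈ U, inc e v} → Finset (V × Fin 2) := fun e =>
      {v ∈ U | inc e.1 v} ×ˢ Finset.univ
    by_cases hall : ∀ A : Finset {e // e ∈ F ∧ ∃ v ∈ U, inc e v}, A.card ≤ (A.biUnion t).card
    · obtain ⟨f, hf, hft⟩ := (Finset.all_card_le_biUnion_card_iff_exists_injective t).1 hall
      obtain ⟨v₀, hv₀⟩ := hU
      refine ⟨U, subset_rfl, ⟨v₀, hv₀⟩,
        fun e => if h : e ∈ F ∧ ∃ v ∈ U, inc e v then (f ⟨e, h⟩).1 else v₀, ?_, ?_⟩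
      · intro e he hv
        beta_reduce
        rw [dif_pos ⟨he, hv⟩]
        simpa [t] using hft ⟨e, he, hv⟩
      · intro v
        have := Finset.card_le_card_of_injOn (s := {e ∈ F | (∃ w ∈ U, inc e w) ∧
            (if h : e ∈ F ∧ ∃ v ∈ U, inc e v then (f ⟨e, h⟩).1 else v₀) = v})
          (t := (Finset.univ : Finset (Fin 2)))
          (fun e => if h : e ∈ F ∧ ∃ v ∈ U, inc e v then (f ⟨e, h⟩).2 else 0)
          (fun _ _ => Finset.mem_coe.2 (Finset.mem_univ _)) ?_
        · simpa using this
        · intro e he e' he' hee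
          simp only [Finset.coe_filter, Set.mem_ofPred_eq] at he he'
          have h : e ∈ F ∧ ∃ v ∈ U, inc e v := ⟨he.1, he.2.1⟩
          have h' : e' ∈ F ∧ ∃ v ∈ U, inc e' v := ⟨he'.1, he'.2.1⟩
          have h1 := he.2.2
          have h2 := he'.2.2
          simp only [dif_pos h, dif_pos h'] at h1 h2 hee
          have := hf (Prod.ext (h1.trans h2.symm) hee)
          exact congrArg Subtype.val this
    · push Not at hall
      obtain ⟨A, hA⟩ := hall
      set T := {v ∈ U | ∃ e ∈ A, inc e.1 v} with hT
      have hAT : A.biUnion t = T ×ˢ Finset.univ := by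
        ext ⟨v, i⟩
        simp only [Finset.mem_biUnion, t, T, Finset.mem_product, Finset.mem_filter,
          Finset.mem_univ, and_true]
        exact ⟨fun ⟨e, he, hv, hi⟩ => ⟨hv, e, he, hi⟩, fun ⟨hv, e, he, hi⟩ => ⟨e, he, hv, hi⟩⟩
      rw [hAT, Finset.card_product, Finset.card_univ, Fintype.card_fin] at hA
      have hTU : T ⊆ U := Finset.filter_subset _ _
      have hT0 : T.Nonempty := by
        have : A.Nonempty := Finset.card_pos.1 (by omega)
        obtain ⟨⟨e, he, v, hv, hev⟩, heA⟩ := this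
        exact ⟨v, Finset.mem_filter.2 ⟨hv, _, heA, hev⟩⟩
      have hsd := Finset.card_sdiff_add_card_eq_card hTU
      have hdisj : {e ∈ F | ∃ v ∈ U \ T, inc e v} ∪ A.map (Function.Embedding.subtype _) ⊆
          {e ∈ F | ∃ v ∈ U, inc e v} := by
        intro e he
        rcases Finset.mem_union.1 he with he | he
        · obtain ⟨h1, v, hv, h2⟩ := Finset.mem_filter.1 he
          exact Finset.mem_filter.2 ⟨h1, v, (Finset.mem_sdiff.1 hv).1, h2⟩
        · obtain ⟨e', -, rfl⟩ := Finset.mem_map.1 he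
          exact Finset.mem_filter.2 e'.2
      have hcard := Finset.card_le_card hdisj
      rw [Finset.card_union_of_disjoint, Finset.card_map] at hcard
      · have hpos := hT0.card_pos
        have hle : {e ∈ F | ∃ v ∈ U \ T, inc e v}.card ≤ 2 * (U \ T).card := by omega
        obtain ⟨S, hS, h⟩ := ih (U \ T).card (by omega) (U \ T) rfl
          (Finset.card_pos.1 (by omega)) hle
        exact ⟨S, hS.trans Finset.sdiff_subset, h⟩
      · rw [Finset.disjoint_left]
        intro e he he'
        obtain ⟨e', heA, rfl⟩ := Finset.mem_map.1 he'
        obtain ⟨-, v, hv, h2⟩ := Finset.mem_filter.1 he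
        rw [Finset.mem_sdiff] at hv
        exact hv.2 (Finset.mem_filter.2 ⟨hv.1, e', heA, h2⟩)

open Classical in
/-- Signs can be chosen so that at least half of the prescribed comparisons hold. -/
theorem exists_signs {ι V : Type*} [Fintype V] (a c : ι → V) (t : ι → Bool) (B : Finset ι)
    (hac : ∀ b ∈ B, a b ≠ c b) :
    ∃ ε : V → Bool, B.card ≤ 2 * {b ∈ B | (ε (a b) ^^ ε (c b)) = t b}.card := by
  by_contra! h
  have hsum : ∑ ε : V → Bool, 2 * {b ∈ B | (ε (a b) ^^ ε (c b)) = t b}.card <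
      ∑ ε : V → Bool, B.card :=
    Finset.sum_lt_sum_of_nonempty Finset.univ_nonempty fun ε _ => h ε
  have hswap : ∀ b ∈ B, 2 * ∑ ε : V → Bool, (if (ε (a b) ^^ ε (c b)) = t b then 1 else 0) =
      Fintype.card (V → Bool) := by
    intro b hb
    let flip : (V → Bool) → (V → Bool) := fun ε => Function.update ε (a b) (!ε (a b))
    have hflip : Function.Involutive flip := by
      intro ε
      ext v
      by_cases hv : v = a b
      · subst hv; simp [flip]
      · simp [flip, hv]
    have h1 : ∑ ε : V → Bool, (if (ε (a b) ^^ ε (c b)) = t b then 1 else 0) =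
        ∑ ε : V → Bool, (if (ε (a b) ^^ ε (c b)) = t b then 0 else 1) := by
      refine Fintype.sum_equiv hflip.toPerm _ _ fun ε => ?_
      have hcb : c b ≠ a b := (hac b hb).symm
      simp only [Function.Involutive.coe_toPerm, flip, Function.update_self,
        Function.update_of_ne hcb]
      cases ε (a b) <;> cases ε (c b) <;> cases t b <;> rfl
    rw [two_mul]
    nth_rewrite 2 [h1]
    rw [← Finset.sum_add_distrib, Fintype.card_eq_sum_ones]
    exact Finset.sum_congr rfl fun ε _ => by split_ifs <;> rfl
  rw [← Finset.mul_sum] at hsum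
  simp only [Finset.card_filter] at hsum
  rw [Finset.sum_comm, Finset.mul_sum, Finset.sum_congr rfl hswap] at hsum
  simp only [Finset.sum_const, smul_eq_mul, Finset.card_univ] at hsum
  rw [mul_comm] at hsum
  exact lt_irrefl _ hsum

end ChoosSep

namespace ChoosSep

open MvPolynomial Classical

/-- The common color of the lists of two adjacent vertices. -/
def common {V : Type} (L : V → Finset ℕ) (u v : V) : ℕ := ∑ c ∈ L u ∩ L v, c

theorem common_comm {V : Type} (L : V → Finset ℕ) (u v : V) : common L u v = common L v u := by
  rw [common, common, Finset.inter_comm]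

/-- A list assignment for which all proper induced subgraphs containing `p` are colorable, but the
whole graph is not. -/
structure Critical {V : Type} (G : SimpleGraph V) (p : V) (L : V → Finset ℕ) : Prop where
  card_inter : ∀ ⦃u v⦄, G.Adj u v → (L u ∩ L v).card = 1
  card_p : (L p).card = 1
  card_of_ne : ∀ v, v ≠ p → (L v).card = 3
  exists_partial : ∀ O : Set V, p ∈ O → O ≠ Set.univ →
    ∃ φ : V → ℕ, (∀ v ∈ O, φ v ∈ L v) ∧ ∀ u ∈ O, ∀ v ∈ O, G.Adj u v → φ u ≠ φ v
  not_colorable : ¬ ColorableWith G L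

/-- Rational coordinates of the colors in each list. -/
structure Coord {V : Type} (p : V) (L : V → Finset ℕ) (f : V → ℕ → ℚ) : Prop where
  inj : ∀ v, Set.InjOn (f v) (L v)
  mem : ∀ v, v ≠ p → ∀ c ∈ L v, f v c ∈ ({0, 1, 2} : Finset ℚ)
  surj : ∀ v, v ≠ p → ∀ x ∈ ({0, 1, 2} : Finset ℚ), ∃ c ∈ L v, f v c = x

/-- The coordinate in the list of `u` of the common color with `v`. -/
def hit {V : Type} (L : V → Finset ℕ) (f : V → ℕ → ℚ) (u v : V) : ℚ := f u (common L u v)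

/-- The exponent that an edge touching `S` contributes to its chosen end. -/
noncomputable def mon {V : Type} (S : Finset V) (tail : Sym2 V → V) (e : Sym2 V) : V →₀ ℕ :=
  if ∃ v ∈ S, v ∈ e then Finsupp.single (tail e) 1 else 0

/-- The linear polynomial of an edge, vanishing if both ends get their common color. -/
noncomputable def edgePoly {V : Type} (L : V → Finset ℕ) (f : V → ℕ → ℚ) (S : Finset V)
    (base : V → ℚ) (u v : V) : MvPolynomial V ℚ :=
  C 1 * (var S base u - C (hit L f u v)) + C 1 * (var S base v - C (hit L f v u))

namespace Critical

variable {V : Type} {G : SimpleGraph V} {p : V} {L : V → Finset ℕ}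

theorem inter_eq (K : Critical G p L) {u v : V} (h : G.Adj u v) : L u ∩ L v = {common L u v} := by
  obtain ⟨c, hc⟩ := Finset.card_eq_one.1 (K.card_inter h)
  rw [common, hc, Finset.sum_singleton]

theorem common_mem (K : Critical G p L) {u v : V} (h : G.Adj u v) : common L u v ∈ L u := by
  have : common L u v ∈ L u ∩ L v := by rw [K.inter_eq h]; simp
  exact (Finset.mem_inter.1 this).1

theorem eq_common (K : Critical G p L) {u v : V} (h : G.Adj u v) {c : ℕ} (hu : c ∈ L u)
    (hv : c ∈ L v) : c = common L u v := by
  have : c ∈ L u ∩ L v := Finset.mem_inter.2 ⟨hu, hv⟩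
  rw [K.inter_eq h] at this
  exact Finset.mem_singleton.1 this

/-- The central reduction: gadget polynomials for the vertices of an independent set `W` of
vertices of degree three, together with an orientation of the remaining edges touching `S`,
contradict criticality. -/
theorem false_of_gadgets [Fintype V] (K : Critical G p L) {f : V → ℕ → ℚ} (hf : Coord p L f)
    {W S : Finset V} (hpW : p ∉ W) (hpS : p ∉ S) (hWS : Disjoint W S) (hS : S.Nonempty)
    (hind : ∀ u ∈ W, ∀ v ∈ W, ¬ G.Adj u v) (hdeg : ∀ w ∈ W, (G.neighborSet w).ncard = 3)
    {tail : Sym2 V → V}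
    (htail : ∀ e ∈ G.edgeSet, (∀ w ∈ W, w ∉ e) → (∃ v ∈ S, v ∈ e) → tail e ∈ S ∧ tail e ∈ e)
    (hcount : ∀ v, {e : Sym2 V | (e ∈ G.edgeSet ∧ ∀ w ∈ W, w ∉ e) ∧
      (∃ w ∈ S, w ∈ e) ∧ tail e = v}.ncard ≤ 2)
    (T : V → Finset (Sym2 V)) (hT : ∀ w ∈ W, ∀ e ∈ T w, e ∈ G.edgeSet ∧ ∀ w ∈ W, w ∉ e)
    (hTd : ∀ w ∈ W, ∀ w' ∈ W, w ≠ w' → Disjoint (T w) (T w'))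
    (hgad : ∀ base : V → ℚ, ∀ w ∈ W, (∃ n ∈ S, G.Adj w n) → ∃ Φ : MvPolynomial V ℚ,
      Lead Φ (∑ e ∈ T w, mon S tail e) ∧ ∀ s, eval s Φ ≠ 0 →
        (∀ u v, s(u, v) ∈ T w → (u ∈ S ∨ v ∈ S) → ¬ (eval s (var S base u) = hit L f u v ∧
          eval s (var S base v) = hit L f v u)) ∧
        ¬ ∀ n, G.Adj w n → eval s (var S base n) = hit L f n w) : False := by
  set W' := {w ∈ W | ∃ n ∈ S, G.Adj w n} with hW'
  have hWS' : ∀ v, v ∈ S → v ∉ W := fun v hv hw => Finset.disjoint_left.1 hWS hw hv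
  have hW'W : ∀ v, v ∈ W' → v ∈ W := fun v hv => (Finset.mem_filter.1 hv).1
  obtain ⟨φ, hφL, hφ⟩ := K.exists_partial {v | v ∉ S ∧ v ∉ W'}
    ⟨hpS, fun h => hpW (hW'W _ h)⟩ (fun h => by
      obtain ⟨v, hv⟩ := hS
      have : v ∈ {v | v ∉ S ∧ v ∉ W'} := by rw [h]; trivial
      exact this.1 hv)
  let base : V → ℚ := fun v => f v (φ v)
  have hgad' : ∀ w, ∃ Φ : MvPolynomial V ℚ, w ∈ W' → Lead Φ (∑ e ∈ T w, mon S tail e) ∧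
      ∀ s, eval s Φ ≠ 0 →
        (∀ u v, s(u, v) ∈ T w → (u ∈ S ∨ v ∈ S) → ¬ (eval s (var S base u) = hit L f u v ∧
          eval s (var S base v) = hit L f v u)) ∧
        ¬ ∀ n, G.Adj w n → eval s (var S base n) = hit L f n w := by
    intro w
    by_cases hw : w ∈ W'
    · obtain ⟨Φ, h⟩ := hgad base w (hW'W w hw) (Finset.mem_filter.1 hw).2
      exact ⟨Φ, fun _ => h⟩
    · exact ⟨0, fun h => absurd h hw⟩
  choose Φ hΦ using hgad'
  let P : Sym2 V → MvPolynomial V ℚ := fun e => if ∃ v ∈ S, v ∈ e then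
    Sym2.lift ⟨edgePoly L f S base, fun u v => by rw [edgePoly, edgePoly, add_comm]⟩ e else 1
  let F₀ : Finset (Sym2 V) := {e | e ∈ G.edgeSet ∧ ∀ w ∈ W, w ∉ e}
  have hF₀ : ∀ e, e ∈ F₀ ↔ e ∈ G.edgeSet ∧ ∀ w ∈ W, w ∉ e := fun e => by simp [F₀]
  have hP : ∀ e ∈ F₀, Lead (P e) (mon S tail e) := by
    intro e he
    rw [hF₀] at he
    by_cases h : ∃ v ∈ S, v ∈ e
    · obtain ⟨h1, h2⟩ := htail e he.1 he.2 h
      simp only [P, mon, if_pos h]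
      induction e with
      | h u v => exact lead_linear one_pos one_pos (Sym2.mem_iff.1 h2) h1
    · simp only [P, mon, if_neg h]
      exact lead_one
  have hbi : W'.biUnion T ⊆ F₀ := by
    intro e he
    obtain ⟨w, hw, he⟩ := Finset.mem_biUnion.1 he
    exact (hF₀ e).2 (hT w (hW'W w hw) e he)
  have hlead : Lead ((∏ e ∈ F₀ \ W'.biUnion T, P e) * ∏ w ∈ W', Φ w) (∑ e ∈ F₀, mon S tail e) := by
    rw [← Finset.sum_sdiff hbi, Finset.sum_biUnion fun w hw w' hw' h =>
      hTd w (hW'W w hw) w' (hW'W w' hw') h]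
    exact (Lead.prod _ fun e he => hP e (Finset.mem_sdiff.1 he).1).mul
      (Lead.prod _ fun w hw => (hΦ w hw).1)
  obtain ⟨s, hs, hne⟩ := hlead.exists_eval_ne_zero fun v => by
    rw [Finsupp.finsetSum_apply]
    refine le_trans (le_of_eq ?_) (hcount v)
    have : {e : Sym2 V | (e ∈ G.edgeSet ∧ ∀ w ∈ W, w ∉ e) ∧ (∃ w ∈ S, w ∈ e) ∧ tail e = v} =
        (({e ∈ F₀ | (∃ w ∈ S, w ∈ e) ∧ tail e = v} : Finset (Sym2 V)) : Set (Sym2 V)) := by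
      ext e; simp [hF₀]
    rw [this, Set.ncard_coe_finset, Finset.card_filter]
    refine Finset.sum_congr rfl fun e _ => ?_
    unfold mon
    by_cases h : ∃ v ∈ S, v ∈ e <;> simp [h, Finsupp.single_apply]
  rw [map_mul, map_prod, map_prod, mul_ne_zero_iff, Finset.prod_ne_zero_iff,
    Finset.prod_ne_zero_iff] at hne
  obtain ⟨hneP, hneΦ⟩ := hne
  have hdec : ∀ v, ∃ c, v ∈ S → c ∈ L v ∧ f v c = s v := by
    intro v
    by_cases hv : v ∈ S
    · obtain ⟨c, hc⟩ := hf.surj v (fun h => hpS (h ▸ hv)) (s v) (hs v)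
      exact ⟨c, fun _ => hc⟩
    · exact ⟨0, fun h => absurd h hv⟩
  choose dec hdec using hdec
  let ψ : V → ℕ := fun v => if v ∈ S then dec v else φ v
  have hval : ∀ v, eval s (var S base v) = f v (ψ v) := by
    intro v
    by_cases hv : v ∈ S
    · simp [var, ψ, hv, (hdec v hv).2]
    · simp [var, ψ, hv, base]
  have hψL : ∀ v, v ∉ W' → ψ v ∈ L v := by
    intro v hv'
    by_cases hv : v ∈ S
    · simpa [ψ, hv] using (hdec v hv).1
    · simpa [ψ, hv] using hφL v ⟨hv, hv'⟩
  have hnbr : ∀ u ∈ S, ∀ v, G.Adj u v → v ∉ W' → v ∉ W := fun u hu v h hv hw =>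
    hv (Finset.mem_filter.2 ⟨hw, u, hu, h.symm⟩)
  have hψ : ∀ u, u ∉ W' → ∀ v, v ∉ W' → G.Adj u v → ψ u ≠ ψ v := by
    intro u hu v hv huv heq
    have h1 : ψ u = common L u v := K.eq_common huv (hψL u hu) (heq ▸ hψL v hv)
    have h2 : ψ v = common L v u := by rw [← heq, h1, common_comm]
    have h3 : eval s (var S base u) = hit L f u v := by rw [hval, h1, hit]
    have h4 : eval s (var S base v) = hit L f v u := by rw [hval, h2, hit]
    by_cases huS : u ∈ S ∨ v ∈ S
    · have hF : s(u, v) ∈ F₀ := by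
        rw [hF₀]
        have : u ∉ W ∧ v ∉ W := by
          rcases huS with h | h
          · exact ⟨hWS' u h, hnbr u h v huv hv⟩
          · exact ⟨hnbr v h u huv.symm hu, hWS' v h⟩
        refine ⟨huv, fun w hw hwe => ?_⟩
        rcases Sym2.mem_iff.1 hwe with rfl | rfl
        · exact this.1 hw
        · exact this.2 hw
      by_cases hTw : s(u, v) ∈ W'.biUnion T
      · obtain ⟨w, hw, he⟩ := Finset.mem_biUnion.1 hTw
        exact ((hΦ w hw).2 s (hneΦ w hw)).1 u v he huS ⟨h3, h4⟩
      · refine hneP _ (Finset.mem_sdiff.2 ⟨hF, hTw⟩) ?_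
        have : ∃ x ∈ S, x ∈ s(u, v) := by
          rcases huS with h | h
          · exact ⟨u, h, by simp⟩
          · exact ⟨v, h, by simp⟩
        simp only [P, if_pos this, Sym2.lift_mk, edgePoly, map_add, map_mul, map_sub, eval_C]
        rw [h3, h4]
        ring
    · push Not at huS
      refine hφ u ⟨huS.1, hu⟩ v ⟨huS.2, hv⟩ huv ?_
      simpa [ψ, huS.1, huS.2] using heq
  have hfree : ∀ w, ∃ c, w ∈ W' → c ∈ L w ∧ ∀ n, G.Adj w n → ψ n ≠ c := by
    intro w
    by_cases hw : w ∈ W'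
    swap
    · exact ⟨0, fun h => absurd h hw⟩
    by_contra! hcon
    have hcon' : ∀ c ∈ L w, ∃ n, G.Adj w n ∧ ψ n = c := fun c hc => (hcon c).2 hc
    refine ((hΦ w hw).2 s (hneΦ w hw)).2 fun n hn => ?_
    have hnW : ∀ n, G.Adj w n → n ∉ W' := fun n hn h => hind w (hW'W w hw) n (hW'W n h) hn
    have hsub : (L w : Set ℕ) ⊆ ψ '' G.neighborSet w := fun c hc => by
      obtain ⟨n, hn, rfl⟩ := hcon' c hc
      exact ⟨n, hn, rfl⟩
    have heq := Set.eq_of_subset_of_ncard_le hsub (by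
      rw [Set.ncard_coe_finset, K.card_of_ne w (fun h => hpW (h ▸ hW'W w hw)),
        ← hdeg w (hW'W w hw)]
      exact Set.ncard_image_le (Set.toFinite _)) (Set.toFinite _)
    have : ψ n ∈ (L w : Set ℕ) := by rw [heq]; exact ⟨n, hn, rfl⟩
    rw [hval, hit, K.eq_common hn.symm (hψL n (hnW n hn)) (Finset.mem_coe.1 this)]
  choose free hfree using hfree
  refine K.not_colorable ⟨fun v => if v ∈ W' then free v else ψ v, fun v => ?_, fun u v huv => ?_⟩
  · by_cases hv : v ∈ W'
    · simpa [hv] using (hfree v hv).1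
    · simpa [hv] using hψL v hv
  · by_cases hu : u ∈ W' <;> by_cases hv : v ∈ W'
    · exact absurd huv (hind u (hW'W u hu) v (hW'W v hv))
    · simpa [hu, hv] using ((hfree u hu).2 v huv).symm
    · simpa [hu, hv] using (hfree v hv).2 u huv.symm
    · simpa [hu, hv] using hψ u hu v hv huv

end Critical
end ChoosSep

namespace ChoosSep

open MvPolynomial Classical

/-- A biaffine function vanishing on three coordinate lines but not at a given point. -/
theorem exists_biaffine {x₁ x₂ x₃ y₁ y₂ y₃ z₁ z₂ z₃ : ℚ}
    (hx₁ : x₁ ∈ ({0, 1, 2} : Finset ℚ)) (hx₂ : x₂ ∈ ({0, 1, 2} : Finset ℚ))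
    (hx₃ : x₃ ∈ ({0, 1, 2} : Finset ℚ)) (hy₁ : y₁ ∈ ({0, 1, 2} : Finset ℚ))
    (hy₂ : y₂ ∈ ({0, 1, 2} : Finset ℚ)) (hy₃ : y₃ ∈ ({0, 1, 2} : Finset ℚ))
    (hz₁ : z₁ ∈ ({0, 1, 2} : Finset ℚ)) (hz₂ : z₂ ∈ ({0, 1, 2} : Finset ℚ))
    (hz₃ : z₃ ∈ ({0, 1, 2} : Finset ℚ)) (hx₃₁ : x₃ ≠ x₁) (hx₃₂ : x₃ ≠ x₂) (hy₃₁ : y₃ ≠ y₁)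
    (hy₃₂ : y₃ ≠ y₂) (hz₃₁ : z₃ ≠ z₁) (hz₃₂ : z₃ ≠ z₂)
    (h : (x₁ ≠ x₂ ∧ y₁ ≠ y₂ ∧ z₁ ≠ z₂) ∨ (x₁ = x₂ ∧ y₁ = y₂ ∧ z₁ = z₂)) :
    ∃ A B C D E F H : ℚ,
      (∀ z, A * (y₁ * z) + B * (x₁ * z) + C * (x₁ * y₁) + D * x₁ + E * y₁ + F * z + H = 0) ∧
      (∀ x, A * (y₂ * z₂) + B * (x * z₂) + C * (x * y₂) + D * x + E * y₂ + F * z₂ + H = 0) ∧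
      (∀ y, A * (y * z₁) + B * (x₂ * z₁) + C * (x₂ * y) + D * x₂ + E * y + F * z₁ + H = 0) ∧
      A * (y₃ * z₃) + B * (x₃ * z₃) + C * (x₃ * y₃) + D * x₃ + E * y₃ + F * z₃ + H ≠ 0 := by
  rcases h with ⟨hx, hy, hz⟩ | ⟨rfl, rfl, rfl⟩
  · have key : (x₃ - x₁) * (y₃ - y₂) * (z₃ - z₁) ≠ (x₃ - x₂) * (y₃ - y₁) * (z₃ - z₂) := by
      have ratio : ∀ {x₁ x₂ x₃ : ℚ}, x₁ ∈ ({0, 1, 2} : Finset ℚ) → x₂ ∈ ({0, 1, 2} : Finset ℚ) →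
          x₃ ∈ ({0, 1, 2} : Finset ℚ) → x₃ ≠ x₁ → x₃ ≠ x₂ → x₁ ≠ x₂ →
          x₃ - x₁ = 2 * (x₃ - x₂) ∨ x₃ - x₂ = 2 * (x₃ - x₁) ∨ x₃ - x₁ = -(x₃ - x₂) := by
        intro x₁ x₂ x₃ h1 h2 h3
        simp only [Finset.mem_insert, Finset.mem_singleton] at h1 h2 h3
        rcases h1 with rfl | rfl | rfl <;> rcases h2 with rfl | rfl | rfl <;>
          rcases h3 with rfl | rfl | rfl <;> norm_num
      have a0 := sub_ne_zero.2 hx₃₁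
      have b0 := sub_ne_zero.2 hx₃₂
      have c0 := sub_ne_zero.2 hy₃₁
      have d0 := sub_ne_zero.2 hy₃₂
      have e0 := sub_ne_zero.2 hz₃₁
      have f0 := sub_ne_zero.2 hz₃₂
      have r1 := ratio hx₁ hx₂ hx₃ hx₃₁ hx₃₂ hx
      have r2 := ratio hy₁ hy₂ hy₃ hy₃₁ hy₃₂ hy
      have r3 := ratio hz₁ hz₂ hz₃ hz₃₁ hz₃₂ hz
      generalize x₃ - x₁ = a at *
      generalize x₃ - x₂ = b at *
      generalize y₃ - y₁ = c at *
      generalize y₃ - y₂ = d at *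
      generalize z₃ - z₁ = e at *
      generalize z₃ - z₂ = g at *
      intro h
      have hbcg : b * c * g ≠ 0 := mul_ne_zero (mul_ne_zero b0 c0) f0
      have hade : a * d * e ≠ 0 := mul_ne_zero (mul_ne_zero a0 d0) e0
      have hbde : b * d * e ≠ 0 := mul_ne_zero (mul_ne_zero b0 d0) e0
      have hade' : a * d * g ≠ 0 := mul_ne_zero (mul_ne_zero a0 d0) f0
      have hadf : b * d * g ≠ 0 := mul_ne_zero (mul_ne_zero b0 d0) f0
      have hacg : a * c * g ≠ 0 := mul_ne_zero (mul_ne_zero a0 c0) f0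
      have hace : a * c * e ≠ 0 := mul_ne_zero (mul_ne_zero a0 c0) e0
      have hbce : b * c * e ≠ 0 := mul_ne_zero (mul_ne_zero b0 c0) e0
      rcases r1 with rfl | rfl | rfl <;> rcases r2 with rfl | rfl | rfl <;>
        rcases r3 with rfl | rfl | rfl <;> grind
    refine ⟨-x₁ + x₂, -y₂ + y₁, -z₁ + z₂, y₂ * z₁ - y₁ * z₂, x₁ * z₁ - x₂ * z₂,
      x₁ * y₂ - x₂ * y₁, -(x₁ * y₂ * z₁) + x₂ * y₁ * z₂, fun z => by ring, fun x => by ring,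
      fun y => by ring, fun h => key ?_⟩
    linear_combination h
  · refine ⟨0, 0, 1, -y₁, -x₁, 0, x₁ * y₁, fun z => by ring, fun x => by ring, fun y => by ring, ?_⟩
    have := mul_ne_zero (sub_ne_zero.2 hx₃₁) (sub_ne_zero.2 hy₃₁)
    intro h
    apply this
    linear_combination h

namespace Critical

variable {V : Type} {G : SimpleGraph V} {p : V} {L : V → Finset ℕ}

theorem three_le_ncard_image [Finite V] (K : Critical G p L) {b : V} (hb : b ≠ p) :
    3 ≤ (common L b '' G.neighborSet b).ncard := by
  by_contra! h
  obtain ⟨φ, hφL, hφ⟩ := K.exists_partial {b}ᶜ hb.symm (fun h => by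
    have : b ∈ ({b}ᶜ : Set V) := h ▸ Set.mem_univ b
    exact this rfl)
  have : ¬ (L b : Set ℕ) ⊆ common L b '' G.neighborSet b := by
    intro hsub
    have := Set.ncard_le_ncard hsub (Set.toFinite _)
    rw [Set.ncard_coe_finset, K.card_of_ne b hb] at this
    omega
  obtain ⟨c, hc, hcn⟩ := Set.not_subset.1 this
  have hnb : ∀ n, G.Adj b n → φ n ≠ c := by
    rintro n hn rfl
    exact hcn ⟨n, hn, (K.eq_common hn hc (hφL n hn.ne')).symm⟩
  refine K.not_colorable ⟨fun v => if v = b then c else φ v, fun v => ?_, fun u v huv => ?_⟩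
  · by_cases hv : v = b
    · subst hv; simpa using hc
    · simpa [hv] using hφL v hv
  · by_cases hu : u = b
    · subst hu
      simpa [huv.ne'] using (hnb v huv).symm
    · by_cases hv : v = b
      · subst hv
        simpa [hu] using hnb u huv.symm
      · simpa [hu, hv] using hφ u hu v hv huv

theorem common_ne [Finite V] (K : Critical G p L) {b u v : V} (hb : b ≠ p)
    (h3 : (G.neighborSet b).ncard = 3) (hu : G.Adj b u) (hv : G.Adj b v) (huv : u ≠ v) :
    common L b u ≠ common L b v := by
  intro h
  have hinj : Set.InjOn (common L b) (G.neighborSet b) :=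
    Set.injOn_of_ncard_image_eq (le_antisymm (Set.ncard_image_le (Set.toFinite _))
      (h3.trans_le (K.three_le_ncard_image hb))) (Set.toFinite _)
  exact huv (hinj hu hv h)

theorem hit_ne (K : Critical G p L) {f : V → ℕ → ℚ} (hf : Coord p L f) {u v w : V}
    (hv : G.Adj u v) (hw : G.Adj u w) (h : common L u v ≠ common L u w) :
    hit L f u v ≠ hit L f u w :=
  fun he => h (hf.inj u (K.common_mem hv) (K.common_mem hw) he)

/-- Two sides of a triangle with the same common color. -/
theorem common_eq_of_triangle (K : Critical G p L) {u v w : V} (huv : G.Adj u v) (huw : G.Adj u w)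
    (hvw : G.Adj v w) (h : common L u v = common L u w) : common L v u = common L v w := by
  refine K.eq_common hvw ?_ ?_
  · exact K.common_mem huv.symm
  · rw [common_comm, h, common_comm]
    exact K.common_mem huw.symm

/-- The common colors at a neighbor `u` of a vertex `w` of degree three, with `w` itself and
with a common neighbor, differ. -/
theorem common_ne_of_triangle [Finite V] (K : Critical G p L) {w u v : V} (hw : w ≠ p)
    (h3 : (G.neighborSet w).ncard = 3) (hu : G.Adj w u) (hv : G.Adj w v) (huv : G.Adj u v) :
    common L u w ≠ common L u v :=
  fun h => K.common_ne hw h3 hu hv huv.ne (K.common_eq_of_triangle hu.symm huv hv h)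

theorem hit_mem (K : Critical G p L) {f : V → ℕ → ℚ} (hf : Coord p L f) {u v : V}
    (hu : u ≠ p) (h : G.Adj u v) : hit L f u v ∈ ({0, 1, 2} : Finset ℚ) :=
  hf.mem u hu _ (K.common_mem h)

end Critical

section gadget

variable {V : Type} {L : V → Finset ℕ} {f : V → ℕ → ℚ} {S : Finset V} {base : V → ℚ}
  {tail : Sym2 V → V} {u v : V}

/-- The factor contributed by an edge. -/
noncomputable def edgeFactor (L : V → Finset ℕ) (f : V → ℕ → ℚ) (S : Finset V)
    (base : V → ℚ) (u v : V) : MvPolynomial V ℚ :=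
  if u ∈ S ∨ v ∈ S then edgePoly L f S base u v else 1

theorem mon_mk : mon S tail s(u, v) =
    if u ∈ S ∨ v ∈ S then Finsupp.single (tail s(u, v)) 1 else 0 := by
  unfold mon
  congr 1
  simp only [Sym2.mem_iff, eq_iff_iff]
  exact ⟨by rintro ⟨x, hx, rfl | rfl⟩ <;> simp [hx],
    by rintro (h | h); exacts [⟨u, h, by simp⟩, ⟨v, h, by simp⟩]⟩

theorem lead_edgeFactor (ht : u ∈ S ∨ v ∈ S → tail s(u, v) ∈ S ∧ tail s(u, v) ∈ s(u, v)) :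
    Lead (edgeFactor L f S base u v) (mon S tail s(u, v)) := by
  rw [edgeFactor, mon_mk]
  split_ifs with h
  · exact lead_linear one_pos one_pos (Sym2.mem_iff.1 (ht h).2) (ht h).1
  · exact lead_one

theorem eval_edgeFactor (s : V → ℚ) : eval s (edgeFactor L f S base u v) =
    if u ∈ S ∨ v ∈ S then (eval s (var S base u) - hit L f u v) +
      (eval s (var S base v) - hit L f v u) else 1 := by
  rw [edgeFactor]
  split_ifs
  · simp [edgePoly]
  · simp

end gadget

end ChoosSep

namespace ChoosSep

open MvPolynomial Classical

section gadget

variable {V : Type} {L : V → Finset ℕ} {f : V → ℕ → ℚ} {S : Finset V} {base : V → ℚ}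
  {tail : Sym2 V → V}

theorem totalDegree_C_mul_le {σ : Type*} (a : ℚ) (q : MvPolynomial σ ℚ) :
    (C a * q).totalDegree ≤ q.totalDegree :=
  (totalDegree_mul _ _).trans (by rw [totalDegree_C, zero_add])

theorem totalDegree_C_mul_var_mul_var_le (A : ℚ) (u v : V) :
    (C A * (var S base u * var S base v)).totalDegree ≤
      (if u ∈ S then 1 else 0) + (if v ∈ S then 1 else 0) :=
  (totalDegree_C_mul_le _ _).trans
    ((totalDegree_mul _ _).trans (add_le_add totalDegree_var_le totalDegree_var_le))

theorem totalDegree_C_mul_var_le (A : ℚ) (u : V) :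
    (C A * var S base u).totalDegree ≤ if u ∈ S then 1 else 0 :=
  (totalDegree_C_mul_le _ _).trans totalDegree_var_le

theorem exists_triangle_gadget {w a b c : V}
    (ht : ∀ u v, (s(u, v) = s(a, b) ∨ s(u, v) = s(b, c) ∨ s(u, v) = s(a, c)) → u ∈ S ∨ v ∈ S →
      tail s(u, v) ∈ S ∧ tail s(u, v) ∈ s(u, v))
    (hS : a ∈ S ∨ b ∈ S ∨ c ∈ S)
    (hq : ∃ A B C D E F H : ℚ,
      (∀ z, A * (hit L f b a * z) + B * (hit L f a b * z) + C * (hit L f a b * hit L f b a) +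
        D * hit L f a b + E * hit L f b a + F * z + H = 0) ∧
      (∀ x, A * (hit L f b c * hit L f c b) + B * (x * hit L f c b) + C * (x * hit L f b c) +
        D * x + E * hit L f b c + F * hit L f c b + H = 0) ∧
      (∀ y, A * (y * hit L f c a) + B * (hit L f a c * hit L f c a) + C * (hit L f a c * y) +
        D * hit L f a c + E * y + F * hit L f c a + H = 0) ∧
      A * (hit L f b w * hit L f c w) + B * (hit L f a w * hit L f c w) +
        C * (hit L f a w * hit L f b w) + D * hit L f a w + E * hit L f b w +
        F * hit L f c w + H ≠ 0) :
    ∃ Φ : MvPolynomial V ℚ, Lead Φ (mon S tail s(a, b) + mon S tail s(b, c) + mon S tail s(a, c)) ∧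
      ∀ s, eval s Φ ≠ 0 →
        (∀ u v, (s(u, v) = s(a, b) ∨ s(u, v) = s(b, c) ∨ s(u, v) = s(a, c)) → u ∈ S ∨ v ∈ S →
          ¬ (eval s (var S base u) = hit L f u v ∧ eval s (var S base v) = hit L f v u)) ∧
        ¬ (eval s (var S base a) = hit L f a w ∧ eval s (var S base b) = hit L f b w ∧
          eval s (var S base c) = hit L f c w) := by
  obtain ⟨A, B, C', D, E, F, H, h1, h2, h3, h4⟩ := hq
  let q : MvPolynomial V ℚ := C A * (var S base b * var S base c) +
    C B * (var S base a * var S base c) + C C' * (var S base a * var S base b) +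
    C D * var S base a + C E * var S base b + C F * var S base c + C H
  have hqe : ∀ s, eval s q = A * (eval s (var S base b) * eval s (var S base c)) +
    B * (eval s (var S base a) * eval s (var S base c)) +
    C' * (eval s (var S base a) * eval s (var S base b)) +
    D * eval s (var S base a) + E * eval s (var S base b) + F * eval s (var S base c) + H := by
    intro s
    simp [q]
  let pt : V → V → ℚ := fun u v => if u ∈ S ∨ v ∈ S then (hit L f u w - hit L f u v) +
      (hit L f v w - hit L f v u) else 1
  obtain ⟨l, hl⟩ : ∃ l : ℚ, pt a b * pt b c * pt a c + l * (A * (hit L f b w * hit L f c w) +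
      B * (hit L f a w * hit L f c w) + C' * (hit L f a w * hit L f b w) + D * hit L f a w +
      E * hit L f b w + F * hit L f c w + H) = 0 :=
    ⟨-(pt a b * pt b c * pt a c) / _, by rw [div_mul_cancel₀ _ h4, add_neg_cancel]⟩
  refine ⟨edgeFactor L f S base a b * edgeFactor L f S base b c * edgeFactor L f S base a c +
    C l * q, ?_, fun s hs => ⟨fun u v huv hS ⟨hu, hv⟩ => ?_, fun ⟨ha, hb, hc⟩ => ?_⟩⟩
  · refine Lead.add (((lead_edgeFactor (ht a b (by simp))).mul
      (lead_edgeFactor (ht b c (by simp)))).mul (lead_edgeFactor (ht a c (by simp)))) ?_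
    refine topNonneg_of_totalDegree_lt ((totalDegree_C_mul_le _ _).trans_lt ?_)
    have hdeg : ∀ u v : V, (mon S tail s(u, v)).degree = if u ∈ S ∨ v ∈ S then 1 else 0 := by
      intro u v
      rw [mon_mk]
      split_ifs <;> simp
    rw [map_add, map_add, hdeg, hdeg, hdeg]
    have e1 := totalDegree_C_mul_var_mul_var_le (S := S) (base := base) A b c
    have e2 := totalDegree_C_mul_var_mul_var_le (S := S) (base := base) B a c
    have e3 := totalDegree_C_mul_var_mul_var_le (S := S) (base := base) C' a b
    have e4 := totalDegree_C_mul_var_le (S := S) (base := base) D a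
    have e5 := totalDegree_C_mul_var_le (S := S) (base := base) E b
    have e6 := totalDegree_C_mul_var_le (S := S) (base := base) F c
    have e7 : (C H : MvPolynomial V ℚ).totalDegree ≤ 0 := (totalDegree_C _).le
    have key : ∀ n, (if b ∈ S then 1 else 0) + (if c ∈ S then 1 else 0) ≤ n →
        (if a ∈ S then 1 else 0) + (if c ∈ S then 1 else 0) ≤ n →
        (if a ∈ S then 1 else 0) + (if b ∈ S then 1 else 0) ≤ n → q.totalDegree ≤ n := by
      intro n i1 i2 i3
      refine (totalDegree_add _ _).trans (max_le ?_ (by omega))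
      refine (totalDegree_add _ _).trans (max_le ?_ (by omega))
      refine (totalDegree_add _ _).trans (max_le ?_ (by omega))
      refine (totalDegree_add _ _).trans (max_le ?_ (by omega))
      refine (totalDegree_add _ _).trans (max_le ?_ (by omega))
      exact (totalDegree_add _ _).trans (max_le (by omega) (by omega))
    by_cases ha : a ∈ S <;> by_cases hb : b ∈ S <;> by_cases hc : c ∈ S <;>
      simp only [ha, hb, hc, if_true, if_false, or_self, or_true, or_false] at key hS ⊢
    · exact (key 2 le_rfl le_rfl le_rfl).trans_lt (by norm_num)
    · exact (key 2 (by norm_num) (by norm_num) le_rfl).trans_lt (by norm_num)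
    · exact (key 2 (by norm_num) (by norm_num) (by norm_num)).trans_lt (by norm_num)
    · exact (key 1 (by norm_num) (by norm_num) (by norm_num)).trans_lt (by norm_num)
    · exact (key 2 (by norm_num) (by norm_num) (by norm_num)).trans_lt (by norm_num)
    · exact (key 1 (by norm_num) (by norm_num) (by norm_num)).trans_lt (by norm_num)
    · exact (key 1 (by norm_num) (by norm_num) (by norm_num)).trans_lt (by norm_num)
  · refine hs ?_
    rw [map_add, map_mul, map_mul, map_mul, hqe, eval_edgeFactor, eval_edgeFactor, eval_edgeFactor,
      eval_C]
    have key : ∀ {x y : V}, s(u, v) = s(x, y) → (x ∈ S ∨ y ∈ S) ∧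
        eval s (var S base x) = hit L f x y ∧ eval s (var S base y) = hit L f y x := by
      intro x y h
      rcases Sym2.eq_iff.1 h with ⟨rfl, rfl⟩ | ⟨rfl, rfl⟩
      · exact ⟨hS, hu, hv⟩
      · exact ⟨hS.symm, hv, hu⟩
    rcases huv with h | h | h <;> obtain ⟨k1, k2, k3⟩ := key h <;> rw [k2, k3, if_pos k1]
    · rw [h1]; ring
    · rw [h2]; ring
    · rw [h3]; ring
  · refine hs ?_
    rw [map_add, map_mul, map_mul, map_mul, hqe, eval_edgeFactor, eval_edgeFactor, eval_edgeFactor,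
      eval_C, ha, hb, hc]
    exact hl

theorem exists_path_gadget {w a b c : V}
    (ht : ∀ u v, (s(u, v) = s(a, b) ∨ s(u, v) = s(b, c)) → u ∈ S ∨ v ∈ S →
      tail s(u, v) ∈ S ∧ tail s(u, v) ∈ s(u, v))
    (hS : a ∈ S ∨ b ∈ S ∨ c ∈ S) (hbc : hit L f b w ≠ hit L f b c)
    (hsign : (hit L f a w - hit L f a b) * (hit L f b w - hit L f b a) < 0) :
    ∃ Φ : MvPolynomial V ℚ, Lead Φ (mon S tail s(a, b) + mon S tail s(b, c)) ∧
      ∀ s, eval s Φ ≠ 0 →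
        (∀ u v, (s(u, v) = s(a, b) ∨ s(u, v) = s(b, c)) → u ∈ S ∨ v ∈ S →
          ¬ (eval s (var S base u) = hit L f u v ∧ eval s (var S base v) = hit L f v u)) ∧
        ¬ (eval s (var S base a) = hit L f a w ∧ eval s (var S base b) = hit L f b w ∧
          eval s (var S base c) = hit L f c w) := by
  by_cases habS : a ∈ S ∨ b ∈ S
  · obtain ⟨ht1, ht2⟩ := ht a b (by simp) habS
    refine ⟨(C |hit L f b w - hit L f b a| * (var S base a - C (hit L f a b)) +
      C |hit L f a w - hit L f a b| * (var S base b - C (hit L f b a))) *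
      edgeFactor L f S base b c, ?_, fun s hs => ⟨fun u v huv hS' ⟨hu, hv⟩ => ?_,
        fun ⟨ha, hb, hc⟩ => ?_⟩⟩
    · refine Lead.mul ?_ (lead_edgeFactor (ht b c (by simp)))
      rw [mon_mk, if_pos habS]
      refine lead_linear (abs_pos.2 ?_) (abs_pos.2 ?_) (Sym2.mem_iff.1 ht2) ht1
      · intro h; rw [h, mul_zero] at hsign; exact lt_irrefl _ hsign
      · intro h; rw [h, zero_mul] at hsign; exact lt_irrefl _ hsign
    · refine hs ?_
      have key : ∀ {x y : V}, s(u, v) = s(x, y) → (x ∈ S ∨ y ∈ S) ∧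
          eval s (var S base x) = hit L f x y ∧ eval s (var S base y) = hit L f y x := by
        intro x y h
        rcases Sym2.eq_iff.1 h with ⟨rfl, rfl⟩ | ⟨rfl, rfl⟩
        · exact ⟨hS', hu, hv⟩
        · exact ⟨hS'.symm, hv, hu⟩
      rcases huv with h | h <;> obtain ⟨k1, k2, k3⟩ := key h
      · simp [k2, k3]
      · rw [map_mul, eval_edgeFactor, k2, k3, if_pos k1]
        ring
    · refine hs ?_
      rw [map_mul]
      refine mul_eq_zero_of_left ?_ _
      simp only [map_add, map_mul, map_sub, eval_C, ha, hb]
      rcases mul_neg_iff.1 hsign with ⟨h1, h2⟩ | ⟨h1, h2⟩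
      · rw [abs_of_neg h2, abs_of_pos h1]; ring
      · rw [abs_of_pos h2, abs_of_neg h1]; ring
  · have haS : a ∉ S := fun h => habS (Or.inl h)
    have hbS : b ∉ S := fun h => habS (Or.inr h)
    have hcS : c ∈ S := by tauto
    obtain ⟨ht1, ht2⟩ := ht b c (by simp) (Or.inr hcS)
    have htc : tail s(b, c) = c := by
      rcases Sym2.mem_iff.1 ht2 with h | h
      · rw [h] at ht1; exact absurd ht1 hbS
      · exact h
    refine ⟨var S base c + C (-if base b = hit L f b w then hit L f c w else hit L f c b), ?_,
      fun s hs => ?_⟩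
    · rw [mon_mk, mon_mk, if_neg habS, if_pos (Or.inr hcS), zero_add, htc]
      refine (lead_var hcS).add (topNonneg_of_totalDegree_lt ?_)
      rw [totalDegree_C]; simp
    · have hb : eval s (var S base b) = base b := by simp [var, hbS]
      rw [map_add, eval_C, ← sub_eq_add_neg, sub_ne_zero] at hs
      rw [hb]
      refine ⟨fun u v huv hS' huv' => ?_, fun ⟨_, h2, h3⟩ => ?_⟩
      · rcases huv with h | h
        · rcases Sym2.eq_iff.1 h with ⟨rfl, rfl⟩ | ⟨rfl, rfl⟩ <;> tauto
        · have : base b = hit L f b c ∧ eval s (var S base c) = hit L f c b := by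
            rcases Sym2.eq_iff.1 h with ⟨rfl, rfl⟩ | ⟨rfl, rfl⟩
            · rw [← hb]; exact huv'
            · rw [← hb]; exact huv'.symm
          rw [if_neg (by rw [this.1]; exact hbc.symm)] at hs
          exact hs this.2
      · rw [if_pos h2] at hs
        exact hs h3

end gadget

end ChoosSep

namespace ChoosSep

open MvPolynomial Classical

/-- The vertex `w` has exactly three neighbors, forming a path `a`, `b`, `c` or a triangle. -/
structure Spread {V : Type} (G : SimpleGraph V) (w a b c : V) : Prop where
  nbr : G.neighborSet w = {a, b, c}
  ne : a ≠ c
  adj₁ : G.Adj a b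
  adj₂ : G.Adj b c

namespace Spread

variable {V : Type} {G : SimpleGraph V} {w a b c : V}

theorem adj_iff (h : Spread G w a b c) (x : V) : G.Adj w x ↔ x = a ∨ x = b ∨ x = c := by
  rw [← SimpleGraph.mem_neighborSet, h.nbr]
  rfl

theorem adj_a (h : Spread G w a b c) : G.Adj w a := (h.adj_iff a).2 (by simp)
theorem adj_b (h : Spread G w a b c) : G.Adj w b := (h.adj_iff b).2 (by simp)
theorem adj_c (h : Spread G w a b c) : G.Adj w c := (h.adj_iff c).2 (by simp)

theorem ncard (h : Spread G w a b c) : (G.neighborSet w).ncard = 3 := by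
  rw [h.nbr, Set.ncard_eq_three]
  exact ⟨a, b, c, h.adj₁.ne, h.ne, h.adj₂.ne, rfl⟩

/-- Every edge in the neighborhood of `w` has an end adjacent to a third neighbor of `w`. -/
theorem exists_third (h : Spread G w a b c) {u v : V} (huv : G.Adj u v) (hu : G.Adj w u)
    (hv : G.Adj w v) : ∃ y, G.Adj w y ∧ y ≠ u ∧ y ≠ v ∧ (G.Adj y u ∨ G.Adj y v) := by
  have h1 := h.adj₁.ne
  have h2 := h.adj₂.ne
  have h3 := h.ne
  rcases (h.adj_iff u).1 hu with rfl | rfl | rfl <;> rcases (h.adj_iff v).1 hv with rfl | rfl | rfl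
  · exact absurd huv (SimpleGraph.irrefl G)
  · exact ⟨c, h.adj_c, h3.symm, h2.symm, Or.inr h.adj₂.symm⟩
  · exact ⟨b, h.adj_b, h1.symm, h2, Or.inl h.adj₁.symm⟩
  · exact ⟨c, h.adj_c, h2.symm, h3.symm, Or.inl h.adj₂.symm⟩
  · exact absurd huv (SimpleGraph.irrefl G)
  · exact ⟨a, h.adj_a, h1, h3, Or.inl h.adj₁⟩
  · exact ⟨b, h.adj_b, h2, h1.symm, Or.inl h.adj₂⟩
  · exact ⟨a, h.adj_a, h3, h1, Or.inr h.adj₁⟩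
  · exact absurd huv (SimpleGraph.irrefl G)

end Spread

/-- A vertex that can be eliminated by a gadget polynomial. -/
def Good {V : Type} (G : SimpleGraph V) (L : V → Finset ℕ) (f : V → ℕ → ℚ) (w : V) : Prop :=
  ∃ a b c, Spread G w a b c ∧ (G.Adj a c ∨ (¬ G.Adj a c ∧
    (hit L f a w - hit L f a b) * (hit L f b w - hit L f b a) < 0))

/-- A critical list assignment on a graph without short cycles. -/
structure SparseCritical {V : Type} (G : SimpleGraph V) (p : V) (L : V → Finset ℕ) : Prop
    extends Critical G p L where
  no5 : ¬ HasCycleLen G 5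
  not_triangle : ∀ ⦃u w⦄, G.Adj p u → G.Adj p w → ¬ G.Adj u w

namespace SparseCritical

variable {V : Type} {G : SimpleGraph V} {p : V} {L : V → Finset ℕ}

theorem ne_of_triangle (K : SparseCritical G p L) {u v w : V} (h1 : G.Adj w u) (h2 : G.Adj w v)
    (h3 : G.Adj u v) : w ≠ p := by
  rintro rfl
  exact K.not_triangle h1 h2 h3

/-- No edge lies in the neighborhoods of two distinct nonadjacent spread vertices. -/
theorem not_adj_both (K : SparseCritical G p L) {w w' a b c u v : V} (h : Spread G w a b c)
    (hww : w ≠ w') (hn : ¬ G.Adj w w') (huv : G.Adj u v) (hu : G.Adj w u) (hv : G.Adj w v)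
    (hu' : G.Adj w' u) (hv' : G.Adj w' v) : False := by
  obtain ⟨y, hy, hyu, hyv, h | h⟩ := h.exists_third huv hu hv
  · exact K.no5 (hasCycleLen_five hy h hu'.symm hv' hv.symm hu.ne hww (fun h => hn (h ▸ hy)) hyv
      huv.ne)
  · exact K.no5 (hasCycleLen_five hy h hv'.symm hu' hu.symm hv.ne hww (fun h => hn (h ▸ hy)) hyu
      huv.ne')

theorem false_of_tail [Fintype V] (K : SparseCritical G p L) {f : V → ℕ → ℚ} (hf : Coord p L f)
    {W S : Finset V} (hpW : p ∉ W) (hpS : p ∉ S) (hWS : Disjoint W S) (hS : S.Nonempty)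
    (hind : ∀ u ∈ W, ∀ v ∈ W, ¬ G.Adj u v) (hgood : ∀ w ∈ W, Good G L f w)
    {tail : Sym2 V → V}
    (htail : ∀ e ∈ G.edgeSet, (∀ w ∈ W, w ∉ e) → (∃ v ∈ S, v ∈ e) → tail e ∈ S ∧ tail e ∈ e)
    (hcount : ∀ v, {e : Sym2 V | (e ∈ G.edgeSet ∧ ∀ w ∈ W, w ∉ e) ∧
      (∃ w ∈ S, w ∈ e) ∧ tail e = v}.ncard ≤ 2) : False := by
  have hTmem : ∀ w u v, s(u, v) ∈ ({e | e ∈ G.edgeSet ∧ ∀ x ∈ e, G.Adj w x} : Finset (Sym2 V)) ↔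
      G.Adj u v ∧ G.Adj w u ∧ G.Adj w v := by
    intro w u v
    simp
  refine K.false_of_gadgets hf hpW hpS hWS hS hind (fun w hw => ?_) htail hcount
    (fun w => {e | e ∈ G.edgeSet ∧ ∀ x ∈ e, G.Adj w x}) ?_ ?_ ?_
  · obtain ⟨a, b, c, h, -⟩ := hgood w hw
    exact h.ncard
  · intro w hw e he
    rw [Finset.mem_filter] at he
    exact ⟨he.2.1, fun w' hw' hwe => hind w hw w' hw' (he.2.2 w' hwe)⟩
  · intro w hw w' hw' hne
    rw [Finset.disjoint_left]
    intro e he he'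
    obtain ⟨a, b, c, h, -⟩ := hgood w hw
    induction e with
    | h u v =>
      rw [hTmem] at he he'
      exact K.not_adj_both h hne (hind w hw w' hw') he.1 he.2.1 he.2.2 he'.2.1 he'.2.2
  · intro base w hw ⟨n, hnS, hn⟩
    have hwp : w ≠ p := fun h => hpW (h ▸ hw)
    obtain ⟨a, b, c, h, hor⟩ := hgood w hw
    have ha := h.adj_a
    have hb := h.adj_b
    have hc := h.adj_c
    have hab := h.adj₁
    have hbc := h.adj₂
    have hd := h.ncard
    have htouch : a ∈ S ∨ b ∈ S ∨ c ∈ S := by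
      rcases (h.adj_iff n).1 hn with rfl | rfl | rfl <;> simp [hnS]
    have hnW : ∀ x, G.Adj w x → x ∉ W := fun x hx hxW => hind w hw x hxW hx
    have ht : ∀ u v, G.Adj u v → G.Adj w u → G.Adj w v → u ∈ S ∨ v ∈ S →
        tail s(u, v) ∈ S ∧ tail s(u, v) ∈ s(u, v) := by
      intro u v huv hu hv hS
      refine htail _ huv (fun x hx hxe => ?_) ?_
      · rcases Sym2.mem_iff.1 hxe with rfl | rfl
        · exact hnW _ hu hx
        · exact hnW _ hv hx
      · rcases hS with hS | hS
        · exact ⟨u, hS, by simp⟩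
        · exact ⟨v, hS, by simp⟩
    have hap : a ≠ p := K.ne_of_triangle ha.symm hab hb
    have hbp : b ≠ p := K.ne_of_triangle hb.symm hab.symm ha
    have hcp : c ≠ p := K.ne_of_triangle hc.symm hbc.symm hb
    have hne1 : s(a, b) ≠ s(b, c) := fun he => by
      rcases Sym2.eq_iff.1 he with ⟨h1, h2⟩ | ⟨h1, h2⟩
      · exact hab.ne h1
      · exact h.ne h1
    rcases hor with hac | ⟨hac, hsign⟩
    · have hne2 : s(a, b) ≠ s(a, c) := fun he => by
        rcases Sym2.eq_iff.1 he with ⟨h1, h2⟩ | ⟨h1, h2⟩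
        · exact hbc.ne h2
        · exact h.ne h1
      have hne3 : s(b, c) ≠ s(a, c) := fun he => by
        rcases Sym2.eq_iff.1 he with ⟨h1, h2⟩ | ⟨h1, h2⟩
        · exact hab.ne h1.symm
        · exact hbc.ne h1
      have hT : ({e | e ∈ G.edgeSet ∧ ∀ x ∈ e, G.Adj w x} : Finset (Sym2 V)) =
          {s(a, b), s(b, c), s(a, c)} := by
        ext e
        induction e with
        | h u v =>
          rw [hTmem]
          simp only [Finset.mem_insert, Finset.mem_singleton]
          constructor
          · rintro ⟨huv, hu, hv⟩
            rcases (h.adj_iff u).1 hu with rfl | rfl | rfl <;>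
              rcases (h.adj_iff v).1 hv with rfl | rfl | rfl <;>
              simp <;> exact absurd huv (SimpleGraph.irrefl G)
          · rintro (he | he | he) <;> rcases Sym2.eq_iff.1 he with ⟨rfl, rfl⟩ | ⟨rfl, rfl⟩
            exacts [⟨hab, ha, hb⟩, ⟨hab.symm, hb, ha⟩, ⟨hbc, hb, hc⟩, ⟨hbc.symm, hc, hb⟩,
              ⟨hac, ha, hc⟩, ⟨hac.symm, hc, ha⟩]
      have hq := exists_biaffine (K.hit_mem hf hap hab) (K.hit_mem hf hap hac)
        (K.hit_mem hf hap ha.symm) (K.hit_mem hf hbp hab.symm) (K.hit_mem hf hbp hbc)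
        (K.hit_mem hf hbp hb.symm) (K.hit_mem hf hcp hac.symm) (K.hit_mem hf hcp hbc.symm)
        (K.hit_mem hf hcp hc.symm)
        (K.hit_ne hf ha.symm hab (K.common_ne_of_triangle hwp hd ha hb hab))
        (K.hit_ne hf ha.symm hac (K.common_ne_of_triangle hwp hd ha hc hac))
        (K.hit_ne hf hb.symm hab.symm (K.common_ne_of_triangle hwp hd hb ha hab.symm))
        (K.hit_ne hf hb.symm hbc (K.common_ne_of_triangle hwp hd hb hc hbc))
        (K.hit_ne hf hc.symm hac.symm (K.common_ne_of_triangle hwp hd hc ha hac.symm))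
        (K.hit_ne hf hc.symm hbc.symm (K.common_ne_of_triangle hwp hd hc hb hbc.symm)) (by
          by_cases hm : common L a b = common L a c
          · have h1 := K.common_eq_of_triangle hab hac hbc hm
            have h2 := K.common_eq_of_triangle hac hab hbc.symm hm.symm
            exact Or.inr ⟨by rw [hit, hm, hit], by rw [hit, h1, hit], by rw [hit, h2, hit]⟩
          · refine Or.inl ⟨K.hit_ne hf hab hac hm, K.hit_ne hf hab.symm hbc fun h1 => hm ?_,
              K.hit_ne hf hac.symm hbc.symm fun h1 => hm ?_⟩
            · exact K.common_eq_of_triangle hab.symm hbc hac h1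
            · exact (K.common_eq_of_triangle hac.symm hbc.symm hab h1).symm)
      have hmem : ∀ u v, (s(u, v) = s(a, b) ∨ s(u, v) = s(b, c) ∨ s(u, v) = s(a, c)) ↔
          G.Adj u v ∧ G.Adj w u ∧ G.Adj w v := by
        intro u v
        rw [← hTmem, hT]
        simp
      obtain ⟨Φ, hΦ, hΦ'⟩ := exists_triangle_gadget (S := S) (base := base) (tail := tail) (w := w)
        (fun u v he => ht u v ((hmem u v).1 he).1 ((hmem u v).1 he).2.1 ((hmem u v).1 he).2.2)
        htouch hq
      refine ⟨Φ, ?_, fun s hs => ⟨fun u v he => (hΦ' s hs).1 u v ?_, fun hall =>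
        (hΦ' s hs).2 ⟨hall a ha, hall b hb, hall c hc⟩⟩⟩
      · rw [hT, Finset.sum_insert (by simp [hne1, hne2]), Finset.sum_insert (by simpa using hne3),
          Finset.sum_singleton, ← add_assoc]
        exact hΦ
      · rw [hTmem] at he
        exact (hmem u v).2 he
    · have hT : ({e | e ∈ G.edgeSet ∧ ∀ x ∈ e, G.Adj w x} : Finset (Sym2 V)) =
          {s(a, b), s(b, c)} := by
        ext e
        induction e with
        | h u v =>
          rw [hTmem]
          simp only [Finset.mem_insert, Finset.mem_singleton]
          constructor
          · rintro ⟨huv, hu, hv⟩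
            rcases (h.adj_iff u).1 hu with rfl | rfl | rfl <;>
              rcases (h.adj_iff v).1 hv with rfl | rfl | rfl <;>
              simp <;>
              first | exact absurd huv (SimpleGraph.irrefl G) | exact absurd huv hac |
                exact absurd huv.symm hac
          · rintro (he | he) <;> rcases Sym2.eq_iff.1 he with ⟨rfl, rfl⟩ | ⟨rfl, rfl⟩
            exacts [⟨hab, ha, hb⟩, ⟨hab.symm, hb, ha⟩, ⟨hbc, hb, hc⟩, ⟨hbc.symm, hc, hb⟩]
      have hmem : ∀ u v, (s(u, v) = s(a, b) ∨ s(u, v) = s(b, c)) ↔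
          G.Adj u v ∧ G.Adj w u ∧ G.Adj w v := by
        intro u v
        rw [← hTmem, hT]
        simp
      obtain ⟨Φ, hΦ, hΦ'⟩ := exists_path_gadget (S := S) (base := base) (tail := tail) (w := w)
        (fun u v he => ht u v ((hmem u v).1 he).1 ((hmem u v).1 he).2.1 ((hmem u v).1 he).2.2)
        htouch (K.hit_ne hf hb.symm hbc (K.common_ne_of_triangle hwp hd hb hc hbc)) hsign
      refine ⟨Φ, ?_, fun s hs => ⟨fun u v he => (hΦ' s hs).1 u v ?_, fun hall =>
        (hΦ' s hs).2 ⟨hall a ha, hall b hb, hall c hc⟩⟩⟩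
      · rw [hT, Finset.sum_insert (by simpa using hne1), Finset.sum_singleton]
        exact hΦ
      · rw [hTmem] at he
        exact (hmem u v).2 he

end SparseCritical

end ChoosSep

namespace ChoosSep

open Classical

section coord

variable {V : Type} {p : V} {L : V → Finset ℕ}

theorem coord_rank (hL : ∀ v, v ≠ p → (L v).card = 3) :
    Coord p L fun v c => ({x ∈ L v | x < c}.card : ℚ) := by
  have hlt : ∀ v, ∀ c ∈ L v, {x ∈ L v | x < c}.card < (L v).card := fun v c hc =>
    Finset.card_lt_card ⟨Finset.filter_subset _ _, fun h => by
      simpa using (Finset.mem_filter.1 (h hc)).2⟩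
  have hmono : ∀ v, ∀ c ∈ L v, ∀ d ∈ L v, c < d →
      {x ∈ L v | x < c}.card < {x ∈ L v | x < d}.card := fun v c hc d hd hcd =>
    Finset.card_lt_card ⟨fun x hx => by
      rw [Finset.mem_filter] at hx ⊢
      exact ⟨hx.1, hx.2.trans hcd⟩, fun h => by
      simpa using (Finset.mem_filter.1 (h (Finset.mem_filter.2 ⟨hc, hcd⟩))).2⟩
  have hinj : ∀ v, Set.InjOn (fun c => {x ∈ L v | x < c}.card) (L v) := by
    intro v c hc d hd h
    rcases lt_trichotomy c d with hcd | hcd | hcd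
    · exact absurd h (hmono v c hc d hd hcd).ne
    · exact hcd
    · exact absurd h (hmono v d hd c hc hcd).ne'
  refine ⟨fun v c hc d hd h => hinj v hc hd (by exact_mod_cast h), fun v hv c hc => ?_,
    fun v hv x hx => ?_⟩
  · have := hlt v c hc
    rw [hL v hv] at this
    generalize {x ∈ L v | x < c}.card = n at *
    interval_cases n <;> simp
  · have hsurj := Finset.surj_on_of_inj_on_of_card_le
      (s := L v) (t := Finset.range 3) (fun c _ => {x ∈ L v | x < c}.card)
      (fun c hc => Finset.mem_range.2 (hL v hv ▸ hlt v c hc))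
      (fun c d hc hd h => hinj v hc hd h) (by simp [hL v hv])
    simp only [Finset.mem_insert, Finset.mem_singleton] at hx
    rcases hx with rfl | rfl | rfl
    · obtain ⟨c, hc, h⟩ := hsurj 0 (by simp)
      exact ⟨c, hc, by exact_mod_cast h.symm⟩
    · obtain ⟨c, hc, h⟩ := hsurj 1 (by simp)
      exact ⟨c, hc, by exact_mod_cast h.symm⟩
    · obtain ⟨c, hc, h⟩ := hsurj 2 (by simp)
      exact ⟨c, hc, by exact_mod_cast h.symm⟩

theorem Coord.flip {f : V → ℕ → ℚ} (hf : Coord p L f) (ε : V → Bool) :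
    Coord p L fun v c => if ε v then 2 - f v c else f v c := by
  refine ⟨fun v c hc d hd h => hf.inj v hc hd ?_, fun v hv c hc => ?_, fun v hv x hx => ?_⟩
  · cases hε : ε v
    · simpa [hε] using h
    · simpa [hε] using h
  · have := hf.mem v hv c hc
    simp only [Finset.mem_insert, Finset.mem_singleton] at this ⊢
    split_ifs
    · rcases this with h | h | h <;> rw [h] <;> norm_num
    · exact this
  · cases hε : ε v
    · simpa [hε] using hf.surj v hv x hx
    · obtain ⟨c, hc, h⟩ := hf.surj v hv (2 - x) (by
        simp only [Finset.mem_insert, Finset.mem_singleton] at hx ⊢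
        rcases hx with h | h | h <;> rw [h] <;> norm_num)
      exact ⟨c, hc, by simp [h]⟩

end coord

namespace SparseCritical

variable {V : Type} {G : SimpleGraph V} {p : V} {L : V → Finset ℕ}

theorem ne_of_spread (K : SparseCritical G p L) {w a b c : V} (h : Spread G w a b c) : w ≠ p :=
  K.ne_of_triangle h.adj_a h.adj_b h.adj₁

theorem not_adj_of_spread (K : SparseCritical G p L) {w a b c : V} (h : Spread G w a b c) :
    ¬ G.Adj w p := by
  intro hp
  rcases (h.adj_iff p).1 hp with rfl | rfl | rfl
  · exact K.not_triangle h.adj_a.symm h.adj₁ h.adj_b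
  · exact K.not_triangle h.adj_b.symm h.adj₁.symm h.adj_a
  · exact K.not_triangle h.adj_c.symm h.adj₂.symm h.adj_b

/-- Coordinates can be chosen such that at least half of the given spread vertices satisfy the
sign condition. -/
theorem exists_coord [Fintype V] (K : SparseCritical G p L) (B : Finset V) (a b c : V → V)
    (h : ∀ w ∈ B, Spread G w (a w) (b w) (c w)) : ∃ f, Coord p L f ∧
      B.card ≤ 2 * {w ∈ B | (hit L f (a w) w - hit L f (a w) (b w)) *
        (hit L f (b w) w - hit L f (b w) (a w)) < 0}.card := by
  have hf := coord_rank K.card_of_ne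
  set f : V → ℕ → ℚ := fun v c => ({x ∈ L v | x < c}.card : ℚ)
  obtain ⟨ε, hε⟩ := exists_signs a b (fun w => decide (0 <
    (hit L f (a w) w - hit L f (a w) (b w)) * (hit L f (b w) w - hit L f (b w) (a w)))) B
    fun w hw => (h w hw).adj₁.ne
  refine ⟨_, hf.flip ε, hε.trans (Nat.mul_le_mul_left 2 (Finset.card_le_card fun w hw => ?_))⟩
  obtain ⟨hwB, hw⟩ := Finset.mem_filter.1 hw
  refine Finset.mem_filter.2 ⟨hwB, ?_⟩
  have hs := h w hwB
  have hwp := K.ne_of_spread hs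
  have h1 := sub_ne_zero.2 (K.hit_ne hf hs.adj_a.symm hs.adj₁
    (K.common_ne_of_triangle hwp hs.ncard hs.adj_a hs.adj_b hs.adj₁))
  have h2 := sub_ne_zero.2 (K.hit_ne hf hs.adj_b.symm hs.adj₁.symm
    (K.common_ne_of_triangle hwp hs.ncard hs.adj_b hs.adj_a hs.adj₁.symm))
  have h3 := mul_ne_zero h1 h2
  have hflip : ∀ u v, hit L (fun v c => if ε v then 2 - f v c else f v c) u v =
      if ε u then 2 - hit L f u v else hit L f u v := fun u v => rfl
  rw [hflip, hflip, hflip, hflip]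
  replace hw := hw.symm
  cases ha : ε (a w) <;> cases hb : ε (b w) <;> rw [ha, hb] at hw <;>
    simp only [Bool.xor_false, Bool.xor_true, Bool.not_true, Bool.not_false, decide_eq_true_eq,
      decide_eq_false_iff_not, if_true, Bool.false_eq_true, if_false] at hw ⊢
  · exact lt_of_le_of_ne (not_lt.1 hw) h3
  · nlinarith
  · nlinarith
  · have := lt_of_le_of_ne (not_lt.1 hw) h3
    nlinarith

/-- A vertex outside an eliminable set `W` has at least three neighbors outside `W`. -/
theorem three_le_ncard_compl [Fintype V] (K : SparseCritical G p L) {f : V → ℕ → ℚ}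
    (hf : Coord p L f) {W : Finset V} (hind : ∀ u ∈ W, ∀ v ∈ W, ¬ G.Adj u v)
    (hgood : ∀ w ∈ W, Good G L f w) {u : V} (hup : u ≠ p) (huW : u ∉ W) :
    3 ≤ {x | G.Adj u x ∧ x ∉ W}.ncard := by
  by_contra! hlt
  refine K.false_of_tail hf (W := W) (S := {u}) (tail := fun _ => u) (fun h => ?_)
    (by simpa using hup.symm) (by simpa using huW) (Finset.singleton_nonempty u) hind hgood ?_ ?_
  · obtain ⟨a, b, c, h, -⟩ := hgood p h
    exact K.ne_of_spread h rfl
  · rintro e - - ⟨v, hv, hve⟩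
    rw [Finset.mem_singleton] at hv
    subst hv
    exact ⟨Finset.mem_singleton_self _, hve⟩
  · intro v
    refine (Set.ncard_le_ncard (t := (fun x => s(u, x)) '' {x | G.Adj u x ∧ x ∉ W}) ?_
      (Set.toFinite _)).trans ((Set.ncard_image_le (Set.toFinite _)).trans (by omega))
    rintro e ⟨⟨he, heW⟩, ⟨w, hw, hwe⟩, -⟩
    rw [Finset.mem_singleton] at hw
    subst hw
    obtain ⟨x, rfl⟩ := Sym2.mem_iff_exists.1 hwe
    exact ⟨x, ⟨he, fun hx => heW x hx (by simp)⟩, rfl⟩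

theorem four_le_deg [Fintype V] (K : SparseCritical G p L) {w a b c u : V}
    (h : Spread G w a b c) (hu : G.Adj w u) : 4 ≤ (G.neighborSet u).ncard := by
  obtain ⟨f, hf, hcard⟩ := K.exists_coord {w} (fun _ => a) (fun _ => b) (fun _ => c)
    (fun x hx => by rw [Finset.mem_singleton.1 hx]; exact h)
  have hgood : Good G L f w := by
    refine ⟨a, b, c, h, or_iff_not_imp_left.2 fun hac => ⟨hac, ?_⟩⟩
    rw [Finset.card_singleton] at hcard
    obtain ⟨x, hx⟩ := Finset.card_pos.1 (Nat.pos_of_ne_zero fun h0 => by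
      rw [h0] at hcard
      exact absurd hcard (by norm_num))
    rw [Finset.mem_filter, Finset.mem_singleton] at hx
    rw [← hx.1]
    have := hx.2
    rwa [hx.1] at this ⊢
  have h3 := K.three_le_ncard_compl hf (W := {w}) (u := u) (by simp)
    (by simpa using hgood) (fun h' => K.not_adj_of_spread h (h' ▸ hu)) (by simpa using hu.ne')
  have hsub : {x | G.Adj u x ∧ x ∉ ({w} : Finset V)} ⊂ G.neighborSet u :=
    ⟨fun x hx => hx.1, fun hsub => (hsub (show w ∈ G.neighborSet u from hu.symm)).2 (by simp)⟩
  have := Set.ncard_lt_ncard hsub (Set.toFinite _)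
  omega

theorem not_adj_spread [Fintype V] (K : SparseCritical G p L) {w a b c w' a' b' c' : V}
    (h : Spread G w a b c) (h' : Spread G w' a' b' c') : ¬ G.Adj w w' := by
  intro hww
  have := K.four_le_deg h hww
  rw [h'.ncard] at this
  omega

end SparseCritical

/-- The vertices of degree three all of whose neighbors are adjacent. -/
noncomputable def fullVerts {V : Type} [Fintype V] (G : SimpleGraph V) : Finset V :=
  {w | ∃ a b c, Spread G w a b c ∧ G.Adj a c}

/-- The vertices of degree three whose neighborhood induces a path. -/
noncomputable def pathVerts {V : Type} [Fintype V] (G : SimpleGraph V) : Finset V :=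
  {w | ∃ a b c, Spread G w a b c ∧ ¬ G.Adj a c}

theorem mem_fullVerts {V : Type} [Fintype V] {G : SimpleGraph V} {w : V} :
    w ∈ fullVerts G ↔ ∃ a b c, Spread G w a b c ∧ G.Adj a c := by simp [fullVerts]

theorem mem_pathVerts {V : Type} [Fintype V] {G : SimpleGraph V} {w : V} :
    w ∈ pathVerts G ↔ ∃ a b c, Spread G w a b c ∧ ¬ G.Adj a c := by simp [pathVerts]

theorem adj_of_mem_fullVerts {V : Type} [Fintype V] {G : SimpleGraph V} {w x y : V}
    (h : w ∈ fullVerts G) (hx : G.Adj w x) (hy : G.Adj w y) (hxy : x ≠ y) : G.Adj x y := by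
  obtain ⟨a, b, c, h, hac⟩ := mem_fullVerts.1 h
  have h1 := h.adj₁
  have h2 := h.adj₂
  rcases (h.adj_iff x).1 hx with rfl | rfl | rfl <;> rcases (h.adj_iff y).1 hy with rfl | rfl | rfl
  exacts [absurd rfl hxy, h1, hac, h1.symm, absurd rfl hxy, h2, hac.symm, h2.symm, absurd rfl hxy]

namespace SparseCritical

variable {V : Type} [Fintype V] {G : SimpleGraph V} {p : V} {L : V → Finset ℕ}

theorem three_le_ncard_compl_fullVerts (K : SparseCritical G p L) {u : V} (hup : u ≠ p)
    (hu : u ∉ fullVerts G) : 3 ≤ {x | G.Adj u x ∧ x ∉ fullVerts G}.ncard := by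
  refine K.three_le_ncard_compl (coord_rank K.card_of_ne) (fun w hw w' hw' => ?_)
    (fun w hw => ?_) hup hu
  · obtain ⟨a, b, c, h, -⟩ := mem_fullVerts.1 hw
    obtain ⟨a', b', c', h', -⟩ := mem_fullVerts.1 hw'
    exact K.not_adj_spread h h'
  · obtain ⟨a, b, c, h, hac⟩ := mem_fullVerts.1 hw
    exact ⟨a, b, c, h, Or.inl hac⟩

/-- The density of a critical graph without its full vertices. -/
theorem density (K : SparseCritical G p L) {q : V} (hq : G.Adj p q) :
    4 * Fintype.card V + (pathVerts G).card ≤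
      2 * {e : Sym2 V | e ∈ G.edgeSet ∧ ∀ w ∈ fullVerts G, w ∉ e}.ncard + 2 +
        4 * (fullVerts G).card := by
  have hch : ∀ w, ∃ t : V × V × V, w ∈ pathVerts G → Spread G w t.1 t.2.1 t.2.2 ∧
      ¬ G.Adj t.1 t.2.2 := by
    intro w
    by_cases hw : w ∈ pathVerts G
    · obtain ⟨a, b, c, h⟩ := mem_pathVerts.1 hw
      exact ⟨(a, b, c), fun _ => h⟩
    · exact ⟨(w, w, w), fun h => absurd h hw⟩
  choose t ht using hch
  obtain ⟨f, hf, hcard⟩ := K.exists_coord (pathVerts G) (fun w => (t w).1) (fun w => (t w).2.1)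
    (fun w => (t w).2.2) fun w hw => (ht w hw).1
  set X := {w ∈ pathVerts G | (hit L f (t w).1 w - hit L f (t w).1 (t w).2.1) *
    (hit L f (t w).2.1 w - hit L f (t w).2.1 (t w).1) < 0} with hX
  have hgood : ∀ w ∈ fullVerts G ∪ X, Good G L f w := by
    intro w hw
    rcases Finset.mem_union.1 hw with hw | hw
    · obtain ⟨a, b, c, h, hac⟩ := mem_fullVerts.1 hw
      exact ⟨a, b, c, h, Or.inl hac⟩
    · obtain ⟨hw, hs⟩ := Finset.mem_filter.1 hw
      exact ⟨_, _, _, (ht w hw).1, Or.inr ⟨(ht w hw).2, hs⟩⟩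
  have hind : ∀ u ∈ fullVerts G ∪ X, ∀ v ∈ fullVerts G ∪ X, ¬ G.Adj u v := by
    intro u hu v hv
    obtain ⟨_, _, _, h, -⟩ := hgood u hu
    obtain ⟨_, _, _, h', -⟩ := hgood v hv
    exact K.not_adj_spread h h'
  have hpW : p ∉ fullVerts G ∪ X := fun h => by
    obtain ⟨_, _, _, h, -⟩ := hgood p h
    exact K.ne_of_spread h rfl
  have hqW : q ∉ fullVerts G ∪ X := fun h => by
    obtain ⟨_, _, _, h, -⟩ := hgood q h
    exact K.not_adj_of_spread h hq.symm
  have hdisj : Disjoint (fullVerts G) X := by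
    rw [Finset.disjoint_left]
    intro w hw hwX
    have hs := ht w (Finset.mem_filter.1 hwX).1
    exact hs.2 (adj_of_mem_fullVerts hw hs.1.adj_a hs.1.adj_c hs.1.ne)
  let F : Finset (Sym2 V) := {e | e ∈ G.edgeSet ∧ ∀ w ∈ fullVerts G ∪ X, w ∉ e}
  have hFmem : ∀ e, e ∈ F ↔ e ∈ G.edgeSet ∧ ∀ w ∈ fullVerts G ∪ X, w ∉ e := fun e => by simp [F]
  let U : Finset V := Finset.univ \ insert p (fullVerts G ∪ X)
  have hUmem : ∀ v, v ∈ U ↔ v ≠ p ∧ v ∉ fullVerts G ∪ X := fun v => by simp [U]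
  have hUcard : U.card + (1 + (fullVerts G).card + X.card) = Fintype.card V := by
    have := Finset.card_sdiff_add_card_eq_card (Finset.subset_univ (insert p (fullVerts G ∪ X)))
    rw [Finset.card_insert_of_notMem hpW, Finset.card_union_of_disjoint hdisj] at this
    rw [← Finset.card_univ, ← this]
    simp only [U]
    omega
  have hF : 2 * U.card < F.card := by
    by_contra! hle
    obtain ⟨S, hSU, hS, tail, h1, h2⟩ := exists_tail F (fun e v => v ∈ e) U.card U rfl
      ⟨q, (hUmem q).2 ⟨hq.ne', hqW⟩⟩ (by
        refine le_trans (Finset.card_le_card ?_) hle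
        intro e he
        simp only [Finset.mem_filter] at he
        exact he.1)
    refine K.false_of_tail hf hpW (S := S) (fun h => ((hUmem p).1 (hSU h)).1 rfl) ?_ hS hind hgood
      (tail := tail) (fun e he heW hv => h1 e ((hFmem e).2 ⟨he, heW⟩) hv) (fun v => ?_)
    · rw [Finset.disjoint_right]
      exact fun v hv => ((hUmem v).1 (hSU hv)).2
    · refine le_trans (le_of_eq ?_) (h2 v)
      rw [← Set.ncard_coe_finset]
      congr 1
      ext e
      simp [hFmem]
  let D : Finset (Sym2 V) := X.biUnion fun x => (G.neighborSet x).toFinset.image fun y => s(x, y)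
  have hXpath : ∀ x ∈ X, x ∈ pathVerts G := fun x hx => (Finset.mem_filter.1 hx).1
  have hDmem : ∀ e, e ∈ D ↔ ∃ x ∈ X, ∃ y, G.Adj x y ∧ s(x, y) = e := fun e => by simp [D]
  have hD : D.card = 3 * X.card := by
    rw [Finset.card_biUnion]
    · rw [Finset.sum_congr rfl fun x hx => ?_, Finset.sum_const, smul_eq_mul, mul_comm]
      rw [Finset.card_image_of_injective _ fun y z h => Sym2.congr_right.1 h,
        ← Set.ncard_eq_toFinset_card']
      exact (ht x (hXpath x hx)).1.ncard
    · intro x hx y hy hxy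
      change Disjoint _ _
      rw [Finset.disjoint_left]
      intro e he he'
      simp only [Finset.mem_image, Set.mem_toFinset, SimpleGraph.mem_neighborSet] at he he'
      obtain ⟨n, hn, rfl⟩ := he
      obtain ⟨m, hm, h⟩ := he'
      rcases Sym2.eq_iff.1 h with ⟨h1, -⟩ | ⟨rfl, rfl⟩
      · exact hxy h1.symm
      · exact hind _ (Finset.mem_union_right _ hx) _ (Finset.mem_union_right _ hy) hn
  have hFD : Disjoint F D := by
    rw [Finset.disjoint_right]
    intro e he he'
    obtain ⟨x, hx, y, -, rfl⟩ := (hDmem e).1 he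
    exact ((hFmem _).1 he').2 x (Finset.mem_union_right _ hx) (by simp)
  have hsub : ((F ∪ D : Finset (Sym2 V)) : Set (Sym2 V)) ⊆
      {e : Sym2 V | e ∈ G.edgeSet ∧ ∀ w ∈ fullVerts G, w ∉ e} := by
    intro e he
    rcases Finset.mem_union.1 (Finset.mem_coe.1 he) with he | he
    · have := (hFmem e).1 he
      exact ⟨this.1, fun w hw => this.2 w (Finset.mem_union_left _ hw)⟩
    · obtain ⟨x, hx, y, hxy, rfl⟩ := (hDmem e).1 he
      refine ⟨hxy, fun w hw hwe => ?_⟩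
      rcases Sym2.mem_iff.1 hwe with rfl | rfl
      · exact Finset.disjoint_left.1 hdisj hw hx
      · exact hind _ (Finset.mem_union_right _ hx) _ (Finset.mem_union_left _ hw) hxy
  have := Set.ncard_le_ncard hsub (Set.toFinite _)
  rw [Set.ncard_coe_finset, Finset.card_union_of_disjoint hFD, hD] at this
  omega

end SparseCritical

end ChoosSep

namespace ChoosSep

open Classical

section transfer

variable {V V' : Type} {G : SimpleGraph V} {H : SimpleGraph V'}

theorem HasCycleLen.map {n : ℕ} (h : HasCycleLen H n) (φ : H →g G)
    (hφ : Function.Injective φ) : HasCycleLen G n := by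
  obtain ⟨v, c, hc, hn⟩ := h
  exact ⟨φ v, c.map φ, hc.map hφ, by rw [SimpleGraph.Walk.length_map, hn]⟩

/-- A plane embedding restricts along an injective homomorphism. -/
def PlaneEmb.restrict (E : PlaneEmb G) (φ : H →g G) (hφ : Function.Injective φ) : PlaneEmb H where
  pos v := E.pos (φ v)
  inj := E.inj.comp hφ
  edges_meet a b c d hab hcd hne := E.edges_meet (φ.map_adj hab) (φ.map_adj hcd) fun h =>
    hne (Sym2.map.injective hφ (by simpa using h))
  vertex_off a b v hab ha hb := E.vertex_off (φ.map_adj hab) (hφ.ne ha) (hφ.ne hb)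

end transfer

namespace SparseCritical

variable {V : Type} [Fintype V] {G : SimpleGraph V} {p : V} {L : V → Finset ℕ}

theorem spread_of_ncard (K : SparseCritical G p L) {v a b c : V}
    (h3 : {x | G.Adj v x ∧ x ∉ fullVerts G}.ncard = 3) (ha : G.Adj v a) (hb : G.Adj v b)
    (hc : G.Adj v c) (haf : a ∉ fullVerts G) (hbf : b ∉ fullVerts G) (hcf : c ∉ fullVerts G)
    (hab : G.Adj a b) (hbc : G.Adj b c) (hac : a ≠ c) : Spread G v a b c := by
  have heq : ({a, b, c} : Set V) = {x | G.Adj v x ∧ x ∉ fullVerts G} := by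
    refine Set.eq_of_subset_of_ncard_le ?_ ?_ (Set.toFinite _)
    · rintro x (rfl | rfl | rfl)
      exacts [⟨ha, haf⟩, ⟨hb, hbf⟩, ⟨hc, hcf⟩]
    · rw [h3, Set.ncard_eq_three.2 ⟨a, b, c, hab.ne, hac, hbc.ne, rfl⟩]
  have hmem : ∀ x, G.Adj v x → x ∉ fullVerts G → x = a ∨ x = b ∨ x = c := by
    intro x h1 h2
    have : x ∈ ({a, b, c} : Set V) := by rw [heq]; exact ⟨h1, h2⟩
    exact this
  have hnof : ∀ k, G.Adj v k → k ∉ fullVerts G := by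
    intro k hk hkf
    have hadj : ∀ y, G.Adj k y → y ≠ v → y = a ∨ y = b ∨ y = c := by
      intro y hy hyv
      refine hmem y (adj_of_mem_fullVerts hkf hk.symm hy hyv.symm) fun hyf => ?_
      obtain ⟨_, _, _, h, -⟩ := mem_fullVerts.1 hkf
      obtain ⟨_, _, _, h', -⟩ := mem_fullVerts.1 hyf
      exact K.not_adj_spread h h' hy
    have hpair : ∃ y z, G.Adj k y ∧ G.Adj k z ∧ y ≠ v ∧ z ≠ v ∧ y ≠ z := by
      obtain ⟨x, y, z, h, -⟩ := mem_fullVerts.1 hkf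
      have h1 := h.adj₁.ne
      have h2 := h.adj₂.ne
      have h3 := h.ne
      rcases (h.adj_iff v).1 hk.symm with rfl | rfl | rfl
      · exact ⟨y, z, h.adj_b, h.adj_c, h1.symm, h3.symm, h2⟩
      · exact ⟨x, z, h.adj_a, h.adj_c, h1, h2.symm, h3⟩
      · exact ⟨x, y, h.adj_a, h.adj_b, h3, h2, h1⟩
    obtain ⟨y, z, hy, hz, hyv, hzv, hyz⟩ := hpair
    have hyz' : G.Adj y z := adj_of_mem_fullVerts hkf hy hz hyz
    have key : ∀ y z t, G.Adj k y → y ≠ v → G.Adj y z → G.Adj z t → G.Adj v t → z ≠ v → y ≠ t →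
        t ∉ fullVerts G → z ≠ k → False := by
      intro y z t h1 h2 h3 h4 h5 h6 h7 h8 h9
      exact K.no5 (hasCycleLen_five hk h1 h3 h4 h5.symm h2.symm h6.symm h9.symm
        (fun h => h8 (h ▸ hkf)) h7)
    rcases hadj y hy hyv with rfl | rfl | rfl <;> rcases hadj z hz hzv with rfl | rfl | rfl
    · exact hyz rfl
    · exact key _ _ c hy hyv hyz' hbc hc hzv hac hcf hz.ne'
    · exact key _ _ b hy hyv hyz' hbc.symm hb hzv hab.ne hbf hz.ne'
    · exact key _ _ c hz hzv hyz'.symm hbc hc hyv hac hcf hy.ne'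
    · exact hyz rfl
    · exact key _ _ a hz hzv hyz'.symm hab.symm ha hyv hac.symm haf hy.ne'
    · exact key _ _ b hz hzv hyz'.symm hbc.symm hb hyv hab.ne hbf hy.ne'
    · exact key _ _ a hy hyv hyz' hab.symm ha hzv hac.symm haf hz.ne'
    · exact hyz rfl
  refine ⟨?_, hac, hab, hbc⟩
  rw [heq]
  ext x
  exact ⟨fun h => ⟨h, hnof x h⟩, fun h => h.1⟩

theorem false_of_planeEmb (K : SparseCritical G p L) (E : PlaneEmb G)
    (no6 : ¬ HasCycleLen G 6) (hdeg : 2 ≤ (G.neighborSet p).ncard) : False := by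
  let s : Set V := {v | v ∉ fullVerts G}
  let H : SimpleGraph s := G.induce s
  have hHadj : ∀ u v : s, H.Adj u v ↔ G.Adj u v := fun u v => Iff.rfl
  let φ : H →g G := ⟨Subtype.val, fun h => h⟩
  have hφ : Function.Injective φ := Subtype.val_injective
  obtain ⟨P, D⟩ := (E.restrict φ hφ).exists_complexDrawing
  obtain ⟨R, hR⟩ := D.exists_rotation
  have hps : p ∈ s := fun h => by
    obtain ⟨_, _, _, h, -⟩ := mem_fullVerts.1 h
    exact K.ne_of_spread h rfl
  have : Nonempty s := ⟨⟨p, hps⟩⟩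
  have hEuler := R.euler hR
  have hdegH : ∀ v : s, deg H v = {x | G.Adj v x ∧ x ∉ fullVerts G}.ncard := by
    intro v
    rw [deg, ← Set.ncard_image_of_injective _ Subtype.val_injective]
    congr 1
    ext x
    constructor
    · rintro ⟨y, hy, rfl⟩
      exact ⟨hy, y.2⟩
    · rintro ⟨h1, h2⟩
      exact ⟨⟨x, h2⟩, h1, rfl⟩
  let X : Finset s := {v | v.1 ∈ pathVerts G}
  have hspread : ∀ {v a b c : s}, deg H v = 3 → H.Adj v a → H.Adj v b → H.Adj v c → H.Adj a b →
      H.Adj b c → a ≠ c → Spread G v a b c := fun {v a b c} h3 ha hb hc hab hbc hac =>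
    K.spread_of_ncard (by rw [← hdegH]; exact h3) ha hb hc a.2 b.2 c.2 hab hbc
      fun h => hac (Subtype.ext h)
  have C : Config R ⟨p, hps⟩ X := by
    refine ⟨fun h => K.no5 (h.map φ hφ), fun h => no6 (h.map φ hφ), ?_, fun v hv => ?_,
      fun u w h1 h2 h3 => K.not_triangle h1 h2 h3, fun v a b c hv h3 ha hb hc hab hbc hac => ?_,
      fun v a b c hv h3 ha hb hc hab hbc hac => ?_⟩
    · rw [hdegH]
      refine hdeg.trans (Set.ncard_le_ncard (fun x hx => ⟨hx, fun h => ?_⟩) (Set.toFinite _))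
      obtain ⟨_, _, _, h, -⟩ := mem_fullVerts.1 h
      exact K.not_adj_of_spread h (SimpleGraph.Adj.symm hx)
    · rw [hdegH]
      exact K.three_le_ncard_compl_fullVerts (fun h => hv (Subtype.ext h)) v.2
    · exact v.2 (mem_fullVerts.2 ⟨a, b, c, hspread h3 ha hb hc hab hbc hac.ne, hac⟩)
    · have hs := hspread h3 ha hb hc hab hbc hac
      simp only [X, Finset.mem_filter, Finset.mem_univ, true_and]
      refine mem_pathVerts.2 ⟨a, b, c, hs, fun hac' => v.2 (mem_fullVerts.2 ⟨a, b, c, hs, hac'⟩)⟩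
  have hq : ∃ q, G.Adj p q := by
    by_contra! h
    have : G.neighborSet p = ∅ := by ext x; simpa using h x
    rw [this] at hdeg
    simp at hdeg
  obtain ⟨q, hq⟩ := hq
  have hdens := K.density hq
  refine C.false_of_euler hEuler ?_
  have hX : X.card ≤ (pathVerts G).card :=
    Finset.card_le_card_of_injOn Subtype.val (fun x hx => by
      have := Finset.mem_coe.1 hx
      simpa [X] using this) Subtype.val_injective.injOn
  have hcard : Fintype.card s + (fullVerts G).card = Fintype.card V := by
    have h1 : Fintype.card s = (Finset.univ \ fullVerts G).card := by
      rw [← Set.toFinset_card]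
      congr 1
      ext x
      simp [s]
    rw [h1, Finset.card_sdiff_add_card_eq_card (Finset.subset_univ _), Finset.card_univ]
  have hedge : {e : Sym2 V | e ∈ G.edgeSet ∧ ∀ w ∈ fullVerts G, w ∉ e}.ncard ≤
      H.edgeFinset.card := by
    rw [← Set.ncard_coe_finset, SimpleGraph.coe_edgeFinset]
    refine (Set.ncard_le_ncard (t := Sym2.map Subtype.val '' H.edgeSet) ?_
      (Set.toFinite _)).trans (Set.ncard_image_le (Set.toFinite _))
    rintro e ⟨he, hef⟩
    induction e with
    | h u v =>
      exact ⟨s(⟨u, fun h => hef u h (by simp)⟩, ⟨v, fun h => hef v h (by simp)⟩), he, rfl⟩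
  have hdart := H.dart_card_eq_twice_card_edges
  simp only [Fintype.card_eq_nat_card] at *
  omega

end SparseCritical

end ChoosSep

namespace ChoosSep

/-- The number of vertices plus the number of darts. -/
noncomputable def size {V : Type} (G : SimpleGraph V) : ℕ :=
  Nat.card V + {q : V × V | G.Adj q.1 q.2}.ncard

theorem size_lt_of_card_lt {V W : Type} [Finite V] {G : SimpleGraph V} {H : SimpleGraph W}
    (φ : H →g G) (hφ : Function.Injective φ) (h : Nat.card W < Nat.card V) : size H < size G := by
  refine add_lt_add_of_lt_of_le h ?_
  refine Set.ncard_le_ncard_of_injOn (Prod.map φ φ) (fun q hq => φ.map_adj hq)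
    (hφ.prodMap hφ).injOn (Set.toFinite _)

theorem size_deleteEdges_lt {V : Type} [Finite V] {G : SimpleGraph V} {u v : V} (h : G.Adj u v) :
    size (G.deleteEdges {s(u, v)}) < size G := by
  refine Nat.add_lt_add_left (Set.ncard_lt_ncard ?_ (Set.toFinite _)) _
  refine ⟨fun q hq => (G.deleteEdges_le _) hq, fun hs => ?_⟩
  have := @hs (u, v) h
  simp at this

/-- A `(*,1)`-list assignment with one list of size one and all others of size three. -/
structure Precolored {V : Type} (G : SimpleGraph V) (p : V) (L : V → Finset ℕ) : Prop where
  card_inter_le : ∀ ⦃u v⦄, G.Adj u v → (L u ∩ L v).card ≤ 1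
  card_p : (L p).card = 1
  card_of_ne : ∀ v, v ≠ p → (L v).card = 3

/-- Every smaller graph embedding into `G` is colorable from its precolored assignments. -/
def SmallerColorable {V : Type} (G : SimpleGraph V) : Prop :=
  ∀ (W : Type) [Fintype W] (H : SimpleGraph W) (q : W) (M : W → Finset ℕ) (φ : H →g G),
    Function.Injective φ → size H < size G → Precolored H q M → ColorableWith H M

section

variable {V : Type} [Fintype V] {G : SimpleGraph V} {p : V} {L : V → Finset ℕ}

theorem Precolored.colorable_deleteEdges (P : Precolored G p L) (S : SmallerColorable G)
    {u v : V} (h : G.Adj u v) :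
    ∃ φ : V → ℕ, (∀ v, φ v ∈ L v) ∧
      ∀ ⦃a b⦄, G.Adj a b → s(a, b) ≠ s(u, v) → φ a ≠ φ b := by
  obtain ⟨φ, h1, h2⟩ := S V (G.deleteEdges {s(u, v)}) p L
    (SimpleGraph.Hom.ofLE (G.deleteEdges_le _)) (fun _ _ h => h) (size_deleteEdges_lt h)
    ⟨fun _ _ h => P.card_inter_le (G.deleteEdges_le _ h), P.card_p, P.card_of_ne⟩
  exact ⟨φ, h1, fun a b hab hne => h2 (SimpleGraph.deleteEdges_adj.2 ⟨hab, hne⟩)⟩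

theorem Precolored.exists_eq_of_adj (P : Precolored G p L) (S : SmallerColorable G)
    (hn : ¬ ColorableWith G L) {u v : V} (h : G.Adj u v) :
    ∃ φ : V → ℕ, (∀ v, φ v ∈ L v) ∧ φ u = φ v ∧
      ∀ ⦃a b⦄, G.Adj a b → s(a, b) ≠ s(u, v) → φ a ≠ φ b := by
  obtain ⟨φ, h1, h2⟩ := P.colorable_deleteEdges S h
  refine ⟨φ, h1, ?_, h2⟩
  by_contra hne
  refine hn ⟨φ, h1, fun a b hab => ?_⟩
  by_cases hs : s(a, b) = s(u, v)
  · rcases Sym2.eq_iff.1 hs with ⟨rfl, rfl⟩ | ⟨rfl, rfl⟩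
    · exact hne
    · exact Ne.symm hne
  · exact h2 hab hs

theorem Precolored.card_inter_eq (P : Precolored G p L) (S : SmallerColorable G)
    (hn : ¬ ColorableWith G L) {u v : V} (h : G.Adj u v) : (L u ∩ L v).card = 1 := by
  obtain ⟨φ, h1, he, -⟩ := P.exists_eq_of_adj S hn h
  have : 0 < (L u ∩ L v).card :=
    Finset.card_pos.2 ⟨φ u, Finset.mem_inter.2 ⟨h1 u, he ▸ h1 v⟩⟩
  have := P.card_inter_le h
  omega

theorem Precolored.mem_of_adj (P : Precolored G p L) (S : SmallerColorable G)
    (hn : ¬ ColorableWith G L) {u : V} (h : G.Adj p u) {c : ℕ} (hc : c ∈ L p) : c ∈ L u := by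
  obtain ⟨φ, h1, he, -⟩ := P.exists_eq_of_adj S hn h
  rw [Finset.card_le_one.1 P.card_p.le c hc _ (h1 p), he]
  exact h1 u

theorem Precolored.not_triangle (P : Precolored G p L) (S : SmallerColorable G)
    (hn : ¬ ColorableWith G L) {u w : V} (hu : G.Adj p u) (hw : G.Adj p w) : ¬ G.Adj u w := by
  intro huw
  obtain ⟨φ, h1, he, h2⟩ := P.exists_eq_of_adj S hn huw
  have hpu : φ p ≠ φ u := h2 hu fun h => by
    rcases Sym2.eq_iff.1 h with ⟨h, -⟩ | ⟨h, -⟩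
    · exact hu.ne h
    · exact hw.ne h
  have m1 := P.mem_of_adj S hn hu (h1 p)
  have m2 := P.mem_of_adj S hn hw (h1 p)
  exact hpu (Finset.card_le_one.1 (P.card_inter_le huw) _ (Finset.mem_inter.2 ⟨m1, m2⟩) _
    (Finset.mem_inter.2 ⟨h1 u, he ▸ h1 w⟩))

theorem SmallerColorable.exists_partial (S : SmallerColorable G) {O : Set V} {q : V} (hq : q ∈ O)
    (hO : O ≠ Set.univ) {M : V → Finset ℕ}
    (hM : ∀ u ∈ O, ∀ v ∈ O, G.Adj u v → (M u ∩ M v).card ≤ 1) (hMq : (M q).card = 1)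
    (hM3 : ∀ v ∈ O, v ≠ q → (M v).card = 3) :
    ∃ φ : V → ℕ, (∀ v ∈ O, φ v ∈ M v) ∧ ∀ u ∈ O, ∀ v ∈ O, G.Adj u v → φ u ≠ φ v := by
  classical
  have hlt : size (G.induce O) < size G := by
    refine size_lt_of_card_lt (SimpleGraph.Embedding.induce O).toHom Subtype.val_injective ?_
    rw [Nat.card_coe_set_eq, ← Set.ncard_univ V]
    exact Set.ncard_lt_ncard (Set.ssubset_univ_iff.2 hO) (Set.toFinite _)
  obtain ⟨φ, h1, h2⟩ := S O (G.induce O) ⟨q, hq⟩ (fun v => M v)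
    (SimpleGraph.Embedding.induce O).toHom Subtype.val_injective hlt
    ⟨fun u v h => hM u u.2 v v.2 h, hMq, fun v hv => hM3 v v.2 fun h => hv (Subtype.ext h)⟩
  refine ⟨fun v => if h : v ∈ O then φ ⟨v, h⟩ else 0, fun v hv => ?_, fun u hu v hv h => ?_⟩
  · simpa [hv] using h1 ⟨v, hv⟩
  · simpa [hu, hv] using @h2 ⟨u, hu⟩ ⟨v, hv⟩ h

theorem Precolored.two_le_ncard_neighborSet (P : Precolored G p L) (S : SmallerColorable G)
    (hn : ¬ ColorableWith G L) : 2 ≤ (G.neighborSet p).ncard := by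
  classical
  by_contra hlt
  have hle : (G.neighborSet p).ncard ≤ 1 := by omega
  obtain ⟨c, hc⟩ := Finset.card_pos.1 (P.card_p.symm ▸ one_pos)
  by_cases hV : ∃ q, q ≠ p
  · obtain ⟨q, hqp, hN⟩ : ∃ q, q ≠ p ∧ ∀ x, G.Adj p x → x = q := by
      by_cases hq : ∃ q, G.Adj p q
      · obtain ⟨q, hq⟩ := hq
        exact ⟨q, hq.ne', fun x hx => (Set.ncard_le_one (Set.toFinite _)).1 hle x hx q hq⟩
      · obtain ⟨q, hqp⟩ := hV
        exact ⟨q, hqp, fun x hx => (hq ⟨x, hx⟩).elim⟩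
    obtain ⟨d, hd, hdp⟩ := Finset.exists_mem_notMem_of_card_lt_card
      (by rw [P.card_p, P.card_of_ne q hqp]; norm_num : (L p).card < (L q).card)
    have hsub : ∀ v, Function.update L q {d} v ⊆ L v := fun v => by
      by_cases h : v = q
      · subst h; simpa using hd
      · simp [h]
    obtain ⟨φ, h1, h2⟩ := S.exists_partial (O := {p}ᶜ) (q := q) (M := Function.update L q {d})
      hqp (by simp)
      (fun u _ v _ h => (Finset.card_le_card
        (Finset.inter_subset_inter (hsub u) (hsub v))).trans (P.card_inter_le h))
      (by simp) (fun v hv hvq => by simpa [hvq] using P.card_of_ne v hv)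
    have hφq : φ q ≠ c := by
      have := h1 q hqp
      simp only [Function.update_self, Finset.mem_singleton] at this
      rw [this]
      exact fun h => hdp (h ▸ hc)
    refine hn ⟨Function.update φ p c, fun v => ?_, fun u v h => ?_⟩
    · by_cases hv : v = p
      · subst hv; simpa using hc
      · simpa [hv] using hsub v (h1 v hv)
    · by_cases hu : u = p
      · subst hu
        have := hN v h
        subst this
        simpa [hqp] using hφq.symm
      · by_cases hv : v = p
        · subst hv
          have := hN u h.symm
          subst this
          simpa [hqp] using hφq
        · simpa [hu, hv] using h2 u hu v hv h
  · push Not at hV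
    exact hn ⟨fun _ => c, fun v => hV v ▸ hc, fun u v h => (h.ne ((hV u).trans (hV v).symm)).elim⟩

theorem Precolored.sparseCritical (P : Precolored G p L) (S : SmallerColorable G)
    (hn : ¬ ColorableWith G L) (no5 : ¬ HasCycleLen G 5) : SparseCritical G p L where
  card_inter _ _ h := P.card_inter_eq S hn h
  card_p := P.card_p
  card_of_ne := P.card_of_ne
  exists_partial _ hp hO := S.exists_partial hp hO (fun _ _ _ _ h => P.card_inter_le h) P.card_p
    fun v _ hv => P.card_of_ne v hv
  not_colorable := hn
  no5 := no5
  not_triangle _ _ h1 h2 := P.not_triangle S hn h1 h2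

end

theorem Precolored.colorableWith {V : Type} [Fintype V] {G : SimpleGraph V} {p : V}
    {L : V → Finset ℕ} (P : Precolored G p L) (E : PlaneEmb G)
    (no5 : ¬ HasCycleLen G 5) (no6 : ¬ HasCycleLen G 6) : ColorableWith G L := by
  induction hm : size G using Nat.strong_induction_on generalizing V with
  | _ m ih =>
    subst hm
    have S : SmallerColorable G := fun W _ H q M φ hφ hlt hP =>
      ih _ hlt hP (E.restrict φ hφ) (fun h => no5 (h.map φ hφ)) (fun h => no6 (h.map φ hφ)) rfl
    by_contra hn
    exact (P.sparseCritical S hn no5).false_of_planeEmb E no6 (P.two_le_ncard_neighborSet S hn)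

/-- **Theorem 7 of the paper.** Let `G` be a plane graph without 5-cycles or 6-cycles,
let `p ∈ V(G)`, and let `L` be a `(*,1)`-list assignment with `|L(p)| = 1` and
`|L(v)| = 3` for every other vertex.  Then `G` is `L`-colorable. -/
theorem C5C6free_one_precolored_vertex {V : Type} [Fintype V]
    (G : SimpleGraph V) (E : PlaneEmb G)
    (hC5 : ¬ HasCycleLen G 5) (hC6 : ¬ HasCycleLen G 6)
    (p : V) (L : V → Finset ℕ)
    (hsep : ∀ ⦃u v⦄, G.Adj u v → ((L u) ∩ (L v)).card ≤ 1)
    (hp : (L p).card = 1)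
    (hv : ∀ v, v ≠ p → (L v).card = 3) :
    ColorableWith G L :=
  Precolored.colorableWith ⟨hsep, hp, hv⟩ E hC5 hC6

end ChoosSep
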